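/- Let q be a prime power and 0 < δ < 1/2 with 10/δ an integer. For all sufficiently large ℓ (with 2(1−δ)ℓ an integer) and all n sufficiently large in terms of q and ℓ, the following holds. Let T₁ be a table on Grass_q(n, 2ℓ) and T₂ a table on Grass_q(n, 2(1−δ)ℓ), and suppose T₁ and T₂ are ε-consistent for some ε ≥ q^{−2(1−1000δ)ℓ}. Then there exist subspaces Q ⊆ W ⊆ F_q^n and an F_q-linear function f : W → F_q such that dim(Q) + codim(W) = 10/δ and f restricted to L equals T₁[L] for at least an ε' = q^{−2(1−1000δ²)ℓ} fraction of the subspaces L ∈ Grass_q(n, 2ℓ) with Q ⊆ L ⊆ W. -/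

import Mathlib

open Module

/-- The consistency probability of the `2ℓ`-vs-`m`-dimensional subspace agreement test:
the fraction of pairs `R ⊆ L` with `dim L = ℓ₂`, `dim R = m`, on which `T₁[L]` restricted
to `R` coincides with `T₂[R]`. -/
noncomputable def consistFrac (F : Type) [Field F] (n ℓ₂ m : ℕ)
    (T₁ T₂ : (L : Submodule F (Fin n → F)) → (↥L →ₗ[F] F)) : ℝ :=
  (Nat.card {p : Submodule F (Fin n → F) × Submodule F (Fin n → F) //
      finrank F ↥p.1 = ℓ₂ ∧ finrank F ↥p.2 = m ∧ p.2 ≤ p.1 ∧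
        ∀ (x : Fin n → F) (hx2 : x ∈ p.2) (hx1 : x ∈ p.1),
          T₁ p.1 ⟨x, hx1⟩ = T₂ p.2 ⟨x, hx2⟩} : ℝ) /
    (Nat.card {p : Submodule F (Fin n → F) × Submodule F (Fin n → F) //
      finrank F ↥p.1 = ℓ₂ ∧ finrank F ↥p.2 = m ∧ p.2 ≤ p.1} : ℝ)

set_option linter.unusedSectionVars false

noncomputable section
namespace GrassTest

open scoped BigOperators Classical ComplexConjugate
open Finset Matrix

variable {F : Type} [Field F] [Fintype F]
variable {ι κ : Type} [Fintype ι] [Fintype κ]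

/-- A primitive complex additive character of the finite field `F`. -/
def psi (F : Type) [Field F] [Fintype F] : AddChar F ℂ := AddChar.FiniteField.primitiveChar_to_Complex F

theorem psi_isPrimitive : (psi F).IsPrimitive :=
  AddChar.FiniteField.primitiveChar_to_Complex_isPrimitive F

/-- The character of the space of `ι × κ` matrices attached to a `κ × ι` matrix. -/
def chi (Y : Matrix κ ι F) (M : Matrix ι κ F) : ℂ := psi F (trace (Y * M))

theorem chi_comm (Y : Matrix κ ι F) (M : Matrix ι κ F) : chi Y M = chi M Y := by
  unfold chi; rw [trace_mul_comm]

theorem chi_add_right (Y : Matrix κ ι F) (M N : Matrix ι κ F) :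
    chi Y (M + N) = chi Y M * chi Y N := by
  simp [chi, Matrix.mul_add, AddChar.map_add_eq_mul]

theorem chi_add_left (Y Z : Matrix κ ι F) (M : Matrix ι κ F) :
    chi (Y + Z) M = chi Y M * chi Z M := by
  simp [chi, Matrix.add_mul, AddChar.map_add_eq_mul]

@[simp] theorem chi_zero_left (M : Matrix ι κ F) : chi (0 : Matrix κ ι F) M = 1 := by simp [chi]

theorem conj_chi (Y : Matrix κ ι F) (M : Matrix ι κ F) : conj (chi Y M) = chi (-Y) M := by
  simp [chi, AddChar.map_neg_eq_conj]

theorem chi_neg_mul (Y : Matrix κ ι F) (M : Matrix ι κ F) : chi (-Y) M * chi Y M = 1 := by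
  rw [← chi_add_left]; simp

theorem chi_transpose (Y : Matrix κ ι F) (M : Matrix ι κ F) : chi Yᵀ Mᵀ = chi Y M := by
  unfold chi; rw [← transpose_mul, trace_transpose, trace_mul_comm]

theorem exists_trace_eq {Y : Matrix κ ι F} (hY : Y ≠ 0) (c : F) :
    ∃ M : Matrix ι κ F, trace (Y * M) = c := by
  obtain ⟨a, b, hab⟩ : ∃ a b, Y a b ≠ 0 := by
    by_contra! h; exact hY (by ext a b; simp [h])
  refine ⟨Matrix.single b a ((Y a b)⁻¹ * c), ?_⟩
  rw [Matrix.trace_mul_single]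
  simp [hab]

theorem expect_chi (Y : Matrix κ ι F) : 𝔼 M : Matrix ι κ F, chi Y M = if Y = 0 then 1 else 0 := by
  split_ifs with h
  · subst h; simp
  · obtain ⟨c, hc⟩ : ∃ c, psi F c ≠ 1 := by
      have := psi_isPrimitive (F := F) (one_ne_zero)
      rwa [AddChar.mulShift_one, AddChar.ne_one_iff] at this
    obtain ⟨N, hN⟩ := exists_trace_eq h c
    have h1 : 𝔼 M : Matrix ι κ F, chi Y M = 𝔼 M : Matrix ι κ F, chi Y (N + M) :=
      (Fintype.expect_equiv (Equiv.addLeft N) _ _ (fun _ => rfl)).symm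
    simp_rw [chi_add_right, ← mul_expect] at h1
    have h2 : chi Y N ≠ 1 := by rw [chi, hN]; exact hc
    by_contra h3
    exact h2 (mul_right_cancel₀ h3 (by rw [← h1, one_mul]))

theorem sum_chi (M : Matrix ι κ F) :
    ∑ Y : Matrix κ ι F, chi Y M = if M = 0 then (Fintype.card (Matrix κ ι F) : ℂ) else 0 := by
  have := expect_chi M
  rw [Fintype.expect_eq_sum_div_card] at this
  simp_rw [chi_comm _ M]
  rw [div_eq_iff (by simp)] at this
  rw [this]; split_ifs <;> simp

/-- Fourier coefficient. -/
def ft (f : Matrix ι κ F → ℂ) (Y : Matrix κ ι F) : ℂ := 𝔼 M, f M * chi (-Y) M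

/-- The function with prescribed Fourier coefficients. -/
def synth (c : Matrix κ ι F → ℂ) (M : Matrix ι κ F) : ℂ := ∑ Y, c Y * chi Y M

theorem card_matrix_swap :
    Fintype.card (Matrix κ ι F) = Fintype.card (Matrix ι κ F) :=
  Fintype.card_congr (transposeAddEquiv _ _ _).toEquiv

theorem synth_ft (f : Matrix ι κ F → ℂ) : synth (ft f) = f := by
  ext M
  simp only [synth, ft, expect_mul]
  rw [← expect_sum_comm]
  have : ∀ N : Matrix ι κ F, ∑ Y : Matrix κ ι F, f N * chi (-Y) N * chi Y M
      = if N = M then f M * (Fintype.card (Matrix ι κ F) : ℂ) else 0 := by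
    intro N
    have h1 : ∀ Y : Matrix κ ι F, f N * chi (-Y) N * chi Y M = f N * chi Y (M - N) := by
      intro Y
      rw [sub_eq_add_neg, chi_add_right, mul_assoc, mul_comm (chi Y M)]
      congr 2
      simp [chi]
    simp_rw [h1, ← mul_sum, sum_chi, sub_eq_zero, eq_comm (a := M), card_matrix_swap]
    split_ifs with h
    · rw [h]
    · simp
  simp_rw [this]
  rw [Fintype.expect_eq_sum_div_card, sum_ite_eq' univ M]
  simp

theorem ft_synth (c : Matrix κ ι F → ℂ) : ft (synth c) = c := by
  ext Y
  simp only [synth, ft, sum_mul]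
  rw [expect_sum_comm]
  have : ∀ Z : Matrix κ ι F, 𝔼 M : Matrix ι κ F, c Z * chi Z M * chi (-Y) M
      = if Z = Y then c Y else 0 := by
    intro Z
    simp_rw [mul_assoc, ← chi_add_left, ← mul_expect, expect_chi, ← sub_eq_add_neg, sub_eq_zero]
    split_ifs with h
    · rw [h]; simp
    · simp
  simp_rw [this]
  simp

theorem ft_injective {f g : Matrix ι κ F → ℂ} (h : ft f = ft g) : f = g := by
  rw [← synth_ft f, h, synth_ft]

theorem inversion (f : Matrix ι κ F → ℂ) (M : Matrix ι κ F) : f M = ∑ Y, ft f Y * chi Y M :=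
  (congrFun (synth_ft f) M).symm

theorem parseval_inner (f g : Matrix ι κ F → ℂ) :
    𝔼 M, f M * conj (g M) = ∑ Y, ft f Y * conj (ft g Y) := by
  have h : ∀ M, f M * conj (g M) = ∑ Y, f M * chi (-Y) M * conj (ft g Y) := by
    intro M
    conv_lhs => rw [inversion g M]
    rw [map_sum, mul_sum]
    refine sum_congr rfl fun Y _ => ?_
    rw [map_mul, conj_chi]; ring
  simp_rw [h]
  rw [expect_sum_comm]
  simp_rw [← expect_mul]
  rfl

/-- The `p`-th moment of a function under the uniform measure. -/
def moment (p : ℕ) (f : Matrix ι κ F → ℂ) : ℝ := 𝔼 M, ‖f M‖ ^ p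

theorem moment_nonneg (p : ℕ) (f : Matrix ι κ F → ℂ) : 0 ≤ moment p f :=
  expect_nonneg fun _ _ => by positivity

theorem parseval (f : Matrix ι κ F → ℂ) : moment 2 f = ∑ Y, ‖ft f Y‖ ^ 2 := by
  have h := parseval_inner f f
  simp_rw [Complex.mul_conj, Complex.normSq_eq_norm_sq] at h
  have h2 : ((moment 2 f : ℝ) : ℂ) = ((∑ Y, ‖ft f Y‖ ^ 2 : ℝ) : ℂ) := by
    rw [Complex.ofReal_sum, ← h, moment, Fintype.expect_eq_sum_div_card, Fintype.expect_eq_sum_div_card]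
    push_cast; rfl
  exact_mod_cast h2

theorem ft_add (f g : Matrix ι κ F → ℂ) : ft (f + g) = ft f + ft g := by
  ext Y; simp [ft, add_mul, expect_add_distrib]

theorem ft_smul (c : ℂ) (f : Matrix ι κ F → ℂ) : ft (c • f) = c • ft f := by
  ext Y; simp [ft, mul_expect, mul_assoc]

theorem ft_zero : ft (0 : Matrix ι κ F → ℂ) = 0 := by
  ext Y; simp [ft]

theorem ft_neg (f : Matrix ι κ F → ℂ) : ft (-f) = -ft f := by
  rw [← neg_one_smul ℂ f, ft_smul, neg_one_smul]

theorem ft_sub (f g : Matrix ι κ F → ℂ) : ft (f - g) = ft f - ft g := by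
  rw [sub_eq_add_neg, ft_add, ft_neg, sub_eq_add_neg]

theorem ft_mul (f g : Matrix ι κ F → ℂ) (X : Matrix κ ι F) :
    ft (f * g) X = ∑ Y, ft f Y * ft g (X - Y) := by
  simp only [ft]
  have h : ∀ M, (f * g) M * chi (-X) M = ∑ Y, ft f Y * (g M * chi (-(X - Y)) M) := by
    intro M
    rw [Pi.mul_apply, inversion f M, sum_mul, sum_mul]
    refine sum_congr rfl fun Y _ => ?_
    rw [show -(X - Y) = Y + -X by abel, chi_add_left]; ring
  simp_rw [h]
  rw [expect_sum_comm]
  simp_rw [← mul_expect]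
  rfl

/-- Restriction of the Fourier expansion to the frequencies satisfying `p`. -/
def proj (p : Matrix κ ι F → Prop) (f : Matrix ι κ F → ℂ) : Matrix ι κ F → ℂ :=
  synth fun Y => if p Y then ft f Y else 0

theorem ft_proj (p : Matrix κ ι F → Prop) (f : Matrix ι κ F → ℂ) (Y : Matrix κ ι F) :
    ft (proj p f) Y = if p Y then ft f Y else 0 := by
  rw [proj, ft_synth]

theorem proj_proj (p r : Matrix κ ι F → Prop) (f : Matrix ι κ F → ℂ) :
    proj p (proj r f) = proj (fun Y => p Y ∧ r Y) f := by
  apply ft_injective; ext Y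
  simp only [ft_proj]; split_ifs <;> tauto

theorem proj_true {p : Matrix κ ι F → Prop} {f : Matrix ι κ F → ℂ} (h : ∀ Y, ft f Y ≠ 0 → p Y) :
    proj p f = f := by
  apply ft_injective; ext Y
  rw [ft_proj]; split_ifs with h1
  · rfl
  · by_contra h2; exact h1 (h Y (Ne.symm h2))

theorem moment_two_proj (p : Matrix κ ι F → Prop) (f : Matrix ι κ F → ℂ) :
    moment 2 (proj p f) = ∑ Y, if p Y then ‖ft f Y‖ ^ 2 else 0 := by
  rw [parseval]
  refine sum_congr rfl fun Y _ => ?_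
  rw [ft_proj]; split_ifs <;> simp

theorem inner_proj (p : Matrix κ ι F → Prop) (f : Matrix ι κ F → ℂ) :
    𝔼 M, f M * conj (proj p f M) = (moment 2 (proj p f) : ℂ) := by
  rw [parseval_inner, moment_two_proj]
  push_cast
  refine sum_congr rfl fun Y _ => ?_
  rw [ft_proj]; split_ifs
  · rw [Complex.mul_conj, Complex.normSq_eq_norm_sq]
  · simp

/-- The composition of a function with the affine map `M ↦ T + P' * M * P`. -/
def res (T : Matrix ι κ F) (P : Matrix κ κ F) (P' : Matrix ι ι F) (f : Matrix ι κ F → ℂ) :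
    Matrix ι κ F → ℂ := fun M => f (T + P' * M * P)

theorem chi_res (Y : Matrix κ ι F) (T M : Matrix ι κ F) (P : Matrix κ κ F) (P' : Matrix ι ι F) :
    chi Y (T + P' * M * P) = chi Y T * chi (P * Y * P') M := by
  rw [chi_add_right]; congr 1
  unfold chi
  rw [← Matrix.mul_assoc, trace_mul_comm, ← Matrix.mul_assoc, ← Matrix.mul_assoc]

theorem ft_res (T : Matrix ι κ F) (P : Matrix κ κ F) (P' : Matrix ι ι F) (f : Matrix ι κ F → ℂ)
    (X : Matrix κ ι F) :
    ft (res T P P' f) X = ∑ Y, if P * Y * P' = X then ft f Y * chi Y T else 0 := by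
  have : res T P P' f = synth (fun X => ∑ Y, if P * Y * P' = X then ft f Y * chi Y T else 0) := by
    ext M
    rw [res, inversion f, synth]
    simp_rw [sum_mul, ite_mul, zero_mul]
    rw [sum_comm]
    simp_rw [sum_ite_eq, mem_univ, if_true, chi_res, mul_assoc]
  rw [this, ft_synth]

theorem proj_res (p : Matrix κ ι F → Prop) (T : Matrix ι κ F) (P : Matrix κ κ F) (P' : Matrix ι ι F)
    (f : Matrix ι κ F → ℂ) :
    proj p (res T P P' f) = res T P P' (proj (fun Y => p (P * Y * P')) f) := by
  apply ft_injective; ext X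
  rw [ft_proj, ft_res, ft_res]
  simp_rw [ft_proj]
  split_ifs with h
  · refine sum_congr rfl fun Y _ => ?_
    split_ifs with h1 h2 <;> simp_all
  · symm; apply sum_eq_zero; intro Y _
    split_ifs with h1 h2 <;> simp_all

theorem res_res (T T₁ : Matrix ι κ F) (P P₁ : Matrix κ κ F) (P' P₁' : Matrix ι ι F)
    (f : Matrix ι κ F → ℂ) :
    res T₁ P₁ P₁' (res T P P' f) = res (T + P' * T₁ * P) (P₁ * P) (P' * P₁') f := by
  ext M; simp only [res]; congr 1
  simp only [Matrix.mul_add, Matrix.add_mul, Matrix.mul_assoc, add_assoc]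

theorem res_add (T : Matrix ι κ F) (P : Matrix κ κ F) (P' : Matrix ι ι F) (f g : Matrix ι κ F → ℂ) :
    res T P P' (f + g) = res T P P' f + res T P P' g := rfl

theorem expect_moment_res (p : ℕ) (P : Matrix κ κ F) (P' : Matrix ι ι F) (f : Matrix ι κ F → ℂ) :
    𝔼 T, moment p (res T P P' f) = moment p f := by
  simp only [moment, res]
  rw [expect_comm]
  have : ∀ M : Matrix ι κ F, 𝔼 T : Matrix ι κ F, ‖f (T + P' * M * P)‖ ^ p = moment p f := by
    intro M
    exact Fintype.expect_equiv (Equiv.addRight (P' * M * P)) _ _ (fun _ => rfl)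
  simp_rw [this]
  simp [moment]

/-- The function on transposed matrices. -/
def tr (f : Matrix ι κ F → ℂ) : Matrix κ ι F → ℂ := fun N => f Nᵀ

@[simp] theorem tr_tr (f : Matrix ι κ F → ℂ) : tr (tr f) = f := rfl

theorem ft_tr (f : Matrix ι κ F → ℂ) (Y : Matrix ι κ F) : ft (tr f) Y = ft f Yᵀ := by
  refine Fintype.expect_equiv (transposeAddEquiv _ _ _).toEquiv _ _ (fun N => ?_)
  change f Nᵀ * chi (-Y) N = f Nᵀ * chi (-Yᵀ) Nᵀ
  rw [← transpose_neg, chi_transpose]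

theorem moment_tr (p : ℕ) (f : Matrix ι κ F → ℂ) : moment p (tr f) = moment p f :=
  Fintype.expect_equiv (transposeAddEquiv _ _ _).toEquiv _ _ (fun _ => rfl)

theorem tr_proj (p : Matrix κ ι F → Prop) (f : Matrix ι κ F → ℂ) :
    tr (proj p f) = proj (fun Y => p Yᵀ) (tr f) := by
  apply ft_injective; ext Y; rw [ft_tr, ft_proj, ft_proj, ft_tr]

theorem tr_res (T : Matrix ι κ F) (P : Matrix κ κ F) (P' : Matrix ι ι F) (f : Matrix ι κ F → ℂ) :
    tr (res T P P' f) = res Tᵀ P'ᵀ Pᵀ (tr f) := by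
  ext M; simp [tr, res, transpose_mul, Matrix.mul_assoc]

/-- The vector `u` lies in the column space of `Y`. -/
def InIm (u : κ → F) (Y : Matrix κ ι F) : Prop := ∃ x, Y *ᵥ x = u

theorem inIm_iff (u : κ → F) (Y : Matrix κ ι F) :
    InIm u Y ↔ u ∈ LinearMap.range Y.mulVecLin := by
  simp [InIm, LinearMap.mem_range]

theorem rank_add_le (A B : Matrix κ ι F) : (A + B).rank ≤ A.rank + B.rank := by
  unfold Matrix.rank
  refine le_trans (Submodule.finrank_mono ?_)
    (Submodule.finrank_add_le_finrank_add_finrank _ _)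
  rintro _ ⟨x, rfl⟩
  simp only [mulVecLin_apply, add_mulVec]
  exact Submodule.add_mem_sup ⟨x, rfl⟩ ⟨x, rfl⟩

theorem rank_vecMulVec_le_one (u : κ → F) (v : ι → F) : (vecMulVec u v).rank ≤ 1 :=
  Matrix.rank_vecMulVec_le u v

/-- The linear functionals, written as vectors, taking the value `1` at `u`. -/
def slice (u : κ → F) : Finset (κ → F) := univ.filter fun l => l ⬝ᵥ u = 1

theorem mem_slice {u l : κ → F} : l ∈ slice u ↔ l ⬝ᵥ u = 1 := by simp [slice]

theorem slice_nonempty {u : κ → F} (hu : u ≠ 0) : (slice u).Nonempty := by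
  obtain ⟨a, ha⟩ := Function.ne_iff.mp hu
  exact ⟨Pi.single a (u a)⁻¹, by rw [mem_slice, single_dotProduct]; exact inv_mul_cancel₀ ha⟩

/-- A nonzero functional on a subspace takes the value one at a `1/q` fraction of points. -/
theorem card_level_one {V : Type} [AddCommGroup V] [Module F V] [Fintype V]
    (K : Submodule F V) (g : V →ₗ[F] F) {x₀ : V} (hx : x₀ ∈ K) (hg : g x₀ ≠ 0) :
    Fintype.card F * #{x : V | x ∈ K ∧ g x = 1} = #{x : V | x ∈ K} := by
  have hsurj : ∀ c : F, c ∈ Set.range (g.comp K.subtype).toAddMonoidHom := fun c =>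
    ⟨(c * (g x₀)⁻¹) • ⟨x₀, hx⟩, by simp [hg]⟩
  have h1 : ∀ c : F, #{x : K | (g.comp K.subtype).toAddMonoidHom x = c}
      = #{x : K | (g.comp K.subtype).toAddMonoidHom x = 1} := fun c =>
    AddMonoidHom.card_fiber_eq_of_mem_range _ (hsurj c) (hsurj 1)
  have h2 : Fintype.card K = ∑ c : F, #{x : K | (g.comp K.subtype).toAddMonoidHom x = c} := by
    rw [← card_univ]
    exact card_eq_sum_card_fiberwise (fun _ _ => mem_coe.2 (mem_univ _))
  simp_rw [h1] at h2
  rw [sum_const, card_univ, smul_eq_mul] at h2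
  have h3 : #{x : V | x ∈ K} = Fintype.card K := (Fintype.card_subtype _).symm
  have h4 : #{x : V | x ∈ K ∧ g x = 1} = #{x : K | (g.comp K.subtype).toAddMonoidHom x = 1} := by
    symm
    refine card_bij (fun x _ => x.1) ?_ ?_ ?_
    · intro x hx
      exact mem_filter.2 ⟨mem_univ _, x.2, (mem_filter.1 hx).2⟩
    · intro x _ y _ h; exact Subtype.ext h
    · intro x hx
      simp only [mem_filter, mem_univ, true_and] at hx
      exact ⟨⟨x, hx.1⟩, mem_filter.2 ⟨mem_univ _, hx.2⟩, rfl⟩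
  rw [h3, h4, h2]

theorem card_filter_vecMul (Y : Matrix κ ι F) :
    #{l : κ → F | l ᵥ* Y = 0} * Fintype.card F ^ Y.rank = Fintype.card F ^ Fintype.card κ := by
  have h1 : #{l : κ → F | l ᵥ* Y = 0} = Fintype.card (LinearMap.ker Yᵀ.mulVecLin) := by
    rw [Fintype.card_subtype]
    congr 1; ext l; simp
  rw [h1, card_eq_pow_finrank (K := F), ← pow_add, ← rank_transpose Y, Matrix.rank, add_comm,
    LinearMap.finrank_range_add_finrank_ker, finrank_fintype_fun_eq_card]

theorem exists_annihilator {u : κ → F} {Y : Matrix κ ι F} (h : ¬ InIm u Y) :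
    ∃ l : κ → F, l ᵥ* Y = 0 ∧ l ⬝ᵥ u ≠ 0 := by
  rw [inIm_iff] at h
  obtain ⟨f, hf, hk⟩ := Submodule.exists_le_ker_of_notMem h
  refine ⟨(dotProductEquiv F κ).symm f, ?_, ?_⟩
  · rw [← dotProduct_eq_zero_iff]
    intro x
    rw [← dotProduct_mulVec]
    have := hk ⟨x, rfl⟩
    rw [LinearMap.mem_ker, mulVecLin_apply] at this
    rw [← this]
    exact DFunLike.congr_fun ((dotProductEquiv F κ).apply_symm_apply f) _
  · have : (dotProductEquiv F κ).symm f ⬝ᵥ u = f u :=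
      DFunLike.congr_fun ((dotProductEquiv F κ).apply_symm_apply f) _
    rwa [this]

theorem expect_slice {u : κ → F} (hu : u ≠ 0) (Y : Matrix κ ι F) :
    (𝔼 l ∈ slice u, if l ᵥ* Y = 0 then (1 : ℝ) else 0)
      = if InIm u Y then 0 else ((Fintype.card F : ℝ) ^ Y.rank)⁻¹ := by
  split_ifs with h
  · apply expect_eq_zero
    intro l hl
    rw [mem_slice] at hl
    obtain ⟨x, rfl⟩ := h
    rw [if_neg]
    intro h0
    rw [dotProduct_mulVec, h0, zero_dotProduct] at hl
    exact zero_ne_one hl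
  · obtain ⟨l₀, h1, h2⟩ := exists_annihilator h
    let g : (κ → F) →ₗ[F] F := dotProductBilin F F |>.flip u
    have hg : ∀ l, g l = l ⬝ᵥ u := fun l => rfl
    have e1 := card_level_one (⊤ : Submodule F (κ → F)) g (x₀ := l₀) trivial (by rwa [hg])
    have e2 := card_level_one (LinearMap.ker Yᵀ.mulVecLin) g (x₀ := l₀)
      (by simp [h1]) (by rwa [hg])
    have e3 := card_filter_vecMul Y
    simp only [LinearMap.mem_ker, mulVecLin_apply, mulVec_transpose, hg, Submodule.mem_top, true_and,
      filter_true, card_univ, Fintype.card_fun] at e1 e2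
    rw [expect_eq_sum_div_card, ← sum_filter, slice, filter_filter, sum_const, nsmul_eq_mul, mul_one]
    have hq : (0 : ℝ) < Fintype.card F := by exact_mod_cast Fintype.card_pos
    have e4 : (0 : ℝ) < #{l : κ → F | l ⬝ᵥ u = 1} := by
      have := slice_nonempty hu
      exact_mod_cast this.card_pos
    rw [div_eq_iff e4.ne', inv_mul_eq_div, eq_div_iff (by positivity)]
    have e5 : Fintype.card F * (#{l : κ → F | l ⬝ᵥ u = 1 ∧ l ᵥ* Y = 0} * Fintype.card F ^ Y.rank)
      = Fintype.card F * #{l : κ → F | l ⬝ᵥ u = 1} := by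
      rw [e1, ← e3, ← e2]
      simp_rw [and_comm (a := _ ⬝ᵥ u = 1)]
      ring
    exact_mod_cast Nat.eq_of_mul_eq_mul_left Fintype.card_pos e5

/-- The rank-one projection killing `u`. -/
def killer (u l : κ → F) : Matrix κ κ F := 1 - vecMulVec u l

theorem killer_mulVec_self {u l : κ → F} (h : l ⬝ᵥ u = 1) : killer u l *ᵥ u = 0 := by
  simp [killer, sub_mulVec, vecMulVec_mulVec, h]

theorem rank_le_rank_killer_mul (u l : κ → F) (Y : Matrix κ ι F) :
    Y.rank ≤ (killer u l * Y).rank + 1 := by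
  have : Y = killer u l * Y + vecMulVec u (l ᵥ* Y) := by
    simp [killer, Matrix.sub_mul, vecMulVec_mul]
  conv_lhs => rw [this]
  exact (rank_add_le _ _).trans (by gcongr; exact rank_vecMulVec_le_one _ _)

theorem rank_le_rank_mul_killer (u l : κ → F) (Y : Matrix ι κ F) :
    Y.rank ≤ (Y * killer u l).rank + 1 := by
  have : Y = Y * killer u l + vecMulVec (Y *ᵥ u) l := by
    simp [killer, Matrix.mul_sub, mul_vecMulVec]
  conv_lhs => rw [this]
  exact (rank_add_le _ _).trans (by gcongr; exact rank_vecMulVec_le_one _ _)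

theorem rank_killer_mul_of_inIm {u l : κ → F} (hl : l ⬝ᵥ u = 1) {Y : Matrix κ ι F} (h : InIm u Y) :
    (killer u l * Y).rank + 1 = Y.rank := by
  refine le_antisymm ?_ (rank_le_rank_killer_mul _ _ _)
  obtain ⟨x, rfl⟩ := h
  have e1 := LinearMap.finrank_range_add_finrank_ker Y.mulVecLin
  have e2 := LinearMap.finrank_range_add_finrank_ker (killer (Y *ᵥ x) l * Y).mulVecLin
  have e3 : finrank F (LinearMap.ker Y.mulVecLin)
      < finrank F (LinearMap.ker (killer (Y *ᵥ x) l * Y).mulVecLin) := by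
    apply Submodule.finrank_lt_finrank_of_lt
    refine lt_of_le_of_ne ?_ ?_
    · intro z hz
      simp only [LinearMap.mem_ker, mulVecLin_apply] at hz ⊢
      rw [← mulVec_mulVec, hz, mulVec_zero]
    · intro heq
      have : x ∈ LinearMap.ker Y.mulVecLin := by
        rw [heq, LinearMap.mem_ker, mulVecLin_apply, ← mulVec_mulVec, killer_mulVec_self hl]
      rw [LinearMap.mem_ker, mulVecLin_apply] at this
      rw [this] at hl
      simp at hl
  unfold Matrix.rank
  omega

theorem rank_killer_mul_of_not_inIm {u l : κ → F} {Y : Matrix κ ι F} (h : ¬ InIm u Y) :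
    (killer u l * Y).rank = Y.rank := by
  refine le_antisymm (rank_mul_le_right _ _) ?_
  have e1 := LinearMap.finrank_range_add_finrank_ker Y.mulVecLin
  have e2 := LinearMap.finrank_range_add_finrank_ker (killer u l * Y).mulVecLin
  have e3 : finrank F (LinearMap.ker (killer u l * Y).mulVecLin)
      ≤ finrank F (LinearMap.ker Y.mulVecLin) := by
    apply Submodule.finrank_mono
    intro z hz
    simp only [LinearMap.mem_ker, mulVecLin_apply] at hz ⊢
    rw [← mulVec_mulVec, killer, sub_mulVec, one_mulVec, vecMulVec_mulVec, sub_eq_zero] at hz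
    by_contra h0
    have hc : l ⬝ᵥ Y *ᵥ z ≠ 0 := fun hc => h0 (by rw [hz, hc]; simp)
    apply h
    refine ⟨(l ⬝ᵥ Y *ᵥ z)⁻¹ • z, ?_⟩
    rw [mulVec_smul]
    nth_rewrite 2 [hz]
    rw [op_smul_eq_smul, smul_smul, inv_mul_cancel₀ hc, one_smul]
  unfold Matrix.rank
  omega

theorem rank_lt_rank_add_vecMulVec {u v l : κ → F} {P : Matrix κ κ F} (hl : l ⬝ᵥ u = 1)
    (hu : P *ᵥ u = 0) (hv : ¬ InIm v P) : P.rank < (P + vecMulVec v l).rank := by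
  have h1 : (P + vecMulVec v l) *ᵥ u = v := by
    simp [add_mulVec, hu, vecMulVec_mulVec, hl]
  apply Submodule.finrank_lt_finrank_of_lt
  refine lt_of_le_of_ne ?_ ?_
  · rintro _ ⟨x, rfl⟩
    refine ⟨x - (l ⬝ᵥ x) • u, ?_⟩
    simp only [mulVecLin_apply, mulVec_sub, mulVec_smul, h1]
    simp [add_mulVec, vecMulVec_mulVec]
  · intro heq
    rw [inIm_iff, heq] at hv
    exact hv ⟨u, h1⟩

theorem exists_not_inIm {P : Matrix κ κ F} (h : P.rank < Fintype.card κ) : ∃ v, ¬ InIm v P := by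
  by_contra! hc
  have : LinearMap.range P.mulVecLin = ⊤ := by
    exact eq_top_iff.2 fun v _ => (inIm_iff v P).1 (hc v)
  rw [Matrix.rank, this, finrank_top, finrank_fintype_fun_eq_card] at h
  exact lt_irrefl _ h

theorem exists_mulVec_eq_zero {P : Matrix κ κ F} (h : P.rank < Fintype.card κ) :
    ∃ u, u ≠ 0 ∧ P *ᵥ u = 0 := by
  have e1 := LinearMap.finrank_range_add_finrank_ker P.mulVecLin
  rw [finrank_fintype_fun_eq_card] at e1
  have : 0 < finrank F (LinearMap.ker P.mulVecLin) := by unfold Matrix.rank at h; omega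
  rw [Module.finrank_pos_iff_exists_ne_zero] at this
  obtain ⟨u, hu⟩ := this
  exact ⟨u, fun h => hu (Subtype.ext h), LinearMap.mem_ker.1 u.2⟩

theorem one_le_card_real : (1 : ℝ) ≤ Fintype.card F := by exact_mod_cast Fintype.card_pos

theorem rank_add_rank_le (A B : Matrix κ κ F) : A.rank + B.rank ≤ (A * B).rank + Fintype.card κ := by
  have e1 := LinearMap.finrank_range_add_finrank_ker A.mulVecLin
  rw [finrank_fintype_fun_eq_card] at e1
  have e2 := LinearMap.finrank_range_add_finrank_ker
    (A.mulVecLin.domRestrict (LinearMap.range B.mulVecLin))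
  have e3 : LinearMap.range (A.mulVecLin.domRestrict (LinearMap.range B.mulVecLin))
      ≤ LinearMap.range (A * B).mulVecLin := by
    rintro _ ⟨⟨_, x, rfl⟩, rfl⟩
    exact ⟨x, by simp⟩
  have e4 : finrank F (LinearMap.ker (A.mulVecLin.domRestrict (LinearMap.range B.mulVecLin)))
      ≤ finrank F (LinearMap.ker A.mulVecLin) := by
    rw [← Submodule.finrank_map_subtype_eq]
    apply Submodule.finrank_mono
    rintro _ ⟨x, hx, rfl⟩
    exact hx
  have e5 := Submodule.finrank_mono e3
  unfold Matrix.rank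
  omega

/-- All Fourier coefficients of `f` sit on frequencies of rank less than `i`. -/
def DegLT (i : ℕ) (f : Matrix ι κ F → ℂ) : Prop := ∀ Y : Matrix κ ι F, i ≤ Y.rank → ft f Y = 0

/-- The part of `f` on frequencies of rank less than `i`. -/
def low (i : ℕ) (f : Matrix ι κ F → ℂ) : Matrix ι κ F → ℂ := proj (fun Y => Y.rank < i) f

/-- The second moments of all restrictions of codimension at most `t` are at most `e`. -/
def Glob (t : ℕ) (e : ℝ) (f : Matrix ι κ F → ℂ) : Prop :=
  ∀ (T : Matrix ι κ F) (P : Matrix κ κ F) (P' : Matrix ι ι F),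
    Fintype.card κ + Fintype.card ι ≤ P.rank + P'.rank + t → moment 2 (res T P P' f) ≤ e

theorem DegLT.rank_lt {i : ℕ} {f : Matrix ι κ F → ℂ} (h : DegLT i f) {Y : Matrix κ ι F}
    (hY : ft f Y ≠ 0) : Y.rank < i := by
  by_contra! h1; exact hY (h Y h1)

theorem degLT_zero_iff {f : Matrix ι κ F → ℂ} (h : DegLT 0 f) : f = 0 := by
  apply ft_injective; ext Y; rw [h Y (Nat.zero_le _), ft_zero]; rfl

theorem degLT_low (i : ℕ) (f : Matrix ι κ F → ℂ) : DegLT i (low i f) := fun Y hY => by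
  rw [low, ft_proj, if_neg (by omega)]

theorem DegLT.proj {i : ℕ} {f : Matrix ι κ F → ℂ} (h : DegLT i f) (p : Matrix κ ι F → Prop) :
    DegLT i (proj p f) := fun Y hY => by
  rw [ft_proj, h Y hY, ite_self]

theorem DegLT.tr {i : ℕ} {f : Matrix ι κ F → ℂ} (h : DegLT i f) : DegLT i (tr f) := fun Y hY => by
  rw [ft_tr]; exact h _ (by rwa [rank_transpose])

theorem exists_of_ft_res_ne_zero {f : Matrix ι κ F → ℂ} {T : Matrix ι κ F} {P : Matrix κ κ F}
    {P' : Matrix ι ι F} {X : Matrix κ ι F} (h : ft (res T P P' f) X ≠ 0) :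
    ∃ Y, ft f Y ≠ 0 ∧ P * Y * P' = X := by
  rw [ft_res] at h
  obtain ⟨Y, -, hY⟩ := exists_ne_zero_of_sum_ne_zero h
  refine ⟨Y, ?_, ?_⟩
  · intro h0; simp [h0] at hY
  · by_contra h0; simp [h0] at hY

theorem DegLT.res {i : ℕ} {f : Matrix ι κ F → ℂ} (h : DegLT i f) (T : Matrix ι κ F)
    (P : Matrix κ κ F) (P' : Matrix ι ι F) : DegLT i (res T P P' f) := fun X hX => by
  by_contra h0
  obtain ⟨Y, hY, rfl⟩ := exists_of_ft_res_ne_zero h0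
  have := h.rank_lt hY
  have h1 := rank_mul_le_left (P * Y) P'
  have h2 := rank_mul_le_right P Y
  omega

theorem DegLT.mul {i j : ℕ} {f g : Matrix ι κ F → ℂ} (hf : DegLT i f) (hg : DegLT j g) :
    DegLT (i + j) (f * g) := fun X hX => by
  rw [ft_mul]
  refine sum_eq_zero fun Y _ => ?_
  by_cases h : i ≤ Y.rank
  · rw [hf Y h, zero_mul]
  · rw [hg (X - Y), mul_zero]
    have := rank_add_le Y (X - Y)
    rw [add_sub_cancel] at this
    omega

theorem Glob.mono {t t' : ℕ} {e e' : ℝ} {f : Matrix ι κ F → ℂ} (h : Glob t e f) (ht : t' ≤ t)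
    (he : e ≤ e') : Glob t' e' f := fun T P P' hP => (h T P P' (by omega)).trans he

theorem Glob.tr {t : ℕ} {e : ℝ} {f : Matrix ι κ F → ℂ} (h : Glob t e f) : Glob t e (tr f) :=
  fun T P P' hP => by
    have := h Tᵀ P'ᵀ Pᵀ (by rw [rank_transpose, rank_transpose]; omega)
    rwa [← moment_tr, tr_res, transpose_transpose, transpose_transpose, transpose_transpose] at this

theorem res_id (f : Matrix ι κ F → ℂ) : res 0 1 1 f = f := by
  ext M; simp [res]

theorem Glob.moment_le {t : ℕ} {e : ℝ} {f : Matrix ι κ F → ℂ} (h : Glob t e f) : moment 2 f ≤ e := by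
  have := h 0 1 1 (by rw [rank_one, rank_one]; omega)
  rwa [res_id] at this

theorem moment_two_add_le (f g : Matrix ι κ F → ℂ) :
    moment 2 (f + g) ≤ 2 * moment 2 f + 2 * moment 2 g := by
  unfold moment
  rw [mul_expect, mul_expect, ← expect_add_distrib]
  refine expect_le_expect fun M _ => ?_
  have := norm_add_le (f M) (g M)
  have h0 := norm_nonneg (f M + g M)
  simp only [Pi.add_apply]
  nlinarith [sq_nonneg (‖f M‖ - ‖g M‖)]

theorem moment_smul (p : ℕ) (c : ℂ) (f : Matrix ι κ F → ℂ) :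
    moment p (c • f) = ‖c‖ ^ p * moment p f := by
  simp [moment, mul_expect, mul_pow]

theorem Glob.add {t : ℕ} {e e' : ℝ} {f g : Matrix ι κ F → ℂ} (hf : Glob t e f) (hg : Glob t e' g) :
    Glob t (2 * e + 2 * e') (f + g) := fun T P P' hP => by
  rw [res_add]
  refine (moment_two_add_le _ _).trans ?_
  have := hf T P P' hP
  have := hg T P P' hP
  linarith

theorem Glob.smul {t : ℕ} {e : ℝ} {f : Matrix ι κ F → ℂ} (hf : Glob t e f) (c : ℂ) :
    Glob t (‖c‖ ^ 2 * e) (c • f) := fun T P P' hP => by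
  change moment 2 (c • res T P P' f) ≤ _
  rw [moment_smul]
  have := hf T P P' hP
  gcongr

theorem Glob.neg {t : ℕ} {e : ℝ} {f : Matrix ι κ F → ℂ} (hf : Glob t e f) :
    Glob t e (-f) := by
  have := hf.smul (-1)
  simpa using this

theorem Glob.res {t s : ℕ} {e : ℝ} {f : Matrix ι κ F → ℂ} (hf : Glob (t + s) e f)
    (T : Matrix ι κ F) (P : Matrix κ κ F) (P' : Matrix ι ι F)
    (hP : Fintype.card κ + Fintype.card ι ≤ P.rank + P'.rank + s) :
    Glob t e (res T P P' f) := fun T₁ P₁ P₁' hP₁ => by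
  rw [res_res]
  apply hf
  have h1 := rank_add_rank_le P₁ P
  have h2 := rank_add_rank_le P' P₁'
  omega

theorem norm_expect_sq_le {α : Type} (s : Finset α) (z : α → ℂ) :
    ‖𝔼 a ∈ s, z a‖ ^ 2 ≤ 𝔼 a ∈ s, ‖z a‖ ^ 2 := by
  rcases s.eq_empty_or_nonempty with rfl | hs
  · simp
  have h1 : ‖𝔼 a ∈ s, z a‖ ≤ 𝔼 a ∈ s, ‖z a‖ := RCLike.norm_expect_le (K := ℂ)
  have h2 := expect_mul_sq_le_sq_mul_sq s (fun a => ‖z a‖) (fun _ => 1)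
  simp only [mul_one, one_pow, expect_const hs] at h2
  exact (pow_le_pow_left₀ (norm_nonneg _) h1 2).trans h2

theorem moment_expect_le {α : Type} (s : Finset α) (g : α → Matrix ι κ F → ℂ) :
    moment 2 (fun M => 𝔼 a ∈ s, g a M) ≤ 𝔼 a ∈ s, moment 2 (g a) := by
  unfold moment
  rw [expect_comm]
  exact expect_le_expect fun M _ => norm_expect_sq_le _ _

/-- Averaging over the rank-one translates `w lᵀ` with `l ⬝ᵥ u = 1`. -/
def avg (u : κ → F) (f : Matrix ι κ F → ℂ) : Matrix ι κ F → ℂ := fun M =>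
  𝔼 l ∈ slice u, 𝔼 w : ι → F, f (M + vecMulVec w l)

theorem expect_chi_vecMulVec (Y : Matrix κ ι F) (l : κ → F) :
    𝔼 w : ι → F, chi Y (vecMulVec w l) = if l ᵥ* Y = 0 then 1 else 0 := by
  have h1 : ∀ w : ι → F, chi Y (vecMulVec w l)
      = chi (Matrix.replicateRow Unit (l ᵥ* Y)) (Matrix.replicateCol Unit w) := by
    intro w
    unfold chi
    rw [mul_vecMulVec, trace_vecMulVec, dotProduct_comm, dotProduct_mulVec]
    congr 1
    simp [trace, Matrix.mul_apply, dotProduct]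
  simp_rw [h1]
  have h2 := expect_chi (Matrix.replicateRow Unit (l ᵥ* Y))
  have h3 : 𝔼 w : ι → F, chi (Matrix.replicateRow Unit (l ᵥ* Y)) (Matrix.replicateCol Unit w)
    = 𝔼 M : Matrix ι Unit F, chi (Matrix.replicateRow Unit (l ᵥ* Y)) M := by
    refine Fintype.expect_equiv ⟨fun w => Matrix.replicateCol Unit w, fun M i => M i (), ?_, ?_⟩ _ _ ?_
    · intro w; rfl
    · intro M; rfl
    · intro w; rfl
  rw [h3]
  refine Eq.trans (by congr!) (h2.trans ?_)
  congr 1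
  rw [eq_iff_iff]
  constructor
  · intro h; ext j; exact congrFun (congrFun h ()) j
  · intro h; rw [h]; rfl

theorem ft_avg {u : κ → F} (hu : u ≠ 0) (f : Matrix ι κ F → ℂ) (Y : Matrix κ ι F) :
    ft (avg u f) Y = ft f Y * if InIm u Y then 0 else ((Fintype.card F : ℂ) ^ Y.rank)⁻¹ := by
  have h0 : ((𝔼 l ∈ slice u, if l ᵥ* Y = 0 then (1 : ℝ) else 0 : ℝ) : ℂ)
      = 𝔼 l ∈ slice u, if l ᵥ* Y = 0 then (1 : ℂ) else 0 := by
    rw [expect_eq_sum_div_card, expect_eq_sum_div_card]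
    push_cast
    congr! 2
    split_ifs <;> simp
  have h1 : (if InIm u Y then 0 else ((Fintype.card F : ℂ) ^ Y.rank)⁻¹)
      = 𝔼 l ∈ slice u, if l ᵥ* Y = 0 then (1 : ℂ) else 0 := by
    rw [← h0, expect_slice hu]
    split_ifs <;> simp
  have h2 : ∀ l w, 𝔼 M, f (M + vecMulVec w l) * chi (-Y) M = ft f Y * chi Y (vecMulVec w l) := by
    intro l w
    rw [ft, expect_mul]
    refine Fintype.expect_equiv (Equiv.addRight (vecMulVec w l)) _ _ fun M => ?_
    simp only [Equiv.coe_addRight]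
    rw [chi_add_right, mul_assoc, mul_assoc, chi_neg_mul, mul_one]
  calc ft (avg u f) Y
      = 𝔼 M, 𝔼 l ∈ slice u, 𝔼 w : ι → F, f (M + vecMulVec w l) * chi (-Y) M := by
        unfold ft avg
        simp_rw [expect_mul]
    _ = 𝔼 l ∈ slice u, 𝔼 w : ι → F, 𝔼 M, f (M + vecMulVec w l) * chi (-Y) M := by
        rw [expect_comm]
        exact expect_congr rfl fun l _ => expect_comm _ _ _
    _ = 𝔼 l ∈ slice u, ft f Y * if l ᵥ* Y = 0 then 1 else 0 := by
        refine expect_congr rfl fun l _ => ?_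
        simp_rw [h2]
        rw [← mul_expect, expect_chi_vecMulVec]
    _ = _ := by rw [← mul_expect, h1]

theorem Glob.avg {t : ℕ} {e : ℝ} {f : Matrix ι κ F → ℂ} (hf : Glob t e f) {u : κ → F} (hu : u ≠ 0) :
    Glob t e (avg u f) := fun T P P' hP => by
  have h : GrassTest.res T P P' (GrassTest.avg u f) = fun M => 𝔼 l ∈ slice u, 𝔼 w : ι → F,
      GrassTest.res (T + vecMulVec w l) P P' f M := by
    ext M
    simp only [GrassTest.res, GrassTest.avg]
    refine expect_congr rfl fun l _ => expect_congr rfl fun w _ => ?_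
    congr 1; abel
  rw [h]
  refine (moment_expect_le _ _).trans (expect_le (slice_nonempty hu) fun l _ => ?_)
  refine (moment_expect_le _ _).trans (expect_le univ_nonempty fun w _ => ?_)
  exact hf _ _ _ hP

theorem moment_res_avg_le {t : ℕ} {e : ℝ} {f : Matrix ι κ F → ℂ} (hf : Glob t e f) {u : κ → F}
    (hu : u ≠ 0) (T : Matrix ι κ F) {P : Matrix κ κ F} (hPu : P *ᵥ u = 0) (P' : Matrix ι ι F)
    (hPr : P.rank < Fintype.card κ)
    (hP : Fintype.card κ + Fintype.card ι ≤ P.rank + P'.rank + (t + 1)) :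
    moment 2 (res T P P' (GrassTest.avg u f)) ≤ e := by
  obtain ⟨v, hv⟩ := exists_not_inIm hPr
  have h : res T P P' (GrassTest.avg u f) = fun M => 𝔼 l ∈ slice u, 𝔼 w : ι → F,
      res (T + vecMulVec w l) (P + vecMulVec v l) P' f M := by
    ext M
    simp only [res, GrassTest.avg]
    refine expect_congr rfl fun l _ => ?_
    refine (Fintype.expect_equiv (Equiv.addRight ((P' * M) *ᵥ v)) _ _ fun w => ?_).symm
    simp only [Equiv.coe_addRight, Matrix.mul_add, mul_vecMulVec, add_vecMulVec]
    congr 1; abel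
  rw [h]
  refine (moment_expect_le _ _).trans (expect_le (slice_nonempty hu) fun l hl => ?_)
  refine (moment_expect_le _ _).trans (expect_le univ_nonempty fun w _ => ?_)
  apply hf
  have := rank_lt_rank_add_vecMulVec (mem_slice.1 hl) hPu hv
  omega

/-- The composition of the first `i` operators `1 - q ^ j • avg u`. -/
def sieve (u : κ → F) : ℕ → (Matrix ι κ F → ℂ) → Matrix ι κ F → ℂ
  | 0, f => f
  | i + 1, f => sieve u i f - ((Fintype.card F : ℂ) ^ i) • avg u (sieve u i f)

theorem ft_sieve {u : κ → F} (hu : u ≠ 0) (i : ℕ) (f : Matrix ι κ F → ℂ) (Y : Matrix κ ι F) :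
    ft (sieve u i f) Y = if InIm u Y then ft f Y else
      ft f Y * ∏ j ∈ range i, (1 - (Fintype.card F : ℂ) ^ j * ((Fintype.card F : ℂ) ^ Y.rank)⁻¹) := by
  induction i with
  | zero => simp [sieve]
  | succ i ih =>
    rw [sieve, ft_sub, ft_smul]
    simp only [Pi.sub_apply, Pi.smul_apply, smul_eq_mul]
    rw [ft_avg hu, ih, prod_range_succ]
    split_ifs
    · simp
    · ring

theorem sieve_eq_proj {u : κ → F} (hu : u ≠ 0) {i : ℕ} {f : Matrix ι κ F → ℂ} (hf : DegLT i f) :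
    sieve u i f = proj (InIm u) f := by
  apply ft_injective; ext Y
  rw [ft_sieve hu, ft_proj]
  split_ifs with h
  · rfl
  · by_cases hY : i ≤ Y.rank
    · rw [hf Y hY, zero_mul]
    · rw [prod_eq_zero (mem_range.2 (not_le.1 hY)), mul_zero]
      rw [mul_inv_cancel₀, sub_self]
      exact pow_ne_zero _ (by exact_mod_cast Fintype.card_ne_zero)

theorem Glob.sieve (F : Type) [Field F] [Fintype F] (i : ℕ) :
    ∃ C : ℝ, 0 ≤ C ∧ ∀ (ι κ : Type) [Fintype ι] [Fintype κ] (u : κ → F),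
    u ≠ 0 → ∀ (t : ℕ) (e : ℝ) (f : Matrix ι κ F → ℂ), Glob t e f → Glob t (C * e) (sieve u i f) := by
  induction i with
  | zero => exact ⟨1, zero_le_one, fun ι κ _ _ u _ t e f h => by simpa [GrassTest.sieve] using h⟩
  | succ i ih =>
    obtain ⟨C, hC, ih⟩ := ih
    refine ⟨2 * C + 2 * (((Fintype.card F : ℝ) ^ i) ^ 2 * C), by positivity,
      fun ι κ _ _ u hu t e f h => ?_⟩
    have h1 := ih ι κ u hu t e f h
    have h2 := h1.add ((h1.avg hu).smul ((Fintype.card F : ℂ) ^ i)).neg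
    rw [GrassTest.sieve, sub_eq_add_neg]
    refine h2.mono le_rfl (le_of_eq ?_)
    simp
    ring

theorem Glob.proj_inIm (F : Type) [Field F] [Fintype F] (i : ℕ) :
    ∃ C : ℝ, 0 ≤ C ∧ ∀ (ι κ : Type) [Fintype ι] [Fintype κ] (u : κ → F),
    u ≠ 0 → ∀ (t : ℕ) (e : ℝ) (f : Matrix ι κ F → ℂ), DegLT i f → Glob t e f →
      Glob t (C * e) (proj (InIm u) f) := by
  obtain ⟨C, hC, h⟩ := Glob.sieve F i
  refine ⟨C, hC, fun ι κ _ _ u hu t e f hf hg => ?_⟩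
  rw [← sieve_eq_proj hu hf]
  exact h ι κ u hu t e f hg

/-- A vector of the column space or of the row space, according to its tag. -/
def Occ : (κ → F) ⊕ (ι → F) → Matrix κ ι F → Prop
  | Sum.inl u, Y => InIm u Y
  | Sum.inr v, Y => InIm v Yᵀ

/-- A tagged vector is nonzero. -/
def TagNZ : (κ → F) ⊕ (ι → F) → Prop
  | Sum.inl u => u ≠ 0
  | Sum.inr v => v ≠ 0

/-- The nonzero vectors of the column space and of the row space. -/
def bag (Y : Matrix κ ι F) : Finset ((κ → F) ⊕ (ι → F)) :=
  univ.filter fun a => TagNZ a ∧ Occ a Y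

theorem card_inIm (Y : Matrix κ ι F) : #{u : κ → F | InIm u Y} = Fintype.card F ^ Y.rank := by
  rw [Matrix.rank, ← card_eq_pow_finrank (K := F), Fintype.card_subtype]
  congr 1

theorem card_bag_le (Y : Matrix κ ι F) : #(bag Y) ≤ 2 * Fintype.card F ^ Y.rank := by
  have h : bag Y ⊆ ({u : κ → F | InIm u Y} : Finset _).disjSum {v : ι → F | InIm v Yᵀ} := by
    intro a ha
    simp only [bag, mem_filter] at ha
    rcases a with u | v
    · simpa [Occ] using ha.2.2
    · simpa [Occ] using ha.2.2
  refine (card_le_card h).trans ?_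
  rw [card_disjSum, card_inIm, card_inIm, rank_transpose, two_mul]

/-- The part of `f` on frequencies whose row and column spaces contain all vectors of `S`. -/
def part (S : Finset ((κ → F) ⊕ (ι → F))) (f : Matrix ι κ F → ℂ) : Matrix ι κ F → ℂ :=
  proj (fun Y => ∀ a ∈ S, Occ a Y) f

theorem part_insert (b : (κ → F) ⊕ (ι → F)) (S : Finset ((κ → F) ⊕ (ι → F)))
    (f : Matrix ι κ F → ℂ) : part (insert b S) f = proj (Occ b) (part S f) := by
  rw [part, part, proj_proj]
  congr 1; ext Y; simp

theorem Glob.proj_occ (F : Type) [Field F] [Fintype F] (i : ℕ) :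
    ∃ C : ℝ, 1 ≤ C ∧ ∀ (ι κ : Type) [Fintype ι] [Fintype κ] (a : (κ → F) ⊕ (ι → F)),
    TagNZ a → ∀ (t : ℕ) (e : ℝ) (f : Matrix ι κ F → ℂ), DegLT i f → Glob t e f →
      Glob t (C * e) (GrassTest.proj (Occ a) f) := by
  obtain ⟨C, hC, h⟩ := Glob.proj_inIm F i
  refine ⟨max 1 C, le_max_left _ _, fun ι κ _ _ a ha t e f hf hg => ?_⟩
  have he : 0 ≤ e := (moment_nonneg _ _).trans hg.moment_le
  have hmono : C * e ≤ max 1 C * e := by gcongr; exact le_max_right _ _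
  rcases a with u | v
  · exact (h ι κ u ha t e f hf hg).mono le_rfl hmono
  · have := (h κ ι v ha t e (GrassTest.tr f) hf.tr hg.tr).tr
    rw [tr_proj, tr_tr] at this
    exact this.mono le_rfl hmono

theorem Glob.part (F : Type) [Field F] [Fintype F] (i m : ℕ) :
    ∃ C : ℝ, 0 ≤ C ∧ ∀ (ι κ : Type) [Fintype ι] [Fintype κ] (S : Finset ((κ → F) ⊕ (ι → F))),
    (∀ a ∈ S, TagNZ a) → #S ≤ m → ∀ (t : ℕ) (e : ℝ) (f : Matrix ι κ F → ℂ), DegLT i f →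
      Glob t e f → Glob t (C * e) (part S f) := by
  obtain ⟨C, hC, h⟩ := Glob.proj_occ F i
  refine ⟨C ^ m, by positivity, fun ι κ _ _ S hS hm t e f hf hg => ?_⟩
  have he : 0 ≤ e := (moment_nonneg _ _).trans hg.moment_le
  have key : Glob t (C ^ #S * e) (GrassTest.part S f) := by
    clear hm
    induction S using Finset.induction_on with
    | empty =>
      have : GrassTest.part ∅ f = f := proj_true (by simp)
      simpa [this] using hg
    | insert b S hb ih =>
      rw [part_insert, card_insert_of_notMem hb, pow_succ', mul_assoc]
      exact h ι κ b (hS b (mem_insert_self _ _)) t _ _ (hf.proj _)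
        (ih fun a ha => hS a (mem_insert_of_mem ha))
  exact key.mono le_rfl (by gcongr)

/-- The range of `A` is contained in that of `B`, and the kernel of `B` in that of `A`. -/
def Sub (A B : Matrix κ ι F) : Prop :=
  (∀ x, InIm (A *ᵥ x) B) ∧ ∀ x, B *ᵥ x = 0 → A *ᵥ x = 0

theorem card_sub_le (B : Matrix κ ι F) :
    #{A : Matrix κ ι F | Sub A B} ≤ Fintype.card F ^ (B.rank * B.rank) := by
  set R := LinearMap.range B.mulVecLin with hR
  have : Finite (R →ₗ[F] R) := Module.finite_of_finite F
  have : Fintype (R →ₗ[F] R) := Fintype.ofFinite _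
  have hc : Fintype.card (R →ₗ[F] R) = Fintype.card F ^ (B.rank * B.rank) := by
    rw [card_eq_pow_finrank (K := F), finrank_linearMap]; rfl
  rw [← hc, ← card_univ]
  refine card_le_card_of_surjOn
    (fun g : R →ₗ[F] R => LinearMap.toMatrix' (R.subtype ∘ₗ g ∘ₗ B.mulVecLin.rangeRestrict)) ?_
  intro A hA
  simp only [coe_filter, mem_univ, true_and, Set.mem_ofPred_eq] at hA
  obtain ⟨s, hs⟩ := LinearMap.exists_rightInverse_of_surjective B.mulVecLin.rangeRestrict
    (LinearMap.range_rangeRestrict _)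
  refine ⟨(A.mulVecLin.codRestrict R fun x => (inIm_iff _ _).1 (hA.1 x)) ∘ₗ s, by simp, ?_⟩
  apply Matrix.toLin'.injective
  rw [Matrix.toLin'_toMatrix']
  apply LinearMap.ext
  intro x
  have h1 : B *ᵥ (s (B.mulVecLin.rangeRestrict x) - x) = 0 := by
    rw [mulVec_sub, sub_eq_zero]
    exact congrArg Subtype.val (LinearMap.congr_fun hs (B.mulVecLin.rangeRestrict x))
  have h2 := hA.2 _ h1
  rw [mulVec_sub, sub_eq_zero] at h2
  simpa using h2

theorem inIm_transpose_of_ker {X : Matrix κ ι F} {φ : ι → F} (h : ∀ x, X *ᵥ x = 0 → φ ⬝ᵥ x = 0) :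
    InIm φ Xᵀ := by
  by_contra hc
  obtain ⟨l, h1, h2⟩ := exists_annihilator hc
  rw [vecMul_transpose] at h1
  exact h2 (by rw [dotProduct_comm]; exact h l h1)

theorem exists_sub_of_good {X Y Z : Matrix κ ι F} (hX : X = Y + Z)
    (h1 : ∀ u, InIm u X → InIm u Y → InIm u Z → u = 0)
    (h2 : ∀ v, InIm v Xᵀ → InIm v Yᵀ → InIm v Zᵀ → v = 0) :
    ∃ A, Sub A X ∧ Sub A Y ∧ Sub (X - A) Z := by
  have hXm : ∀ v, X *ᵥ v = Y *ᵥ v + Z *ᵥ v := fun v => by rw [hX, add_mulVec]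
  set kX := LinearMap.ker X.mulVecLin with hkX
  set kY := LinearMap.ker Y.mulVecLin with hkY
  set kZ := LinearMap.ker Z.mulVecLin with hkZ
  have mX : ∀ x : kX, X *ᵥ (x : ι → F) = 0 := fun x => LinearMap.mem_ker.1 x.2
  have mY : ∀ x : kY, Y *ᵥ (x : ι → F) = 0 := fun x => LinearMap.mem_ker.1 x.2
  have mZ : ∀ x : kZ, Z *ᵥ (x : ι → F) = 0 := fun x => LinearMap.mem_ker.1 x.2
  let Φ : (kX × kY × kZ) →ₗ[F] (ι → F) := kX.subtype.coprod (kY.subtype.coprod kZ.subtype)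
  have hΦ : ∀ a, Φ a = a.1 + (a.2.1 + a.2.2) := fun a => rfl
  have hsurj : LinearMap.range Φ = ⊤ := by
    by_contra hne
    obtain ⟨g, hg0, hg⟩ := Submodule.exists_le_ker_of_lt_top _ (lt_top_iff_ne_top.2 hne)
    set φ := (dotProductEquiv F ι).symm g with hφ
    have hφg : ∀ x, φ ⬝ᵥ x = g x := fun x =>
      DFunLike.congr_fun ((dotProductEquiv F ι).apply_symm_apply g) _
    have : φ = 0 := by
      apply h2
      · exact inIm_transpose_of_ker fun x hx => by
          rw [hφg]; exact hg ⟨(⟨x, hx⟩, 0, 0), by simp [hΦ]⟩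
      · exact inIm_transpose_of_ker fun x hx => by
          rw [hφg]; exact hg ⟨(0, ⟨x, hx⟩, 0), by simp [hΦ]⟩
      · exact inIm_transpose_of_ker fun x hx => by
          rw [hφg]; exact hg ⟨(0, 0, ⟨x, hx⟩), by simp [hΦ]⟩
    apply hg0
    rw [hφ] at this
    simpa using this
  obtain ⟨s, hs⟩ := LinearMap.exists_rightInverse_of_surjective Φ hsurj
  have key : ∀ a : kX × kY × kZ, Φ a = 0 → Y *ᵥ (a.2.2 : ι → F) = 0 ∧ X *ᵥ (a.2.1 : ι → F) = 0 := by
    intro a ha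
    rw [hΦ] at ha
    have ez : (a.2.2 : ι → F) = -a.1 - a.2.1 := by linear_combination (exp := 1) ha
    have ey : (a.2.1 : ι → F) = -a.1 - a.2.2 := by linear_combination (exp := 1) ha
    have e1 : X *ᵥ (a.2.2 : ι → F) = Y *ᵥ (a.2.2 : ι → F) := by rw [hXm, mZ, add_zero]
    have e2 : X *ᵥ (a.2.1 : ι → F) = Z *ᵥ (a.2.1 : ι → F) := by rw [hXm, mY, zero_add]
    have e3 : X *ᵥ (a.2.2 : ι → F) = - X *ᵥ (a.2.1 : ι → F) := by
      rw [ez, mulVec_sub, mulVec_neg, mX]; simp [neg_mulVec]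
    have e4 : Y *ᵥ (a.2.2 : ι → F) = 0 := by
      apply h1
      · exact ⟨_, e1⟩
      · exact ⟨_, rfl⟩
      · refine ⟨-a.2.1, ?_⟩
        rw [mulVec_neg, ← e2, ← e1, e3, neg_mulVec]
    refine ⟨e4, ?_⟩
    rw [← e1, e3, neg_mulVec, neg_eq_zero] at e4
    exact e4
  let A : Matrix κ ι F := LinearMap.toMatrix' (Y.mulVecLin ∘ₗ kZ.subtype ∘ₗ
    LinearMap.snd F kY kZ ∘ₗ LinearMap.snd F kX (kY × kZ) ∘ₗ s)
  have hA0 : ∀ v, A *ᵥ v = Y *ᵥ ((s v).2.2 : ι → F) := fun v => by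
    rw [← Matrix.toLin'_apply, Matrix.toLin'_toMatrix']; rfl
  have hsv : ∀ v, Φ (s v) = v := fun v => LinearMap.congr_fun hs v
  have hA : ∀ a, A *ᵥ Φ a = Y *ᵥ (a.2.2 : ι → F) := fun a => by
    have := (key (s (Φ a) - a) (by rw [map_sub, hsv, sub_self])).1
    simp only [Prod.snd_sub, Submodule.coe_sub, mulVec_sub] at this
    rw [hA0]; exact sub_eq_zero.1 this
  have hXA : ∀ a, (X - A) *ᵥ Φ a = X *ᵥ (a.2.1 : ι → F) := fun a => by
    rw [sub_mulVec, hA, hΦ, mulVec_add, mulVec_add, mX, hXm a.2.2, mZ]; simp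
  refine ⟨A, ⟨fun x => ?_, fun x hx => ?_⟩, ⟨fun x => ?_, fun x hx => ?_⟩, fun x => ?_, fun x hx => ?_⟩
  · exact ⟨(s x).2.2, by rw [hA0, hXm, mZ, add_zero]⟩
  · have := hA (⟨x, hx⟩, 0, 0)
    simpa [hΦ] using this
  · exact ⟨_, (hA0 x).symm⟩
  · have := hA (0, ⟨x, hx⟩, 0)
    simpa [hΦ] using this
  · have := hXA (s x)
    rw [hsv] at this
    exact ⟨(s x).2.1, by rw [this, hXm, mY, zero_add]⟩
  · have := hXA (0, 0, ⟨x, hx⟩)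
    simpa [hΦ] using this

theorem moment_four_eq (f : Matrix ι κ F → ℂ) : moment 4 f = moment 2 (f * f) := by
  unfold moment
  refine expect_congr rfl fun M _ => ?_
  rw [Pi.mul_apply, norm_mul]; ring

/-- A fourth moment inequality in degree less than `i`, with constant `C`. -/
def FourBound (F : Type) [Field F] [Fintype F] (i : ℕ) (C : ℝ) : Prop :=
  ∀ (ι κ : Type) [Fintype ι] [Fintype κ] (e : ℝ) (f : Matrix ι κ F → ℂ),
    DegLT i f → Glob i e f → moment 4 f ≤ C * e * moment 2 f

theorem FourBound.of_inIm {i : ℕ} {C : ℝ} (hC : FourBound F i C) {u : κ → F} (hu : u ≠ 0)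
    {e : ℝ} {g : Matrix ι κ F → ℂ} (hd : DegLT (i + 1) g) (hg : Glob (i + 1) e g)
    (hocc : ∀ Y, ft g Y ≠ 0 → InIm u Y) : moment 4 g ≤ C * e * moment 2 g := by
  obtain ⟨l, hl⟩ := slice_nonempty hu
  rw [mem_slice] at hl
  rw [← expect_moment_res 4 (killer u l) 1 g, ← expect_moment_res 2 (killer u l) 1 g, mul_expect]
  refine expect_le_expect fun T _ => hC _ _ _ _ ?_ ?_
  · intro X hX
    by_contra h0
    obtain ⟨Y, hY, rfl⟩ := exists_of_ft_res_ne_zero h0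
    have h1 := hd.rank_lt hY
    have h2 := rank_killer_mul_of_inIm hl (hocc Y hY)
    rw [Matrix.mul_one] at hX
    omega
  · refine Glob.res hg _ _ _ ?_
    have := rank_le_rank_killer_mul u l (1 : Matrix κ κ F)
    rw [Matrix.mul_one, rank_one] at this
    rw [rank_one]
    omega

theorem FourBound.of_occ {i : ℕ} {C : ℝ} (hC : FourBound F i C) {a : (κ → F) ⊕ (ι → F)}
    (ha : TagNZ a) {e : ℝ} {g : Matrix ι κ F → ℂ} (hd : DegLT (i + 1) g) (hg : Glob (i + 1) e g)
    (hocc : ∀ Y, ft g Y ≠ 0 → Occ a Y) : moment 4 g ≤ C * e * moment 2 g := by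
  rcases a with u | v
  · exact hC.of_inIm ha hd hg hocc
  · rw [← moment_tr 4, ← moment_tr 2]
    refine hC.of_inIm (u := v) ha hd.tr hg.tr fun Y hY => ?_
    rw [ft_tr] at hY
    have := hocc _ hY
    simpa [Occ] using this

/-- No nonzero vector of the row or column space of `X` is shared by both `Y` and `X - Y`. -/
def Good (X Y : Matrix κ ι F) : Prop := ∀ a ∈ bag X, ¬ (Occ a Y ∧ Occ a (X - Y))

/-- The contribution of the good pairs to the Fourier coefficient of `f * f`. -/
def goodConv (f : Matrix ι κ F → ℂ) (X : Matrix κ ι F) : ℂ :=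
  ∑ Y, if Good X Y then ft f Y * ft f (X - Y) else 0

theorem Good.exists_sub {X Y : Matrix κ ι F} (h : Good X Y) :
    ∃ A, Sub A X ∧ Sub A Y ∧ Sub (X - A) (X - Y) := by
  refine exists_sub_of_good (by abel) (fun u h1 h2 h3 => ?_) (fun v h1 h2 h3 => ?_)
  · by_contra hu
    exact h (Sum.inl u) (by simpa [bag] using ⟨hu, h1⟩) ⟨h2, h3⟩
  · by_contra hv
    exact h (Sum.inr v) (by simpa [bag] using ⟨hv, h1⟩) ⟨h2, h3⟩

theorem sum_norm_goodConv_sq_le {i : ℕ} {f : Matrix ι κ F → ℂ} (hf : DegLT i f) :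
    ∑ X, ‖goodConv f X‖ ^ 2 ≤ (Fintype.card F : ℝ) ^ ((2 * i) * (2 * i)) *
      ((Fintype.card F : ℝ) ^ (i * i) * moment 2 f) ^ 2 := by
  set N : ℝ := (Fintype.card F : ℝ) ^ ((2 * i) * (2 * i)) with hN
  set c : Matrix κ ι F → ℝ := fun Y => ‖ft f Y‖ with hc
  set W : Matrix κ ι F → ℝ := fun A => ∑ Y, if Sub A Y then c Y ^ 2 else 0 with hW
  have hW0 : ∀ A, 0 ≤ W A := fun A => sum_nonneg fun Y _ => by positivity
  have hWsum : ∑ A, W A ≤ (Fintype.card F : ℝ) ^ (i * i) * moment 2 f := by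
    rw [hW, sum_comm, parseval, mul_sum]
    refine sum_le_sum fun Y _ => ?_
    rw [← sum_filter, sum_const, nsmul_eq_mul]
    by_cases hY : ft f Y = 0
    · simp [hc, hY]
    have h1 := card_sub_le Y
    have h2 := hf.rank_lt hY
    gcongr
    calc (#{A | Sub A Y} : ℝ) ≤ (Fintype.card F : ℝ) ^ (Y.rank * Y.rank) := by exact_mod_cast h1
      _ ≤ _ := pow_le_pow_right₀ one_le_card_real (by nlinarith)
  have hX : ∀ X, ‖goodConv f X‖ ^ 2 ≤ N * ∑ A, W A * W (X - A) := by
    intro X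
    have hRHS : 0 ≤ ∑ A, W A * W (X - A) := sum_nonneg fun A _ => mul_nonneg (hW0 _) (hW0 _)
    by_cases hr : 2 * i ≤ X.rank
    · have : goodConv f X = 0 := by
        refine sum_eq_zero fun Y _ => ?_
        split_ifs
        · by_cases h : i ≤ Y.rank
          · rw [hf Y h, zero_mul]
          · rw [hf (X - Y), mul_zero]
            have := rank_add_le Y (X - Y)
            rw [add_sub_cancel] at this
            omega
        · rfl
      rw [this]; simp; positivity
    have h1 : ‖goodConv f X‖ ≤ ∑ A with Sub A X, ∑ Y, (if Sub A Y then c Y else 0) *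
        (if Sub (X - A) (X - Y) then c (X - Y) else 0) := by
      rw [sum_comm]
      refine (norm_sum_le _ _).trans (sum_le_sum fun Y _ => ?_)
      have h0 : ∀ A, 0 ≤ (if Sub A Y then c Y else 0) *
        (if Sub (X - A) (X - Y) then c (X - Y) else 0) := fun A => by
          have : 0 ≤ c Y := norm_nonneg _
          have : 0 ≤ c (X - Y) := norm_nonneg _
          positivity
      split_ifs with hg
      · obtain ⟨A, hA1, hA2, hA3⟩ := hg.exists_sub
        refine le_trans (le_of_eq ?_) (single_le_sum (fun A _ => h0 A)
          (mem_filter.2 ⟨mem_univ A, hA1⟩))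
        rw [if_pos hA2, if_pos hA3, norm_mul]
      · rw [norm_zero]; exact sum_nonneg fun A _ => h0 A
    have hcard : (#{A | Sub A X} : ℝ) ≤ N := by
      have h1 := card_sub_le X
      calc (#{A | Sub A X} : ℝ) ≤ (Fintype.card F : ℝ) ^ (X.rank * X.rank) := by exact_mod_cast h1
        _ ≤ _ := pow_le_pow_right₀ one_le_card_real (by nlinarith)
    calc ‖goodConv f X‖ ^ 2 ≤ _ := pow_le_pow_left₀ (norm_nonneg _) h1 2
      _ ≤ _ := sq_sum_le_card_mul_sum_sq
      _ ≤ N * ∑ A with Sub A X, W A * W (X - A) := by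
        gcongr with A hA
        refine (sum_mul_sq_le_sq_mul_sq _ _ _).trans (le_of_eq ?_)
        have e1 : ∀ A, W A = ∑ Y, (if Sub A Y then c Y else 0) ^ 2 := fun A => by
          refine sum_congr rfl fun Y _ => ?_
          split_ifs <;> simp
        rw [e1, e1]
        congr 1
        exact Fintype.sum_equiv (Equiv.subLeft X) _ _ fun Y => rfl
      _ ≤ _ := by
        exact mul_le_mul_of_nonneg_left (sum_le_sum_of_subset_of_nonneg (filter_subset _ _)
          fun A _ _ => mul_nonneg (hW0 _) (hW0 _)) (by rw [hN]; positivity)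
  calc ∑ X, ‖goodConv f X‖ ^ 2 ≤ ∑ X, N * ∑ A, W A * W (X - A) := sum_le_sum fun X _ => hX X
    _ = N * (∑ A, W A) ^ 2 := by
      rw [← mul_sum, sum_comm, sq, sum_mul]
      congr 1
      refine sum_congr rfl fun A _ => ?_
      rw [← mul_sum]
      congr 1
      exact Fintype.sum_equiv (Equiv.subRight A) _ _ fun Y => rfl
    _ ≤ _ := by
      have : 0 ≤ ∑ A, W A := sum_nonneg fun A _ => hW0 A
      gcongr

theorem sum_powerset_ite {α : Type} (B : Finset α) (p : α → Prop) :
    ∑ S ∈ B.powerset, (-1 : ℂ) ^ #S * (if ∀ a ∈ S, p a then 1 else 0)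
      = if ∀ a ∈ B, ¬ p a then 1 else 0 := by
  have h := prod_one_add (R := ℂ) (f := fun a => if p a then -1 else 0) B
  have h1 : ∏ a ∈ B, (1 + (if p a then (-1 : ℂ) else 0)) = ∏ a ∈ B, if ¬ p a then 1 else 0 := by
    refine prod_congr rfl fun a _ => ?_
    split_ifs <;> simp_all
  rw [h1, prod_ite_zero, prod_const_one] at h
  rw [h]
  refine sum_congr rfl fun S _ => ?_
  rw [prod_ite_zero, prod_const]
  split_ifs <;> simp

theorem goodConv_eq (f : Matrix ι κ F → ℂ) (X : Matrix κ ι F) :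
    goodConv f X = ∑ S ∈ (bag X).powerset, (-1 : ℂ) ^ #S * ft (part S f * part S f) X := by
  simp_rw [ft_mul, mul_sum]
  rw [sum_comm, goodConv]
  refine sum_congr rfl fun Y _ => ?_
  have h := sum_powerset_ite (bag X) (fun a => Occ a Y ∧ Occ a (X - Y))
  calc _ = (ft f Y * ft f (X - Y)) * (if Good X Y then 1 else 0) := by
        split_ifs <;> simp
    _ = (ft f Y * ft f (X - Y)) * ∑ S ∈ (bag X).powerset,
          (-1 : ℂ) ^ #S * (if ∀ a ∈ S, Occ a Y ∧ Occ a (X - Y) then 1 else 0) := by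
      refine congrArg _ (Eq.trans ?_ (Eq.trans h.symm ?_))
      · by_cases hg : Good X Y
        · exact (if_pos hg).trans (if_pos hg).symm
        · exact (if_neg hg).trans (if_neg hg).symm
      · exact sum_congr rfl fun S _ => by congr
    _ = _ := by
      rw [mul_sum]
      refine sum_congr rfl fun S _ => ?_
      rw [part, ft_proj, ft_proj]
      split_ifs <;> first | ring1 | (exfalso; grind)

theorem moment_four_le_parts {i : ℕ} {f : Matrix ι κ F → ℂ} (hf : DegLT i f) :
    moment 4 f ≤ 2 * ∑ X, ‖goodConv f X‖ ^ 2 + 2 * 2 ^ (2 * Fintype.card F ^ (2 * i)) *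
      ∑ S : Finset ((κ → F) ⊕ (ι → F)) with
        S ≠ ∅ ∧ (∀ a ∈ S, TagNZ a) ∧ #S ≤ 2 * Fintype.card F ^ (2 * i), moment 4 (part S f) := by
  set 𝒮 : Finset (Finset ((κ → F) ⊕ (ι → F))) := univ.filter fun S =>
    S ≠ ∅ ∧ (∀ a ∈ S, TagNZ a) ∧ #S ≤ 2 * Fintype.card F ^ (2 * i) with h𝒮
  simp_rw [moment_four_eq, parseval]
  rw [sum_comm, mul_sum, mul_sum, ← sum_add_distrib]
  refine sum_le_sum fun X _ => ?_
  by_cases hr : 2 * i ≤ X.rank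
  · rw [(hf.mul hf) X (by omega), norm_zero, zero_pow two_ne_zero]
    positivity
  have hcb : #(bag X) ≤ 2 * Fintype.card F ^ (2 * i) :=
    (card_bag_le X).trans (by gcongr; exact Fintype.card_pos; omega)
  have h0 : part ∅ f = f := proj_true (by simp)
  have h1 := goodConv_eq f X
  rw [← add_sum_erase _ _ (empty_mem_powerset (bag X)), h0] at h1
  simp only [card_empty, pow_zero, one_mul] at h1
  set E := ∑ S ∈ (bag X).powerset.erase ∅, (-1 : ℂ) ^ #S * ft (part S f * part S f) X with hE
  have h2 : ‖ft (f * f) X‖ ≤ ‖goodConv f X‖ + ‖E‖ := by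
    rw [show ft (f * f) X = goodConv f X - E by rw [h1]; ring]
    exact norm_sub_le _ _
  have h3 : ‖E‖ ^ 2 ≤ 2 ^ (2 * Fintype.card F ^ (2 * i)) *
      ∑ S ∈ 𝒮, ‖ft (part S f * part S f) X‖ ^ 2 := by
    have h4 : ‖E‖ ≤ ∑ S ∈ (bag X).powerset.erase ∅, ‖ft (part S f * part S f) X‖ := by
      refine (norm_sum_le _ _).trans (le_of_eq (sum_congr rfl fun S _ => ?_))
      simp
    refine (pow_le_pow_left₀ (norm_nonneg _) h4 2).trans (sq_sum_le_card_mul_sum_sq.trans ?_)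
    gcongr
    · have : #((bag X).powerset.erase ∅) ≤ 2 ^ (2 * Fintype.card F ^ (2 * i)) := by
        refine (card_le_card (erase_subset _ _)).trans ?_
        rw [card_powerset]
        exact Nat.pow_le_pow_right (by norm_num) hcb
      exact_mod_cast this
    · intro S hS
      simp only [mem_erase, mem_powerset] at hS
      simp only [h𝒮, mem_filter, mem_univ, true_and]
      refine ⟨hS.1, fun a ha => ?_, (card_le_card hS.2).trans hcb⟩
      have := hS.2 ha
      simp only [bag, mem_filter] at this
      exact this.2.1
  have h5 : ‖ft (f * f) X‖ ^ 2 ≤ (‖goodConv f X‖ + ‖E‖) ^ 2 := pow_le_pow_left₀ (norm_nonneg _) h2 2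
  nlinarith [sq_nonneg (‖goodConv f X‖ - ‖E‖)]

theorem sum_moment_two_part_le {i : ℕ} {f : Matrix ι κ F → ℂ} (hf : DegLT i f)
    (𝒮 : Finset (Finset ((κ → F) ⊕ (ι → F)))) (h𝒮 : ∀ S ∈ 𝒮, ∀ a ∈ S, TagNZ a) :
    ∑ S ∈ 𝒮, moment 2 (part S f) ≤ 2 ^ (2 * Fintype.card F ^ i) * moment 2 f := by
  simp_rw [part, moment_two_proj]
  rw [sum_comm, parseval, mul_sum]
  refine sum_le_sum fun Y _ => ?_
  refine le_trans (le_of_eq (b := ∑ S ∈ 𝒮 with ∀ a ∈ S, Occ a Y, ‖ft f Y‖ ^ 2) ?_) ?_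
  · rw [sum_filter]
    exact sum_congr rfl fun S _ => by congr
  rw [sum_const, nsmul_eq_mul]
  by_cases hY : ft f Y = 0
  · simp [hY]
  have h2 := hf.rank_lt hY
  gcongr
  have : #(𝒮.filter fun S => ∀ a ∈ S, Occ a Y) ≤ 2 ^ (2 * Fintype.card F ^ i) := by
    calc _ ≤ #(bag Y).powerset := by
          refine card_le_card fun S hS => ?_
          rw [mem_filter] at hS
          rw [mem_powerset]
          intro a ha
          simp only [bag, mem_filter, mem_univ, true_and]
          exact ⟨h𝒮 S hS.1 a ha, hS.2 a ha⟩
      _ ≤ _ := by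
          rw [card_powerset]
          refine Nat.pow_le_pow_right (by norm_num) ((card_bag_le Y).trans ?_)
          gcongr
          exact Fintype.card_pos
  exact_mod_cast this

theorem exists_fourBound (F : Type) [Field F] [Fintype F] (i : ℕ) :
    ∃ C : ℝ, 0 ≤ C ∧ FourBound F i C := by
  induction i with
  | zero =>
    refine ⟨0, le_rfl, fun ι κ _ _ e f hf _ => ?_⟩
    rw [degLT_zero_iff hf]; simp [moment]
  | succ i ih =>
    obtain ⟨C, hC0, hC⟩ := ih
    obtain ⟨C₁, hC₁, hpart⟩ := Glob.part F (i + 1) (2 * Fintype.card F ^ (2 * (i + 1)))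
    set q : ℝ := (Fintype.card F : ℝ) with hq
    set N : ℝ := 2 * 2 ^ (2 * Fintype.card F ^ (2 * (i + 1))) with hN
    refine ⟨2 * q ^ ((2 * (i + 1)) * (2 * (i + 1))) * (q ^ ((i + 1) * (i + 1))) ^ 2
      + N * (C * C₁ * 2 ^ (2 * Fintype.card F ^ (i + 1))), by positivity,
      fun ι κ _ _ e f hf hg => ?_⟩
    have h1 := moment_four_le_parts hf
    have h2 := sum_norm_goodConv_sq_le hf
    set 𝒮 : Finset (Finset ((κ → F) ⊕ (ι → F))) := univ.filter fun S =>
      S ≠ ∅ ∧ (∀ a ∈ S, TagNZ a) ∧ #S ≤ 2 * Fintype.card F ^ (2 * (i + 1)) with h𝒮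
    have he : 0 ≤ e := (moment_nonneg _ _).trans hg.moment_le
    have h3 : ∑ S ∈ 𝒮, moment 4 (part S f) ≤ ∑ S ∈ 𝒮, C * (C₁ * e) * moment 2 (part S f) := by
      refine sum_le_sum fun S hS => ?_
      simp only [h𝒮, mem_filter, mem_univ, true_and] at hS
      obtain ⟨a, ha⟩ := nonempty_iff_ne_empty.2 hS.1
      refine hC.of_occ (hS.2.1 a ha) (hf.proj _) (hpart _ _ S hS.2.1 hS.2.2 _ _ f hf hg) ?_
      intro Y hY
      rw [part, ft_proj] at hY
      by_contra h0
      rw [if_neg fun h => h0 (h a ha)] at hY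
      exact hY rfl
    rw [← mul_sum] at h3
    have h4 := sum_moment_two_part_le hf 𝒮 fun S hS => by
      simp only [h𝒮, mem_filter, mem_univ, true_and] at hS
      exact hS.2.1
    have h5 : moment 2 f ^ 2 ≤ e * moment 2 f := by
      rw [sq]
      exact mul_le_mul_of_nonneg_right hg.moment_le (moment_nonneg _ _)
    calc moment 4 f ≤ 2 * (q ^ ((2 * (i + 1)) * (2 * (i + 1))) *
          ((q ^ ((i + 1) * (i + 1))) ^ 2 * (e * moment 2 f)))
          + N * (C * (C₁ * e) * (2 ^ (2 * Fintype.card F ^ (i + 1)) * moment 2 f)) := by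
          refine h1.trans (add_le_add ?_ ?_)
          · rw [mul_pow] at h2
            exact mul_le_mul_of_nonneg_left (h2.trans (by gcongr)) (by norm_num)
          · refine mul_le_mul_of_nonneg_left (h3.trans ?_) (by positivity)
            exact mul_le_mul_of_nonneg_left h4 (by positivity)
      _ = _ := by ring

theorem exists_moment_le (F : Type) [Field F] [Fintype F] (k : ℕ) : ∀ i : ℕ,
    ∃ (t : ℕ) (C : ℝ), 0 ≤ C ∧ ∀ (ι κ : Type) [Fintype ι] [Fintype κ] (e : ℝ)
      (f : Matrix ι κ F → ℂ), DegLT i f → Glob t e f → moment (2 ^ (k + 1)) f ≤ C * e ^ 2 ^ k := by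
  induction k with
  | zero =>
    exact fun i => ⟨0, 1, zero_le_one, fun ι κ _ _ e f _ hg => by simpa using hg.moment_le⟩
  | succ k ih =>
    intro i
    obtain ⟨t, C, hC, h⟩ := ih (i + i)
    obtain ⟨C₁, hC₁, h₁⟩ := exists_fourBound F i
    refine ⟨i + t, C * C₁ ^ 2 ^ k, by positivity, fun ι κ _ _ e f hf hg => ?_⟩
    have he : 0 ≤ e := (moment_nonneg 2 f).trans hg.moment_le
    have hg2 : Glob t (C₁ * e ^ 2) (f * f) := fun T P P' hP => by
      change moment 2 (res T P P' f * res T P P' f) ≤ _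
      rw [← moment_four_eq]
      have hr := hg.res T P P' hP
      refine (h₁ _ _ _ _ (hf.res T P P') hr).trans ?_
      rw [sq, ← mul_assoc]
      exact mul_le_mul_of_nonneg_left hr.moment_le (by positivity)
    have := h ι κ _ _ (hf.mul hf) hg2
    calc moment (2 ^ (k + 1 + 1)) f = moment (2 ^ (k + 1)) (f * f) := by
          unfold moment
          refine expect_congr rfl fun M _ => ?_
          rw [Pi.mul_apply, norm_mul, ← sq, ← pow_mul, pow_succ' 2 (k + 1)]
      _ ≤ _ := this
      _ = _ := by rw [mul_pow, ← pow_mul, ← pow_succ', mul_assoc]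

/-- The low-degree parts of restrictions of `f`, with degree plus codimension at most `i`,
have second moment at most `e`. -/
def LowBound (i : ℕ) (e : ℝ) (f : Matrix ι κ F → ℂ) : Prop :=
  ∀ (T : Matrix ι κ F) (P : Matrix κ κ F) (P' : Matrix ι ι F) (j : ℕ),
    Fintype.card κ + Fintype.card ι + j ≤ P.rank + P'.rank + i →
      moment 2 (low j (res T P P' f)) ≤ e

theorem tr_low (i : ℕ) (f : Matrix ι κ F → ℂ) : tr (low i f) = low i (tr f) := by
  rw [low, tr_proj, low]
  simp_rw [rank_transpose]

theorem LowBound.tr {i : ℕ} {e : ℝ} {f : Matrix ι κ F → ℂ} (h : LowBound i e f) :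
    LowBound i e (tr f) := fun T P P' j hP => by
  have := h Tᵀ P'ᵀ Pᵀ j (by rw [rank_transpose, rank_transpose]; omega)
  rwa [← moment_tr, tr_low, tr_res, transpose_transpose, transpose_transpose,
    transpose_transpose] at this

theorem LowBound.mono {i i' : ℕ} {e : ℝ} {f : Matrix ι κ F → ℂ} (h : LowBound i e f) (hi : i' ≤ i) :
    LowBound i' e f := fun T P P' j hP => h T P P' j (by omega)

theorem LowBound.moment_le {i : ℕ} {e : ℝ} {f : Matrix ι κ F → ℂ} (h : LowBound i e f) :
    moment 2 (low i f) ≤ e := by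
  have := h 0 1 1 i (by rw [rank_one, rank_one])
  rwa [res_id] at this

theorem LowBound.res_killer {i : ℕ} {e : ℝ} {f : Matrix ι κ F → ℂ} (h : LowBound (i + 1) e f)
    (T : Matrix ι κ F) (u l : κ → F) : LowBound i e (res T (killer u l) 1 f) :=
  fun T₁ P P' j hP => by
    rw [res_res]
    apply h
    have := rank_le_rank_mul_killer u l P
    rw [Matrix.one_mul]
    omega

theorem res_smul (T : Matrix ι κ F) (P : Matrix κ κ F) (P' : Matrix ι ι F) (c : ℂ)
    (f : Matrix ι κ F → ℂ) : res T P P' (c • f) = c • res T P P' f := rfl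

theorem isUnit_of_card_le_rank {P : Matrix κ κ F} (h : Fintype.card κ ≤ P.rank) : IsUnit P := by
  rw [← mulVec_surjective_iff_isUnit, ← Matrix.coe_mulVecLin, ← LinearMap.range_eq_top]
  apply Submodule.eq_top_of_finrank_eq
  rw [finrank_fintype_fun_eq_card]
  exact le_antisymm (rank_le_card_width P) h

theorem moment_res_of_isUnit (p : ℕ) (T : Matrix ι κ F) {P : Matrix κ κ F} {P' : Matrix ι ι F}
    (hP : IsUnit P) (hP' : IsUnit P') (f : Matrix ι κ F → ℂ) :
    moment p (res T P P' f) = moment p f := by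
  obtain ⟨P, rfl⟩ := hP
  obtain ⟨P', rfl⟩ := hP'
  refine Fintype.expect_equiv
    ⟨fun M => T + P'.1 * M * P.1, fun M => P'.inv * (M - T) * P.inv, fun M => ?_, fun M => ?_⟩
    _ _ fun M => rfl
  · simp [← Matrix.mul_assoc]
  · simp [← Matrix.mul_assoc]

theorem low_succ_eq {u l : κ → F} (hu : u ≠ 0) (hl : l ⬝ᵥ u = 1) (i : ℕ) (f : Matrix ι κ F → ℂ) :
    low (i + 1) f = proj (fun Y => (killer u l * Y).rank < i) f
      + ((Fintype.card F : ℂ) ^ i) • avg u (proj (fun Y => Y.rank = i) f) := by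
  have hq : (Fintype.card F : ℂ) ≠ 0 := by exact_mod_cast Fintype.card_ne_zero
  apply ft_injective
  ext Y
  rw [low, ft_add, ft_smul, Pi.add_apply, Pi.smul_apply, ft_avg hu, ft_proj, ft_proj, ft_proj,
    smul_eq_mul]
  by_cases hY : InIm u Y
  · have := rank_killer_mul_of_inIm hl hY
    rw [if_pos hY, mul_zero, mul_zero, add_zero]
    congr 1
    rw [eq_iff_iff]
    omega
  · rw [rank_killer_mul_of_not_inIm hY, if_neg hY]
    rcases lt_trichotomy Y.rank i with h | h | h
    · rw [if_pos (by omega), if_pos h, if_neg h.ne]; ring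
    · rw [if_pos (by omega), if_neg (by omega), if_pos h, h]
      field_simp
      ring
    · rw [if_neg (by omega), if_neg (by omega), if_neg (by omega)]; ring

theorem res_proj_killer {u l v : κ → F} (hl : l ⬝ᵥ u = 1) {P : Matrix κ κ F} (hP : P *ᵥ u = 0)
    (T : Matrix ι κ F) (P' : Matrix ι ι F) (i : ℕ) (f : Matrix ι κ F → ℂ) :
    res T P P' (proj (fun Y => (killer u l * Y).rank < i) f)
      = res 0 (P + vecMulVec v l) P' (low i (res T (killer u l) 1 f)) := by
  have h1 : (P + vecMulVec v l) * killer u l = P := by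
    simp [killer, Matrix.mul_sub, mul_vecMulVec, add_mulVec, hP, vecMulVec_mulVec, hl]
  rw [low, proj_res, res_res, h1]
  simp

theorem exists_glob_low (F : Type) [Field F] [Fintype F] (t : ℕ) : ∀ i : ℕ,
    ∃ C : ℝ, 0 ≤ C ∧ ∀ (ι κ : Type) [Fintype ι] [Fintype κ] (e : ℝ) (f : Matrix ι κ F → ℂ),
      LowBound i e f → Glob t (C * e) (low i f) := by
  induction t with
  | zero =>
    refine fun i => ⟨1, zero_le_one, fun ι κ _ _ e f hf T P P' hP => ?_⟩
    have h1 := rank_le_card_width P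
    have h2 := rank_le_card_width P'
    rw [moment_res_of_isUnit 2 T (isUnit_of_card_le_rank (by omega))
      (isUnit_of_card_le_rank (by omega)), one_mul]
    exact hf.moment_le
  | succ t ih =>
    rintro (_ | i)
    · refine ⟨0, le_rfl, fun ι κ _ _ e f hf T P P' hP => ?_⟩
      rw [degLT_zero_iff (degLT_low 0 f)]
      simp [moment, res]
    obtain ⟨C₀, hC₀, h₀⟩ := ih i
    obtain ⟨C₁, hC₁, h₁⟩ := ih (i + 1)
    set q := ‖(Fintype.card F : ℂ) ^ i‖ with hq
    set C := 2 * C₀ + 2 * (q ^ 2 * (2 * C₁ + 2 * C₀)) with hC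
    have hC0 : 0 ≤ C := by positivity
    have key : ∀ (ι κ : Type) [Fintype ι] [Fintype κ] (e : ℝ) (f : Matrix ι κ F → ℂ),
        LowBound (i + 1) e f → ∀ (T : Matrix ι κ F) (P : Matrix κ κ F) (P' : Matrix ι ι F),
        Fintype.card κ + Fintype.card ι ≤ P.rank + P'.rank + (t + 1) → P.rank < Fintype.card κ →
        moment 2 (res T P P' (low (i + 1) f)) ≤ C * e := by
      intro ι κ _ _ e f hf T P P' hP hr
      obtain ⟨u, hu, hPu⟩ := exists_mulVec_eq_zero hr
      obtain ⟨l, hl⟩ := slice_nonempty hu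
      rw [mem_slice] at hl
      obtain ⟨v, hv⟩ := exists_not_inIm hr
      have hg : Glob t (2 * (C₁ * e) + 2 * (C₀ * e)) (proj (fun Y => Y.rank = i) f) := by
        have h := (h₁ ι κ e f hf).add (h₀ ι κ e f (hf.mono (Nat.le_succ i))).neg
        have heq : low (i + 1) f + -low i f = proj (fun Y => Y.rank = i) f := by
          apply ft_injective
          ext Y
          simp only [low, ft_add, ft_neg, ft_proj, Pi.add_apply, Pi.neg_apply]
          split_ifs <;> first | omega | simp
        rwa [heq] at h
      rw [low_succ_eq hu hl, res_add]
      refine (moment_two_add_le _ _).trans ?_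
      have e1 : moment 2 (res T P P' (proj (fun Y => (killer u l * Y).rank < i) f)) ≤ C₀ * e := by
        rw [res_proj_killer (v := v) hl hPu]
        apply h₀ ι κ e _ (hf.res_killer T u l)
        have := rank_lt_rank_add_vecMulVec hl hPu hv
        omega
      have e2 : moment 2 (res T P P' (((Fintype.card F : ℂ) ^ i) •
          avg u (proj (fun Y => Y.rank = i) f))) ≤ q ^ 2 * (2 * (C₁ * e) + 2 * (C₀ * e)) := by
        rw [res_smul, moment_smul]
        exact mul_le_mul_of_nonneg_left (moment_res_avg_le hg hu T hPu P' hr hP) (by positivity)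
      calc _ ≤ 2 * (C₀ * e) + 2 * (q ^ 2 * (2 * (C₁ * e) + 2 * (C₀ * e))) := by linarith
        _ = _ := by rw [hC]; ring
    refine ⟨C + 1, by positivity, fun ι κ _ _ e f hf T P P' hP => ?_⟩
    have he : 0 ≤ e := (moment_nonneg 2 _).trans hf.moment_le
    have h1 := rank_le_card_width P
    have h2 := rank_le_card_width P'
    by_cases hr : P.rank < Fintype.card κ
    · exact (key ι κ e f hf T P P' hP hr).trans (by linarith)
    by_cases hr' : P'.rank < Fintype.card ι
    · have := key κ ι e (tr f) hf.tr Tᵀ P'ᵀ Pᵀ (by rw [rank_transpose, rank_transpose]; omega)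
        (by rwa [rank_transpose])
      rw [← tr_low, ← tr_res, moment_tr] at this
      linarith
    · rw [moment_res_of_isUnit 2 T (isUnit_of_card_le_rank (by omega))
        (isUnit_of_card_le_rank (by omega))]
      have := hf.moment_le
      nlinarith [mul_nonneg hC0 he]

theorem expect_mul_pow_two_pow_le {α : Type} [Fintype α] {w : α → ℝ} (hw : ∀ a, 0 ≤ w a) (k : ℕ) :
    ∀ {y : α → ℝ}, (∀ a, 0 ≤ y a) →
      (𝔼 a, w a * y a) ^ 2 ^ k ≤ (𝔼 a, w a) ^ (2 ^ k - 1) * 𝔼 a, w a * y a ^ 2 ^ k := by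
  induction k with
  | zero => intro y _; simp
  | succ k ih =>
    intro y hy
    have hA : 0 ≤ 𝔼 a, w a := expect_nonneg fun a _ => hw a
    have hcs : (𝔼 a, w a * y a) ^ 2 ≤ (𝔼 a, w a) * 𝔼 a, w a * y a ^ 2 := by
      have := sum_sq_le_sum_mul_sum_of_sq_le_mul univ (r := fun a => w a * y a) (f := w)
        (g := fun a => w a * y a ^ 2) (fun a _ => hw a)
        (fun a _ => mul_nonneg (hw a) (sq_nonneg _)) (fun a _ => le_of_eq (by ring))
      simp only [Fintype.expect_eq_sum_div_card]
      rw [div_pow, div_mul_div_comm, ← sq]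
      gcongr
    have h := ih (y := fun a => y a ^ 2) fun a => sq_nonneg _
    calc (𝔼 a, w a * y a) ^ 2 ^ (k + 1) = ((𝔼 a, w a * y a) ^ 2) ^ 2 ^ k := by
          rw [← pow_mul, pow_succ']
      _ ≤ ((𝔼 a, w a) * 𝔼 a, w a * y a ^ 2) ^ 2 ^ k := by gcongr
      _ = (𝔼 a, w a) ^ 2 ^ k * (𝔼 a, w a * y a ^ 2) ^ 2 ^ k := mul_pow _ _ _
      _ ≤ (𝔼 a, w a) ^ 2 ^ k * ((𝔼 a, w a) ^ (2 ^ k - 1) * 𝔼 a, w a * (y a ^ 2) ^ 2 ^ k) := by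
          gcongr
      _ = _ := by
          rw [← mul_assoc, ← pow_add]
          have : 2 ^ k + (2 ^ k - 1) = 2 ^ (k + 1) - 1 := by
            have := Nat.one_le_two_pow (n := k)
            rw [pow_succ]; omega
          simp_rw [this, ← pow_mul, ← pow_succ']

theorem exists_moment_low_of_lowBound (F : Type) [Field F] [Fintype F] (i k : ℕ) :
    ∃ C : ℝ, 0 ≤ C ∧ ∀ j ≤ i, ∀ (ι κ : Type) [Fintype ι] [Fintype κ] (e : ℝ)
      (f : Matrix ι κ F → ℂ), LowBound j e f →
        moment (2 ^ (k + 1)) (low j f) ≤ C * e ^ 2 ^ k := by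
  choose t C hC h using exists_moment_le F k
  choose C' hC' h' using fun j => exists_glob_low F (t j) j
  refine ⟨∑ j ∈ range (i + 1), C j * C' j ^ 2 ^ k,
    sum_nonneg fun j _ => mul_nonneg (hC j) (pow_nonneg (hC' j) _), fun j hj ι κ _ _ e f hf => ?_⟩
  have he : 0 ≤ e := (moment_nonneg 2 _).trans hf.moment_le
  calc moment (2 ^ (k + 1)) (low j f) ≤ C j * (C' j * e) ^ 2 ^ k :=
        h j ι κ _ _ (degLT_low j f) (h' j ι κ e f hf)
    _ = (C j * C' j ^ 2 ^ k) * e ^ 2 ^ k := by rw [mul_pow]; ring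
    _ ≤ _ := by
      refine mul_le_mul_of_nonneg_right ?_ (by positivity)
      exact single_le_sum (f := fun j => C j * C' j ^ 2 ^ k)
        (fun j _ => mul_nonneg (hC j) (pow_nonneg (hC' j) _)) (mem_range.2 (by omega))

theorem moment_two_low_pow_le {f : Matrix ι κ F → ℂ} (hf : ∀ M, f M = 0 ∨ f M = 1) (j k : ℕ) :
    moment 2 (low j f) ^ 2 ^ k ≤ moment 1 f ^ (2 ^ k - 1) * moment (2 ^ k) (low j f) := by
  have h1 : moment 2 (low j f) ≤ 𝔼 M, ‖f M‖ * ‖low j f M‖ := by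
    have h := inner_proj (fun Y => Y.rank < j) f
    have h2 : ‖𝔼 M, f M * conj (low j f M)‖ ≤ 𝔼 M, ‖f M * conj (low j f M)‖ :=
      RCLike.norm_expect_le (K := ℂ)
    rw [low, h, Complex.norm_real, Real.norm_of_nonneg (moment_nonneg _ _)] at h2
    simpa [low] using h2
  calc moment 2 (low j f) ^ 2 ^ k ≤ (𝔼 M, ‖f M‖ * ‖low j f M‖) ^ 2 ^ k :=
        pow_le_pow_left₀ (moment_nonneg _ _) h1 _
    _ ≤ (𝔼 M, ‖f M‖) ^ (2 ^ k - 1) * 𝔼 M, ‖f M‖ * ‖low j f M‖ ^ 2 ^ k :=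
        expect_mul_pow_two_pow_le (fun _ => norm_nonneg _) k fun _ => norm_nonneg _
    _ ≤ _ := by
      have e1 : moment 1 f = 𝔼 M, ‖f M‖ := by simp [moment]
      rw [e1]
      refine mul_le_mul_of_nonneg_left (expect_le_expect fun M _ => ?_)
        (pow_nonneg (expect_nonneg fun _ _ => norm_nonneg _) _)
      rcases hf M with h | h
      · rw [h, norm_zero, zero_mul]; positivity
      · rw [h, norm_one, one_mul]

/-- Hypercontractivity for indicator functions none of whose restrictions is dense. -/
theorem exists_moment_low_le (F : Type) [Field F] [Fintype F] (i k : ℕ) :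
    ∃ C : ℝ, 0 ≤ C ∧ ∀ (ι κ : Type) [Fintype ι] [Fintype κ] (x : ℝ) (f : Matrix ι κ F → ℂ),
      (∀ M, f M = 0 ∨ f M = 1) →
      (∀ (T : Matrix ι κ F) (P : Matrix κ κ F) (P' : Matrix ι ι F),
        Fintype.card κ + Fintype.card ι ≤ P.rank + P'.rank + i → moment 1 (res T P P' f) ≤ x) →
      moment (2 ^ (k + 1)) (low i f) ≤ C * x ^ (2 ^ (k + 1) - 1) := by
  obtain ⟨C, hC, h⟩ := exists_moment_low_of_lowBound F i k
  refine ⟨C * C, by positivity, fun ι κ _ _ x f hf hx => ?_⟩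
  set S : Finset (Matrix ι κ F × Matrix κ κ F × Matrix ι ι F × Fin (i + 1)) := univ.filter fun a =>
    Fintype.card κ + Fintype.card ι + a.2.2.2.1 ≤ a.2.1.rank + a.2.2.1.rank + i with hS
  have hSne : S.Nonempty := ⟨(0, 1, 1, 0), by simp [hS, rank_one]⟩
  obtain ⟨⟨T, P, P', j⟩, ha, hmax⟩ :=
    exists_max_image S (fun a => moment 2 (low a.2.2.2.1 (res a.1 a.2.1 a.2.2.1 f))) hSne
  replace ha : Fintype.card κ + Fintype.card ι + j.1 ≤ P.rank + P'.rank + i := by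
    simpa [hS] using ha
  set Λ := moment 2 (low j.1 (res T P P' f)) with hΛ
  have hΛ0 : 0 ≤ Λ := moment_nonneg _ _
  have hx0 : 0 ≤ x := (moment_nonneg 1 _).trans (hx 0 1 1 (by rw [rank_one, rank_one]; omega))
  have hf0 : LowBound i Λ f := fun T₁ P₁ P₁' j₁ h₁ => by
    have h2 := rank_le_card_width P₁
    have h3 := rank_le_card_width P₁'
    exact hmax (T₁, P₁, P₁', ⟨j₁, by omega⟩) (by simpa [hS] using h₁)
  have hg : LowBound j.1 Λ (res T P P' f) := fun T₁ P₁ P₁' j₁ h₁ => by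
    rw [res_res]
    apply hf0
    have h1 := rank_add_rank_le P₁ P
    have h2 := rank_add_rank_le P' P₁'
    omega
  have hp := h j.1 (by omega) ι κ Λ _ hg
  have hm : moment 1 (res T P P' f) ≤ x := hx T P P' (by omega)
  have h4 := moment_two_low_pow_le (f := res T P P' f) (fun M => hf _) j.1 (k + 1)
  have h5 : Λ ^ 2 ^ k * Λ ^ 2 ^ k ≤ (C * x ^ (2 ^ (k + 1) - 1)) * Λ ^ 2 ^ k := by
    calc Λ ^ 2 ^ k * Λ ^ 2 ^ k = Λ ^ 2 ^ (k + 1) := by rw [← pow_add, ← two_mul, pow_succ']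
      _ ≤ _ := h4
      _ ≤ x ^ (2 ^ (k + 1) - 1) * (C * Λ ^ 2 ^ k) := by
        gcongr
        · exact moment_nonneg _ _
        · exact moment_nonneg _ _
      _ = _ := by ring
  have h6 : Λ ^ 2 ^ k ≤ C * x ^ (2 ^ (k + 1) - 1) := by
    rcases hΛ0.eq_or_lt with h0 | h0
    · rw [← h0, zero_pow (by positivity)]; positivity
    · exact le_of_mul_le_mul_right h5 (by positivity)
  calc _ ≤ C * Λ ^ 2 ^ k := h i le_rfl ι κ Λ f hf0
    _ ≤ C * (C * x ^ (2 ^ (k + 1) - 1)) := by gcongr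
    _ = _ := by ring

theorem ft_mul_left_of_invariant {f : Matrix ι κ F → ℂ} {g : Matrix κ κ F} (hg : IsUnit g)
    (hf : ∀ M, f (M * g) = f M) (Y : Matrix κ ι F) : ft f (g * Y) = ft f Y := by
  obtain ⟨g, rfl⟩ := hg
  refine Fintype.expect_equiv
    ⟨fun M => M * g.1, fun M => M * g.inv, fun M => ?_, fun M => ?_⟩ _ _ fun M => ?_
  · simp [Matrix.mul_assoc]
  · simp [Matrix.mul_assoc]
  · simp only [Equiv.coe_fn_mk]
    rw [hf]
    congr 1
    unfold chi
    rw [Matrix.neg_mul, Matrix.neg_mul, Matrix.mul_assoc, trace_neg, trace_neg, trace_mul_comm,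
      Matrix.mul_assoc]

/-- The matrix whose left multiplication replaces row `s` by the combination `l` of the rows. -/
def rowShear (s : κ) (l : κ → F) : Matrix κ κ F := 1 + vecMulVec (Pi.single s 1) (l - Pi.single s 1)

theorem rowShear_mul (s : κ) (l : κ → F) (Y : Matrix κ ι F) :
    rowShear s l * Y = Y + vecMulVec (Pi.single s 1) (l ᵥ* Y - Y.row s) := by
  simp [rowShear, Matrix.add_mul, vecMulVec_mul, sub_vecMul]

theorem isUnit_rowShear {s : κ} {l : κ → F} (hl : l s = 1) : IsUnit (rowShear s l) := by
  have h : (l - Pi.single s 1) ⬝ᵥ (Pi.single s (1 : F)) = 0 := by simp [hl]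
  refine (Units.mk (rowShear s l) (1 - vecMulVec (Pi.single s 1) (l - Pi.single s 1)) ?_ ?_).isUnit
  · simp [rowShear, Matrix.add_mul, Matrix.mul_sub, vecMulVec_mul_vecMulVec, h]
  · simp [rowShear, Matrix.sub_mul, Matrix.mul_add, vecMulVec_mul_vecMulVec, h]

/-- The rows of `Y` with index in `J` vanish. -/
def RowsZero (J : Finset κ) (Y : Matrix κ ι F) : Prop := ∀ a ∈ J, Y.row a = 0

/-- The weight of `f` on frequencies of rank at least `i` whose rows in `J` vanish. -/
def highWeight (f : Matrix ι κ F → ℂ) (i : ℕ) (J : Finset κ) : ℝ :=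
  ∑ Y : Matrix κ ι F, if i ≤ Y.rank ∧ RowsZero J Y then ‖ft f Y‖ ^ 2 else 0

theorem highWeight_insert_le {f : Matrix ι κ F → ℂ}
    (hf : ∀ g : Matrix κ κ F, IsUnit g → ∀ M, f (M * g) = f M) (i : ℕ) {J : Finset κ} {s : κ}
    (hs : s ∉ J) :
    highWeight f i (insert s J) ≤ ((Fintype.card F : ℝ) ^ i)⁻¹ * highWeight f i J := by
  have hq := one_le_card_real (F := F)
  have hu : (Pi.single s 1 : κ → F) ≠ 0 := by simp
  have h1 : ∀ l ∈ slice (Pi.single s (1 : F)), highWeight f i (insert s J)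
      = ∑ Y : Matrix κ ι F, (if i ≤ Y.rank ∧ RowsZero J Y then ‖ft f Y‖ ^ 2 else 0)
          * if l ᵥ* Y = 0 then 1 else 0 := by
    intro l hl
    have hls : l s = 1 := by simpa [mem_slice] using hl
    have hU := isUnit_rowShear hls
    obtain ⟨g, hg⟩ := hU
    refine (Fintype.sum_equiv
      ⟨fun Y => g.1 * Y, fun Y => g.inv * Y, fun M => ?_, fun M => ?_⟩ _ _ fun Y => ?_).symm
    · simp [← Matrix.mul_assoc]
    · simp [← Matrix.mul_assoc]
    · simp only [Equiv.coe_fn_mk]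
      rw [ft_mul_left_of_invariant g.isUnit (hf _ g.isUnit)]
      have hr : (g.1 * Y).rank = Y.rank := rank_mul_eq_right_of_isUnit_det _ _
        ((Matrix.isUnit_iff_isUnit_det _).1 g.isUnit)
      rw [hr, hg, rowShear_mul]
      have e3 : RowsZero (insert s J) (Y + vecMulVec (Pi.single s 1) (l ᵥ* Y - Y.row s))
          ↔ l ᵥ* Y = 0 ∧ RowsZero J Y := by
        unfold RowsZero
        have e1 : ∀ a ∈ J, (Y + vecMulVec (Pi.single s 1) (l ᵥ* Y - Y.row s)).row a = Y.row a := by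
          intro a ha
          have : a ≠ s := fun h => hs (h ▸ ha)
          ext x
          simp [vecMulVec_apply, this]
        have e2 : (Y + vecMulVec (Pi.single s 1) (l ᵥ* Y - Y.row s)).row s = l ᵥ* Y := by
          ext x
          simp [vecMulVec_apply]
        rw [forall_mem_insert, e2]
        exact and_congr_right fun _ => forall₂_congr fun a ha => by rw [e1 a ha]
      simp only [e3]
      by_cases h0 : l ᵥ* Y = 0 <;> simp [h0]
  have h2 : highWeight f i (insert s J) = 𝔼 _l ∈ slice (Pi.single s (1 : F)),
      highWeight f i (insert s J) := (expect_const (slice_nonempty hu) _).symm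
  rw [h2, expect_congr rfl h1, expect_sum_comm, highWeight, mul_sum]
  refine sum_le_sum fun Y _ => ?_
  rw [← mul_expect, expect_slice hu]
  split_ifs with hY _ _
  · rw [mul_zero]
    positivity
  · rw [mul_comm]
    have := hY.1
    gcongr
  · simp
  · simp

theorem highWeight_le {f : Matrix ι κ F → ℂ}
    (hf : ∀ g : Matrix κ κ F, IsUnit g → ∀ M, f (M * g) = f M) (i : ℕ) (J : Finset κ) :
    highWeight f i J ≤ ((Fintype.card F : ℝ) ^ (i * #J))⁻¹ * moment 2 f := by
  induction J using Finset.induction_on with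
  | empty =>
    simp only [card_empty, mul_zero, pow_zero, inv_one, one_mul, parseval, highWeight]
    refine sum_le_sum fun Y _ => ?_
    split_ifs
    · exact le_rfl
    · positivity
  | insert s J hs ih =>
    refine (highWeight_insert_le hf i hs).trans ?_
    rw [card_insert_of_notMem hs, mul_add, mul_one, pow_add, mul_inv, mul_comm (_ ^ (i * #J))⁻¹,
      mul_assoc]
    gcongr

theorem ft_eq_zero_of_forall_add {h : Matrix ι κ F → ℂ} {s : κ}
    (hh : ∀ M w, h (M + vecMulVec w (Pi.single s 1)) = h M) {Y : Matrix κ ι F} (hY : Y.row s ≠ 0) :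
    ft h Y = 0 := by
  have h1 : ∀ w, ft h Y = ft h Y * chi Y (vecMulVec w (Pi.single s 1)) := by
    intro w
    nth_rw 2 [ft]
    rw [expect_mul]
    refine Fintype.expect_equiv (Equiv.addRight (vecMulVec w (Pi.single s 1))) _ _ fun M => ?_
    simp only [Equiv.coe_addRight]
    rw [hh, chi_add_right, mul_assoc, mul_assoc, chi_neg_mul, mul_one]
  have h2 : ft h Y = 𝔼 w : ι → F, ft h Y * chi Y (vecMulVec w (Pi.single s 1)) := by
    simp_rw [← h1]
    simp
  rw [h2, ← mul_expect, expect_chi_vecMulVec, if_neg, mul_zero]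
  simpa using hY

theorem norm_expect_high_mul_le {f h : Matrix ι κ F → ℂ}
    (hf : ∀ g : Matrix κ κ F, IsUnit g → ∀ M, f (M * g) = f M) (J : Finset κ)
    (hh : ∀ s ∈ J, ∀ M w, h (M + vecMulVec w (Pi.single s 1)) = h M) (i : ℕ) :
    ‖𝔼 M, (f M - low i f M) * conj (h M)‖ ^ 2
      ≤ ((Fintype.card F : ℝ) ^ (i * #J))⁻¹ * moment 2 f * moment 2 h := by
  have e1 : 𝔼 M, (f M - low i f M) * conj (h M) = ∑ Y : Matrix κ ι F,
      (if i ≤ Y.rank ∧ RowsZero J Y then ft f Y else 0) * conj (ft h Y) := by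
    change 𝔼 M, (f - low i f) M * conj (h M) = _
    rw [parseval_inner]
    refine sum_congr rfl fun Y _ => ?_
    by_cases hY : RowsZero J Y
    · rw [ft_sub, Pi.sub_apply, low, ft_proj]
      by_cases hr : Y.rank < i
      · simp [hr, hr.not_ge]
      · simp [hr, not_lt.1 hr, hY]
    · obtain ⟨s, hs, hYs⟩ : ∃ s ∈ J, Y.row s ≠ 0 := by
        simpa [RowsZero] using hY
      simp [ft_eq_zero_of_forall_add (hh s hs) hYs]
  rw [e1]
  calc _ ≤ (∑ Y : Matrix κ ι F,
        ‖if i ≤ Y.rank ∧ RowsZero J Y then ft f Y else 0‖ * ‖ft h Y‖) ^ 2 := by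
        gcongr
        refine (norm_sum_le _ _).trans (le_of_eq (sum_congr rfl fun Y _ => ?_))
        rw [norm_mul, RCLike.norm_conj]
    _ ≤ (∑ Y : Matrix κ ι F, ‖if i ≤ Y.rank ∧ RowsZero J Y then ft f Y else 0‖ ^ 2)
        * ∑ Y, ‖ft h Y‖ ^ 2 := sum_mul_sq_le_sq_mul_sq _ _ _
    _ = highWeight f i J * moment 2 h := by
        rw [parseval, highWeight]
        congr 1
        refine sum_congr rfl fun Y _ => ?_
        split_ifs <;> simp
    _ ≤ _ := mul_le_mul_of_nonneg_right (highWeight_le hf i J) (moment_nonneg _ _)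

theorem moment_eq_of_indicator {f : Matrix ι κ F → ℂ} (hf : ∀ M, f M = 0 ∨ f M = 1) :
    moment 2 f = moment 1 f := by
  refine expect_congr rfl fun M _ => ?_
  rcases hf M with h | h <;> simp [h]

/-- The correlation of a dense-free invariant indicator `f` with an indicator `h` ignoring the
columns in `J` is the sum of a hypercontractive low-degree term and a small high-degree term. -/
theorem exists_correlation_bound (F : Type) [Field F] [Fintype F] (i k : ℕ) :
    ∃ C : ℝ, 0 ≤ C ∧ ∀ (ι κ : Type) [Fintype ι] [Fintype κ] (x : ℝ) (f h : Matrix ι κ F → ℂ)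
      (J : Finset κ), (∀ M, f M = 0 ∨ f M = 1) → (∀ M, h M = 0 ∨ h M = 1) →
      (∀ g : Matrix κ κ F, IsUnit g → ∀ M, f (M * g) = f M) →
      (∀ s ∈ J, ∀ M w, h (M + vecMulVec w (Pi.single s 1)) = h M) →
      (∀ (T : Matrix ι κ F) (P : Matrix κ κ F) (P' : Matrix ι ι F),
        Fintype.card κ + Fintype.card ι ≤ P.rank + P'.rank + i → moment 1 (res T P P' f) ≤ x) →
      ∃ lo : ℝ, 0 ≤ lo ∧ lo ^ 2 ^ (k + 1) ≤ C * (moment 1 h * x) ^ (2 ^ (k + 1) - 1) ∧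
        moment 1 (f * h)
          ≤ lo + √(((Fintype.card F : ℝ) ^ (i * #J))⁻¹ * moment 1 f * moment 1 h) := by
  obtain ⟨C, hC, hlow⟩ := exists_moment_low_le F i k
  refine ⟨C, hC, fun ι κ _ _ x f h J hf hh hinv hJ hx => ?_⟩
  have hm := hlow ι κ x f hf hx
  have hreal : ∀ M, conj (h M) = h M := fun M => by rcases hh M with h | h <;> simp [h]
  refine ⟨𝔼 M, ‖h M‖ * ‖low i f M‖, expect_nonneg fun _ _ => by positivity, ?_, ?_⟩
  · have e1 : moment 1 h = 𝔼 M, ‖h M‖ := by simp [moment]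
    calc _ ≤ (𝔼 M, ‖h M‖) ^ (2 ^ (k + 1) - 1) * 𝔼 M, ‖h M‖ * ‖low i f M‖ ^ 2 ^ (k + 1) :=
          expect_mul_pow_two_pow_le (fun _ => norm_nonneg _) (k + 1) fun _ => norm_nonneg _
      _ ≤ (𝔼 M, ‖h M‖) ^ (2 ^ (k + 1) - 1) * moment (2 ^ (k + 1)) (low i f) := by
        refine mul_le_mul_of_nonneg_left (expect_le_expect fun M _ => ?_)
          (pow_nonneg (expect_nonneg fun _ _ => norm_nonneg _) _)
        rcases hh M with h | h
        · rw [h, norm_zero, zero_mul]; positivity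
        · rw [h, norm_one, one_mul]
      _ ≤ moment 1 h ^ (2 ^ (k + 1) - 1) * (C * x ^ (2 ^ (k + 1) - 1)) := by
        rw [e1]
        exact mul_le_mul_of_nonneg_left hm
          (pow_nonneg (expect_nonneg fun _ _ => norm_nonneg _) _)
      _ = _ := by rw [mul_pow]; ring
  · have e1 : (moment 1 (f * h) : ℂ) = (𝔼 M, h M * low i f M)
        + 𝔼 M, (f M - low i f M) * conj (h M) := by
      rw [← expect_add_distrib, moment, Fintype.expect_eq_sum_div_card,
        Fintype.expect_eq_sum_div_card]
      push_cast
      congr 1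
      refine sum_congr rfl fun M _ => ?_
      rw [hreal, Pi.mul_apply]
      rcases hf M with h1 | h1 <;> rcases hh M with h2 | h2 <;> simp [h1, h2]
    have e2 : moment 1 (f * h) = ‖(moment 1 (f * h) : ℂ)‖ := by
      rw [Complex.norm_real, Real.norm_of_nonneg (moment_nonneg _ _)]
    rw [e2, e1]
    refine (norm_add_le _ _).trans (add_le_add ?_ ?_)
    · refine (RCLike.norm_expect_le (K := ℂ)).trans (le_of_eq ?_)
      exact expect_congr rfl fun M _ => norm_mul _ _
    · apply Real.le_sqrt_of_sq_le
      rw [← moment_eq_of_indicator hf, ← moment_eq_of_indicator hh]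
      exact norm_expect_high_mul_le hinv J hJ i

theorem correlation_contradiction {q a b e lo x η C : ℝ} {k d r p : ℕ} (hq : 2 ≤ q) (ha : 0 ≤ a) (hb : 0 ≤ b)
    (hx : 0 ≤ x) (hC : 0 ≤ C) (heb : e ≤ b) (hη : q ^ (1000 * d) ≤ 256 * η * q ^ k)
    (he : η * (a + b / q ^ d + 1 / q ^ k) ≤ e)
    (hlo : e ≤ lo + √((q ^ (r * d))⁻¹ * a * b)) (hlop : lo ^ p ≤ C * (b * x) ^ (p - 1))
    (hdr : d * r = 10 * k) (hk : 1 ≤ k) (hp : r ≤ p) (hxk : x * q ^ k ≤ 4 * q ^ d)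
    (hbig : 256 ^ (p + 1) * 2 ^ p * 4 ^ (p - 1) * C < q ^ k) : False := by
  have hq0 : 0 < q := by linarith
  have hq1 : 1 ≤ q := by linarith
  have hd : 1 ≤ d := by
    rcases Nat.eq_zero_or_pos d with h | h
    · subst h; omega
    · exact h
  have hr : 1 ≤ r := by
    rcases Nat.eq_zero_or_pos r with h | h
    · subst h; omega
    · exact h
  have hη0 : 0 < η := by
    have h1 : 0 < 256 * η * q ^ k := lt_of_lt_of_le (by positivity) hη
    have h2 : 0 < q ^ k := by positivity
    by_contra hn
    have : 256 * η * q ^ k ≤ 0 := mul_nonpos_of_nonpos_of_nonneg (by linarith) h2.le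
    linarith
  have he0 : 0 < e := lt_of_lt_of_le (by positivity) he
  have hbk : η / q ^ k ≤ b := by
    refine le_trans ?_ (he.trans heb)
    have : 0 ≤ η * (a + b / q ^ d) := by positivity
    calc η / q ^ k = η * (1 / q ^ k) := by ring
      _ ≤ _ := by nlinarith
  have hb0 : 0 < b := lt_of_lt_of_le (by positivity) hbk
  have hhigh : √((q ^ (r * d))⁻¹ * a * b) ≤ e / 2 := by
    rw [Real.sqrt_le_left (by positivity)]
    have h1 : q ^ d ≤ η ^ 2 * q ^ (r * d) := by
      have h3 : q ^ d * 256 ^ 2 * q ^ (2 * k) ≤ η ^ 2 * q ^ (r * d) * 256 ^ 2 * q ^ (2 * k) := by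
        calc q ^ d * 256 ^ 2 * q ^ (2 * k) ≤ q ^ d * q ^ 16 * q ^ (2 * k) := by
              have : (256 : ℝ) ^ 2 ≤ q ^ 16 := by
                calc (256 : ℝ) ^ 2 = 2 ^ 16 := by norm_num
                  _ ≤ q ^ 16 := pow_le_pow_left₀ (by norm_num) hq _
              gcongr
          _ = q ^ (d + 16 + 2 * k) := by rw [← pow_add, ← pow_add]
          _ ≤ q ^ (1000 * d * 2 + r * d) := by
              apply pow_le_pow_right₀ hq1
              rw [mul_comm r d]; omega
          _ = (q ^ (1000 * d)) ^ 2 * q ^ (r * d) := by rw [pow_add, pow_mul]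
          _ ≤ (256 * η * q ^ k) ^ 2 * q ^ (r * d) := by gcongr
          _ = _ := by ring
      have h4 : 0 < 256 ^ 2 * q ^ (2 * k) := by positivity
      rw [mul_assoc, mul_assoc _ (256 ^ 2 : ℝ)] at h3
      exact le_of_mul_le_mul_right h3 h4
    have h2 : η ^ 2 * (4 * (a * (b / q ^ d))) ≤ e ^ 2 := by
      calc η ^ 2 * (4 * (a * (b / q ^ d))) ≤ η ^ 2 * (a + b / q ^ d) ^ 2 := by
            gcongr
            nlinarith [sq_nonneg (a - b / q ^ d)]
        _ = (η * (a + b / q ^ d)) ^ 2 := by ring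
        _ ≤ e ^ 2 := by
            have : (0 : ℝ) ≤ 1 / q ^ k := by positivity
            have : 0 ≤ η * (a + b / q ^ d) := by positivity
            exact pow_le_pow_left₀ this
              (le_trans (mul_le_mul_of_nonneg_left (by linarith) hη0.le) he) 2
    calc (q ^ (r * d))⁻¹ * a * b = (q ^ d * (q ^ (r * d))⁻¹) * (a * (b / q ^ d)) := by
          field_simp
      _ ≤ η ^ 2 * (a * (b / q ^ d)) := by
          gcongr
          rw [← div_eq_mul_inv, div_le_iff₀ (by positivity)]
          exact h1
      _ ≤ _ := by linarith
  have hlo1 : η * b / (2 * q ^ d) ≤ lo := by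
    have h1 : η * (b / q ^ d) ≤ e := by
      refine le_trans ?_ he
      have : (0 : ℝ) ≤ 1 / q ^ k := by positivity
      exact mul_le_mul_of_nonneg_left (by linarith) hη0.le
    have h2 : η * b / (2 * q ^ d) = η * (b / q ^ d) / 2 := by field_simp
    rw [h2]
    linarith
  have hp1 : p = (p - 1) + 1 := by omega
  set s := p - 1 with hs
  have h5 : b * (η / (2 * q ^ d)) ^ p ≤ C * x ^ s := by
    have h6 : (b * (η / (2 * q ^ d)) ^ p) * b ^ s ≤ (C * x ^ s) * b ^ s := by
      calc (b * (η / (2 * q ^ d)) ^ p) * b ^ s = (η * b / (2 * q ^ d)) ^ p := by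
            rw [hp1]; ring
        _ ≤ lo ^ p := by gcongr
        _ ≤ _ := hlop
        _ = _ := by rw [mul_pow]; ring
    exact le_of_mul_le_mul_right h6 (by positivity)
  have h7 : (256 * η * q ^ k) ^ (p + 1)
      ≤ 256 ^ (p + 1) * 2 ^ p * C * (x * q ^ k) ^ s * q ^ (3 * k + d * p) := by
    have h8 : η / q ^ k * (η / (2 * q ^ d)) ^ p ≤ C * x ^ s :=
      (mul_le_mul_of_nonneg_right hbk (by positivity)).trans h5
    calc (256 * η * q ^ k) ^ (p + 1) = (η / q ^ k * (η / (2 * q ^ d)) ^ p) *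
          (256 ^ (p + 1) * 2 ^ p * (q ^ k) ^ s * q ^ (3 * k + d * p)) := by
          rw [hp1, div_pow, mul_pow, mul_pow, mul_pow, ← pow_mul, ← pow_mul, ← pow_mul]
          field_simp
          ring
      _ ≤ (C * x ^ s) * (256 ^ (p + 1) * 2 ^ p * (q ^ k) ^ s * q ^ (3 * k + d * p)) := by
          gcongr
      _ = _ := by rw [mul_pow]; ring
  have h9 : q ^ (1000 * d * (p + 1)) ≤
      (256 ^ (p + 1) * 2 ^ p * 4 ^ s * C) * q ^ (d * s + (3 * k + d * p)) := by
    calc q ^ (1000 * d * (p + 1)) = (q ^ (1000 * d)) ^ (p + 1) := pow_mul _ _ _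
      _ ≤ (256 * η * q ^ k) ^ (p + 1) := by gcongr
      _ ≤ _ := h7
      _ ≤ 256 ^ (p + 1) * 2 ^ p * C * (4 * q ^ d) ^ s * q ^ (3 * k + d * p) := by gcongr
      _ = _ := by rw [mul_pow, ← pow_mul, pow_add q (d * s)]; ring
  have h10 : q ^ k * q ^ (d * s + (3 * k + d * p)) ≤ q ^ (1000 * d * (p + 1)) := by
    rw [← pow_add]
    apply pow_le_pow_right₀ hq1
    have h1 : d * r ≤ d * p := Nat.mul_le_mul_left _ hp
    have h2 : d * s ≤ d * p := Nat.mul_le_mul_left _ (by omega)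
    have h3 : 1000 * d * (p + 1) = 1000 * (d * p) + 1000 * d := by ring
    omega
  have h11 := h10.trans h9
  have h12 := le_of_mul_le_mul_right h11 (by positivity)
  linarith

theorem pow_le_four_mul_prod {q : ℝ} (hq : 2 ≤ q) {K N : ℕ} (h : K ≤ N) :
    q ^ (N * K) ≤ 4 * ∏ i ∈ range K, (q ^ N - q ^ i) := by
  have h0 : (0 : ℝ) < q := by linarith
  have key : ∀ K ≤ N, q ^ (N * K) * (q ^ N - q ^ K) ≤ q ^ N * ∏ i ∈ range K, (q ^ N - q ^ i) := by
    intro K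
    induction K with
    | zero => intro _; simp
    | succ K ih =>
      intro hK
      have h1 : 0 ≤ q ^ N - q ^ K :=
        sub_nonneg.2 (pow_le_pow_right₀ (by linarith) (by omega))
      have h2 := mul_le_mul_of_nonneg_right (ih (by omega)) h1
      rw [prod_range_succ, ← mul_assoc]
      refine le_trans ?_ h2
      have h3 : q ^ N * (q ^ N - q ^ (K + 1)) ≤ (q ^ N - q ^ K) * (q ^ N - q ^ K) := by
        have : 0 ≤ q ^ N * q ^ K * (q - 2) := by
          have := sub_nonneg.2 hq
          positivity
        have := sq_nonneg (q ^ K)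
        rw [pow_succ]
        nlinarith
      calc q ^ (N * (K + 1)) * (q ^ N - q ^ (K + 1))
          = q ^ (N * K) * (q ^ N * (q ^ N - q ^ (K + 1))) := by rw [mul_add, pow_add]; ring
        _ ≤ _ := by rw [mul_assoc]; gcongr
  have half : ∀ K, K + 1 ≤ N → q ^ (N * K) ≤ 2 * ∏ i ∈ range K, (q ^ N - q ^ i) := by
    intro K hK
    have h1 := key K (by omega)
    have h2 : q ^ N ≤ 2 * (q ^ N - q ^ K) := by
      obtain ⟨t, rfl⟩ := Nat.exists_eq_add_of_le hK
      have h3 : q ^ K * 2 ≤ q ^ (K + 1 + t) := by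
        calc q ^ K * 2 ≤ q ^ K * q := by gcongr
          _ = q ^ (K + 1) := (pow_succ _ _).symm
          _ ≤ _ := pow_le_pow_right₀ (by linarith) (by omega)
      linarith
    have h3 : q ^ N * q ^ (N * K) ≤ q ^ N * (2 * ∏ i ∈ range K, (q ^ N - q ^ i)) := by
      have := mul_le_mul_of_nonneg_left h2 (pow_nonneg h0.le (N * K))
      linarith
    exact le_of_mul_le_mul_left h3 (by positivity)
  rcases Nat.lt_or_ge K N with h1 | h1
  · have := half K h1
    have h3 : 0 < q ^ (N * K) := by positivity
    linarith
  · obtain rfl : K = N := le_antisymm h h1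
    rcases K with _ | K
    · simp
    have h2 := half K le_rfl
    rw [prod_range_succ]
    have h3 : q ^ (K + 1) ≤ 2 * (q ^ (K + 1) - q ^ K) := by
      have : 0 ≤ q ^ K * (q - 2) := mul_nonneg (by positivity) (by linarith)
      rw [pow_succ]
      linarith
    calc q ^ ((K + 1) * (K + 1)) = q ^ ((K + 1) * K) * q ^ (K + 1) := by rw [← pow_add]; ring_nf
      _ ≤ (2 * ∏ i ∈ range K, (q ^ (K + 1) - q ^ i)) * (2 * (q ^ (K + 1) - q ^ K)) :=
        mul_le_mul h2 h3 (by positivity) (le_trans (by positivity) h2)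
      _ = _ := by ring

theorem pow_le_four_mul_card_linearIndependent {V : Type} [AddCommGroup V] [Module F V] [Finite V]
    {μ : Type} [Fintype μ] (h : Fintype.card μ ≤ finrank F V) :
    (Fintype.card F : ℝ) ^ (finrank F V * Fintype.card μ)
      ≤ 4 * (Nat.card {v : μ → V // LinearIndependent F v} : ℝ) := by
  have : Module.Finite F V := Module.Finite.of_finite
  have e : Nat.card {v : μ → V // LinearIndependent F v}
      = Nat.card {v : Fin (Fintype.card μ) → V // LinearIndependent F v} := by
    refine Nat.card_congr ((Equiv.arrowCongr (Fintype.equivFin μ) (Equiv.refl V)).subtypeEquiv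
      fun v => ?_)
    exact (linearIndependent_equiv (Fintype.equivFin μ).symm).symm
  rw [e, card_linearIndependent (K := F) (V := V) h]
  refine (pow_le_four_mul_prod (q := (Fintype.card F : ℝ)) ?_ h).trans (le_of_eq ?_)
  · exact_mod_cast Fintype.one_lt_card
  · push_cast
    rw [← Fin.prod_univ_eq_prod_range (fun i => (Fintype.card F : ℝ) ^ finrank F V
      - (Fintype.card F : ℝ) ^ i)]
    congr 1
    refine prod_congr rfl fun i _ => ?_
    rw [Nat.cast_sub (Nat.pow_le_pow_right Fintype.card_pos (by omega))]
    push_cast; rfl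

theorem card_filter_comp_mul {X Y : Type} [AddCommGroup X] [AddCommGroup Y] [Fintype X] [Fintype Y]
    [Module F X] [Module F Y] (Ψ : X →ₗ[F] Y) (hΨ : Function.Surjective Ψ) (Z : Y → Prop) :
    #{x | Z (Ψ x)} * Fintype.card Y = #{y | Z y} * Fintype.card X := by
  have hfib : ∀ y, #{x | Ψ x = y} = #{x | Ψ x = 0} := fun y =>
    AddMonoidHom.card_fiber_eq_of_mem_range Ψ.toAddMonoidHom (hΨ y) (hΨ 0)
  have h1 : #{x | Z (Ψ x)} = #{y | Z y} * #{x | Ψ x = 0} := by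
    rw [card_eq_sum_card_fiberwise (f := Ψ) (t := ({y | Z y} : Finset Y)) (by intro x; simp)]
    rw [sum_congr rfl (g := fun _ => #{x | Ψ x = 0}), sum_const, smul_eq_mul]
    intro y hy
    rw [← hfib y]
    congr 1
    ext x
    simp only [mem_filter, mem_univ, true_and] at hy ⊢
    exact ⟨fun h => h.2, fun h => ⟨h ▸ hy, h⟩⟩
  have h2 : Fintype.card X = Fintype.card Y * #{x | Ψ x = 0} := by
    rw [← card_univ, card_eq_sum_card_fiberwise (f := Ψ) (t := (univ : Finset Y)) (by intro x; simp)]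
    rw [sum_congr rfl (g := fun _ => #{x | Ψ x = 0}), sum_const, smul_eq_mul, card_univ]
    intro y _
    rw [← hfib y]
  rw [h1, h2]; ring

/-- The column space of a matrix. -/
def colspan {ι κ : Type} [Fintype κ] (M : Matrix ι κ F) : Submodule F (ι → F) :=
  LinearMap.range M.mulVecLin

theorem finrank_colspan (M : Matrix ι κ F) : finrank F (colspan M) = M.rank := rfl

theorem mulVec_mem_colspan (M : Matrix ι κ F) (x : κ → F) : M *ᵥ x ∈ colspan M := ⟨x, rfl⟩

theorem colspan_le_iff {M : Matrix ι κ F} {L : Submodule F (ι → F)} :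
    colspan M ≤ L ↔ ∀ x, M *ᵥ x ∈ L := by
  constructor
  · intro h x; exact h ⟨x, rfl⟩
  · rintro h _ ⟨x, rfl⟩; exact h x

theorem colspan_mul {μ : Type} [Fintype μ] (M : Matrix ι κ F) (g : Matrix κ μ F) :
    colspan (M * g) = (colspan g).map M.mulVecLin := by
  unfold colspan
  rw [Matrix.mulVecLin_mul, LinearMap.range_comp]

theorem rank_eq_card_iff_injective {M : Matrix ι κ F} :
    M.rank = Fintype.card κ ↔ Function.Injective M.mulVec := by
  have h := LinearMap.finrank_range_add_finrank_ker M.mulVecLin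
  rw [Module.finrank_fintype_fun_eq_card] at h
  have h2 : Function.Injective M.mulVec ↔ LinearMap.ker M.mulVecLin = ⊥ :=
    (LinearMap.ker_eq_bot (f := M.mulVecLin)).symm
  rw [h2, ← Submodule.finrank_eq_zero (R := F)]
  change finrank F (LinearMap.range M.mulVecLin) = _ ↔ _
  omega

theorem pow_le_four_mul_card_rank (h : Fintype.card κ ≤ Fintype.card ι) :
    (Fintype.card F : ℝ) ^ (Fintype.card ι * Fintype.card κ)
      ≤ 4 * (Nat.card {M : Matrix ι κ F // M.rank = Fintype.card κ} : ℝ) := by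
  have h1 := pow_le_four_mul_card_linearIndependent (F := F) (V := ι → F) (μ := κ)
    (by simpa using h)
  rw [Module.finrank_fintype_fun_eq_card] at h1
  refine h1.trans (le_of_eq ?_)
  congr 2
  refine Nat.card_congr ((Equiv.subtypeEquiv
    ⟨fun v => (Matrix.of v)ᵀ, fun M => Mᵀ, fun _ => rfl, fun _ => rfl⟩) fun v => ?_)
  rw [rank_eq_card_iff_injective, Matrix.mulVec_injective_iff]
  rfl

theorem pow_le_four_mul_card_complement {V : Type} [AddCommGroup V] [Module F V] [Fintype V]
    (Q : Submodule F V) {s : ℕ} (hs : finrank F Q + s = finrank F V) :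
    (Fintype.card F : ℝ) ^ (finrank F V * s)
      ≤ 4 * (Nat.card {v : Fin s → V // LinearIndependent F (Q.mkQ ∘ v)} : ℝ) := by
  have : Module.Finite F V := Module.Finite.of_finite
  have : Fintype (V ⧸ Q) := Fintype.ofFinite _
  have hq : finrank F (V ⧸ Q) = s := by
    have := Q.finrank_quotient_add_finrank; omega
  have h1 := card_filter_comp_mul (F := F) (X := Fin s → V) (Y := Fin s → V ⧸ Q)
    (Q.mkQ.compLeft (Fin s)) (fun y => ⟨fun i => (Q.mkQ_surjective (y i)).choose,
      funext fun i => (Q.mkQ_surjective (y i)).choose_spec⟩) (fun y => LinearIndependent F y)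
  have h2 := pow_le_four_mul_card_linearIndependent (F := F) (V := V ⧸ Q) (μ := Fin s) (by simp [hq])
  rw [Nat.card_eq_fintype_card, Fintype.card_subtype] at h2 ⊢
  rw [Fintype.card_fun, Fintype.card_fun, card_eq_pow_finrank (K := F) (V := V),
    card_eq_pow_finrank (K := F) (V := V ⧸ Q), Fintype.card_fin, hq, ← pow_mul, ← pow_mul] at h1
  rw [hq, Fintype.card_fin] at h2
  have h3 : (#{v : Fin s → V | LinearIndependent F (Q.mkQ ∘ v)} : ℝ) * (Fintype.card F : ℝ) ^ (s * s)
      = #{y : Fin s → V ⧸ Q | LinearIndependent F y} * (Fintype.card F : ℝ) ^ (finrank F V * s) := by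
    exact_mod_cast h1
  have hpos : 0 < (Fintype.card F : ℝ) ^ (s * s) :=
    pow_pos (by exact_mod_cast Fintype.card_pos) _
  refine le_of_mul_le_mul_right ?_ hpos
  have := mul_le_mul_of_nonneg_right h2
    (show 0 ≤ (Fintype.card F : ℝ) ^ (finrank F V * s) by positivity)
  linarith

theorem sup_span_eq_of_linearIndependent_mkQ {V : Type} [AddCommGroup V] [Module F V] [Finite V]
    {Q : Submodule F V} {s : ℕ} (hs : finrank F Q + s = finrank F V) {v : Fin s → V}
    (hv : LinearIndependent F (Q.mkQ ∘ v)) : Q ⊔ Submodule.span F (Set.range v) = ⊤ := by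
  have : Module.Finite F V := Module.Finite.of_finite
  have hq : finrank F (V ⧸ Q) = s := by
    have := Q.finrank_quotient_add_finrank; omega
  have h := hv.span_eq_top_of_card_eq_finrank' (by simp [hq])
  rw [Set.range_comp, Submodule.span_image] at h
  have h2 := congrArg (Submodule.comap Q.mkQ) h
  rwa [Submodule.comap_map_mkQ, Submodule.comap_top] at h2

theorem card_segment_le {V : Type} [AddCommGroup V] [Module F V] [Fintype V]
    (Q W : Submodule F V) {k : ℕ} (hk : finrank F Q ≤ k) :
    (Nat.card {L : Submodule F V // finrank F L = k ∧ Q ≤ L ∧ L ≤ W} : ℝ)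
      ≤ 4 * (Fintype.card F : ℝ) ^ ((k - finrank F Q) * (finrank F W - k)) := by
  have : Module.Finite F V := Module.Finite.of_finite
  obtain ⟨s, rfl⟩ := Nat.exists_eq_add_of_le hk
  set S := {L : Submodule F V // finrank F L = finrank F Q + s ∧ Q ≤ L ∧ L ≤ W} with hS
  have : Fintype S := Fintype.ofFinite _
  have hq0 : 0 < (Fintype.card F : ℝ) := by exact_mod_cast Fintype.card_pos
  rcases isEmpty_or_nonempty S with he | ⟨⟨L₀, hL₀, _, hL₀W⟩⟩
  · rw [Nat.card_of_isEmpty, Nat.cast_zero]; positivity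
  have hkW : finrank F Q + s ≤ finrank F W := hL₀ ▸ Submodule.finrank_mono hL₀W
  let B : S → Type := fun L =>
    {v : Fin s → L.1 // LinearIndependent F ((Q.submoduleOf L.1).mkQ ∘ v)}
  have hdim : ∀ L : S, finrank F (Q.submoduleOf L.1) + s = finrank F L.1 := by
    intro L
    rw [(Submodule.submoduleOfEquivOfLe L.2.2.1).finrank_eq, L.2.1]
  have hB : ∀ L : S, (Fintype.card F : ℝ) ^ ((finrank F Q + s) * s) ≤ 4 * (Nat.card (B L) : ℝ) := by
    intro L
    have := pow_le_four_mul_card_complement (F := F) (Q.submoduleOf L.1) (hdim L)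
    rwa [L.2.1] at this
  have hsup : ∀ (L : S) (v : B L), Q ⊔ Submodule.span F (Set.range fun i => (v.1 i : V)) = L.1 := by
    intro L v
    have h := sup_span_eq_of_linearIndependent_mkQ (hdim L) v.2
    have h2 := congrArg (Submodule.map L.1.subtype) h
    rw [Submodule.map_sup, Submodule.map_span, ← Set.range_comp, Submodule.map_top,
      Submodule.range_subtype] at h2
    refine Eq.trans ?_ h2
    congr 1
    rw [Submodule.submoduleOf, Submodule.map_comap_subtype, inf_eq_right.2 L.2.2.1]
  have hinj : Function.Injective (fun p : (L : S) × B L => fun i => (⟨(p.2.1 i : V),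
      p.1.2.2.2 (p.2.1 i).2⟩ : W)) := by
    rintro ⟨L, v⟩ ⟨L', v'⟩ h
    have hv : ∀ i, (v.1 i : V) = v'.1 i := fun i => congrArg Subtype.val (congrFun h i)
    have hL : L = L' := by
      apply Subtype.ext
      rw [← hsup L v, ← hsup L' v']
      simp only [hv]
    subst hL
    congr 1
    exact Subtype.ext (funext fun i => Subtype.ext (hv i))
  have hcard := Nat.card_le_card_of_injective _ hinj
  rw [Nat.card_sigma, Nat.card_fun, Nat.card_eq_fintype_card (α := W), card_eq_pow_finrank (K := F),
    Nat.card_eq_fintype_card (α := Fin s), Fintype.card_fin, ← pow_mul] at hcard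
  have hcard' : ∑ L : S, (Nat.card (B L) : ℝ) ≤ (Fintype.card F : ℝ) ^ (finrank F W * s) := by
    exact_mod_cast hcard
  have hsum : (Nat.card S : ℝ) * (Fintype.card F : ℝ) ^ ((finrank F Q + s) * s)
      ≤ 4 * (Fintype.card F : ℝ) ^ (finrank F W * s) := by
    calc _ = ∑ L : S, (Fintype.card F : ℝ) ^ ((finrank F Q + s) * s) := by
          rw [sum_const, card_univ, nsmul_eq_mul, Nat.card_eq_fintype_card]
      _ ≤ ∑ L : S, 4 * (Nat.card (B L) : ℝ) := sum_le_sum fun L _ => hB L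
      _ ≤ _ := by rw [← mul_sum]; gcongr
  refine le_of_mul_le_mul_right (hsum.trans (le_of_eq ?_))
    (pow_pos hq0 ((finrank F Q + s) * s))
  obtain ⟨t, ht⟩ := Nat.exists_eq_add_of_le hkW
  rw [mul_assoc, ← pow_add, ht, Nat.add_sub_cancel_left, Nat.add_sub_cancel_left]
  ring_nf

theorem mulVecLin_toMatrix' (f : (κ → F) →ₗ[F] ι → F) : (LinearMap.toMatrix' f).mulVecLin = f := by
  rw [← Matrix.toLin'_apply', Matrix.toLin'_toMatrix']

theorem exists_colspan_eq {R : Submodule F (ι → F)} (h : finrank F R = Fintype.card κ) :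
    ∃ A : Matrix ι κ F, colspan A = R := by
  let e : (κ → F) ≃ₗ[F] R := LinearEquiv.ofFinrankEq _ _ (by simp [h])
  refine ⟨LinearMap.toMatrix' (R.subtype ∘ₗ e.toLinearMap), ?_⟩
  rw [colspan, mulVecLin_toMatrix', LinearMap.range_comp, LinearEquiv.range, Submodule.map_top,
    Submodule.range_subtype]

theorem colspan_fromCols {μ ν : Type} [Fintype μ] [Fintype ν] (A : Matrix ι μ F)
    (B : Matrix ι ν F) : colspan (fromCols A B) = colspan A ⊔ colspan B := by
  apply le_antisymm
  · rw [colspan_le_iff]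
    intro x
    rw [fromCols_mulVec]
    exact Submodule.add_mem_sup (mulVec_mem_colspan _ _) (mulVec_mem_colspan _ _)
  · refine sup_le (colspan_le_iff.2 fun x => ?_) (colspan_le_iff.2 fun x => ?_)
    · have := mulVec_mem_colspan (fromCols A B) (Sum.elim x 0)
      rw [fromCols_mulVec] at this
      simpa using this
    · have := mulVec_mem_colspan (fromCols A B) (Sum.elim 0 x)
      rw [fromCols_mulVec] at this
      simpa using this

theorem exists_flag_matrix {μ ν : Type} [Fintype μ] [Fintype ν] {L R : Submodule F (ι → F)}
    (hL : finrank F L = Fintype.card (μ ⊕ ν)) (hR : finrank F R = Fintype.card μ) (hRL : R ≤ L) :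
    ∃ M : Matrix ι (μ ⊕ ν) F, colspan M = L ∧ colspan M.toCols₁ = R := by
  obtain ⟨C, hC⟩ := exists_isCompl R
  have h1 : R ⊔ C ⊓ L = L := by
    rw [← sup_inf_assoc_of_le C hRL, hC.sup_eq_top, top_inf_eq]
  have h2 : R ⊓ (C ⊓ L) = ⊥ := by
    rw [← inf_assoc, hC.inf_eq_bot, bot_inf_eq]
  have h3 := Submodule.finrank_sup_add_finrank_inf_eq R (C ⊓ L)
  rw [h1, h2, finrank_bot, hL, hR, Fintype.card_sum] at h3
  obtain ⟨A, hA⟩ := exists_colspan_eq (F := F) hR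
  obtain ⟨B, hB⟩ := exists_colspan_eq (F := F) (κ := ν) (R := C ⊓ L) (by omega)
  exact ⟨fromCols A B, by rw [colspan_fromCols, hA, hB, h1], by rw [toCols₁_fromCols, hA]⟩

theorem exists_mul_eq_of_colspan_le {M₀ M : Matrix ι κ F} (h : colspan M ≤ colspan M₀) :
    ∃ g : Matrix κ κ F, M₀ * g = M := by
  have h1 : ∀ j, ∃ x, M₀ *ᵥ x = M.col j := fun j => by
    obtain ⟨x, hx⟩ := h (mulVec_mem_colspan M (Pi.single j 1))
    exact ⟨x, by rw [← Matrix.mulVec_single_one]; exact hx⟩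
  choose x hx using h1
  refine ⟨Matrix.of fun i j => x j i, ?_⟩
  ext i j
  exact congrFun (hx j) i

theorem toCols₁_mul {μ ν : Type} [Fintype μ] [Fintype ν] (M : Matrix ι κ F)
    (g : Matrix κ (μ ⊕ ν) F) : (M * g).toCols₁ = M * g.toCols₁ := rfl

theorem rank_toCols₁ {μ ν : Type} [Fintype μ] [Fintype ν] {M : Matrix ι (μ ⊕ ν) F}
    (hM : M.rank = Fintype.card (μ ⊕ ν)) : M.toCols₁.rank = Fintype.card μ := by
  rw [rank_eq_card_iff_injective] at hM ⊢
  intro x y hxy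
  have hz : ∀ z : μ → F, M *ᵥ Sum.elim z 0 = M.toCols₁ *ᵥ z := fun z => by
    conv_lhs => rw [← fromCols_toCols M, fromCols_mulVec]
    simp
  have := hM (show M *ᵥ Sum.elim x 0 = M *ᵥ Sum.elim y 0 by rw [hz, hz]; exact hxy)
  funext i
  simpa using congrFun this (Sum.inl i)

theorem colspan_toCols₁_le {μ ν : Type} [Fintype μ] [Fintype ν] (M : Matrix ι (μ ⊕ ν) F) :
    colspan M.toCols₁ ≤ colspan M := by
  conv_rhs => rw [← fromCols_toCols M, colspan_fromCols]
  exact le_sup_left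

theorem exists_card_flag {μ ν : Type} [Fintype μ] [Fintype ν] :
    ∃ N₀ : ℕ, ∀ Z : Submodule F (ι → F) → Submodule F (ι → F) → Prop,
      Nat.card {M : Matrix ι (μ ⊕ ν) F //
          M.rank = Fintype.card (μ ⊕ ν) ∧ Z (colspan M) (colspan M.toCols₁)}
        = Nat.card {p : Submodule F (ι → F) × Submodule F (ι → F) //
            finrank F p.1 = Fintype.card (μ ⊕ ν) ∧ finrank F p.2 = Fintype.card μ ∧ p.2 ≤ p.1 ∧
              Z p.1 p.2} * N₀ := by
  refine ⟨#{g : Matrix (μ ⊕ ν) (μ ⊕ ν) F | colspan g = ⊤ ∧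
    colspan g.toCols₁ = colspan (1 : Matrix (μ ⊕ ν) (μ ⊕ ν) F).toCols₁}, fun Z => ?_⟩
  have : Fintype (Submodule F (ι → F)) := Fintype.ofFinite _
  rw [Nat.card_eq_fintype_card, Nat.card_eq_fintype_card, Fintype.card_subtype,
    Fintype.card_subtype]
  rw [card_eq_sum_card_fiberwise (f := fun M : Matrix ι (μ ⊕ ν) F => (colspan M, colspan M.toCols₁))
    (t := ({p | finrank F p.1 = Fintype.card (μ ⊕ ν) ∧ finrank F p.2 = Fintype.card μ ∧ p.2 ≤ p.1 ∧
              Z p.1 p.2} : Finset (Submodule F (ι → F) × Submodule F (ι → F))))]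
  · rw [sum_const_nat]
    rintro ⟨L, R⟩ hp
    simp only [mem_filter, mem_univ, true_and] at hp
    obtain ⟨hL, hR, hRL, hZ⟩ := hp
    obtain ⟨M₀, rfl, rfl⟩ := exists_flag_matrix hL hR hRL
    have hinj : Function.Injective M₀.mulVec := rank_eq_card_iff_injective.1 hL
    have hmap := Submodule.map_injective_of_injective (f := M₀.mulVecLin) hinj
    have h1 : ∀ g : Matrix (μ ⊕ ν) (μ ⊕ ν) F, colspan (M₀ * g) = colspan M₀ ↔ colspan g = ⊤ := by
      intro g
      have e : colspan M₀ = Submodule.map M₀.mulVecLin ⊤ := (Submodule.map_top _).symm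
      rw [colspan_mul, e, hmap.eq_iff]
    have h2 : ∀ g : Matrix (μ ⊕ ν) (μ ⊕ ν) F, colspan (M₀ * g).toCols₁ = colspan M₀.toCols₁ ↔
        colspan g.toCols₁ = colspan (1 : Matrix (μ ⊕ ν) (μ ⊕ ν) F).toCols₁ := by
      intro g
      conv_lhs => rw [← Matrix.mul_one M₀, Matrix.mul_assoc, Matrix.one_mul, toCols₁_mul, toCols₁_mul,
        colspan_mul, colspan_mul, hmap.eq_iff]
    symm
    refine card_bij (fun g _ => M₀ * g) ?_ ?_ ?_
    · intro g hg
      simp only [mem_filter, mem_univ, true_and] at hg ⊢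
      have e1 := (h1 g).2 hg.1
      have e2 := (h2 g).2 hg.2
      refine ⟨⟨?_, ?_⟩, ?_⟩
      · rw [← finrank_colspan, e1, hL]
      · rw [e1, e2]; exact hZ
      · rw [e1, e2]
    · intro g _ g' _ h
      ext i j
      have : M₀ *ᵥ g.col j = M₀ *ᵥ g'.col j := by
        funext a; exact congrFun (congrFun h a) j
      exact congrFun (hinj this) i
    · intro M hM
      simp only [mem_filter, mem_univ, true_and, Prod.mk.injEq] at hM
      obtain ⟨g, rfl⟩ := exists_mul_eq_of_colspan_le hM.2.1.le
      refine ⟨g, ?_, rfl⟩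
      simp only [mem_filter, mem_univ, true_and]
      exact ⟨(h1 g).1 hM.2.1, (h2 g).1 hM.2.2⟩
  · intro M hM
    simp only [coe_filter, Set.mem_ofPred_eq, mem_univ, true_and] at hM ⊢
    exact ⟨hM.1, rank_toCols₁ hM.1, colspan_toCols₁_le M, hM.2⟩

theorem finrank_map_mkQ_add {V : Type} [AddCommGroup V] [Module F V] [Finite V]
    {L S : Submodule F V} (h : L ≤ S) : finrank F (S.map L.mkQ) + finrank F L = finrank F S := by
  have : Module.Finite F V := Module.Finite.of_finite
  have h1 := (L.mkQ.domRestrict S).finrank_range_add_finrank_ker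
  rw [LinearMap.range_domRestrict, LinearMap.ker_domRestrict, Submodule.ker_mkQ] at h1
  rw [← h1, ← (Submodule.submoduleOfEquivOfLe h).finrank_eq]
  rfl

/-- Compression of a matrix, seen as a linear map, to a subspace of the source and along a linear
map out of the target. -/
def compress {V : Type} [AddCommGroup V] [Module F V] (g : (ι → F) →ₗ[F] V)
    (U : Submodule F (κ → F)) : Matrix ι κ F →ₗ[F] U →ₗ[F] V where
  toFun M := g ∘ₗ M.mulVecLin ∘ₗ U.subtype
  map_add' M N := by
    rw [Matrix.mulVecLin_add, LinearMap.add_comp, LinearMap.comp_add]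
  map_smul' c M := by
    ext x
    simp

theorem compress_surjective {V : Type} [AddCommGroup V] [Module F V] {g : (ι → F) →ₗ[F] V}
    (hg : Function.Surjective g) (U : Submodule F (κ → F)) :
    Function.Surjective (compress g U) := by
  intro φ
  obtain ⟨σ, hσ⟩ := g.exists_rightInverse_of_surjective (LinearMap.range_eq_top.2 hg)
  obtain ⟨ρ, hρ⟩ := U.subtype.exists_leftInverse_of_injective U.ker_subtype
  refine ⟨LinearMap.toMatrix' (σ ∘ₗ φ ∘ₗ ρ), ?_⟩
  change g ∘ₗ (LinearMap.toMatrix' (σ ∘ₗ φ ∘ₗ ρ)).mulVecLin ∘ₗ U.subtype = φ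
  rw [mulVecLin_toMatrix', LinearMap.comp_assoc, LinearMap.comp_assoc, hρ, LinearMap.comp_id,
    ← LinearMap.comp_assoc, hσ, LinearMap.id_comp]

theorem card_colspan_add_le_mul (L : Submodule F (ι → F)) (T : Matrix ι κ F) (P : Matrix κ κ F)
    (P' : Matrix ι ι F) (hL : L ≤ colspan P' ⊔ colspan T) :
    #{M : Matrix ι κ F | colspan (T + P' * M * P) ≤ L}
      * Fintype.card F ^ (P.rank * (finrank F ↑(colspan P' ⊔ colspan T) - finrank F L))
      ≤ Fintype.card (Matrix ι κ F) := by
  rcases Finset.eq_empty_or_nonempty {M : Matrix ι κ F | colspan (T + P' * M * P) ≤ L} with h | ⟨M₀, h₀⟩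
  · rw [h]; simp
  replace h₀ := (mem_filter.1 h₀).2
  have hsup : colspan P' ⊔ colspan T = L ⊔ colspan P' := by
    apply le_antisymm
    · refine sup_le le_sup_right (colspan_le_iff.2 fun x => ?_)
      have h1 := colspan_le_iff.1 h₀ x
      rw [Matrix.add_mulVec, Matrix.mul_assoc, ← Matrix.mulVec_mulVec] at h1
      have h2 := mulVec_mem_colspan P' ((M₀ * P) *ᵥ x)
      have h3 := Submodule.sub_mem_sup (S := L) h1 h2
      rwa [add_sub_cancel_right] at h3
    · exact sup_le hL le_sup_left
  let G : (ι → F) →ₗ[F] ((ι → F) ⧸ L) := L.mkQ ∘ₗ P'.mulVecLin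
  have hrange : LinearMap.range G = (colspan P' ⊔ colspan T).map L.mkQ := by
    rw [hsup, Submodule.map_sup, LinearMap.range_comp, Submodule.mkQ_map_self, bot_sup_eq]
    rfl
  have hfin : finrank F (LinearMap.range G) = finrank F ↑(colspan P' ⊔ colspan T) - finrank F L := by
    rw [hrange, ← finrank_map_mkQ_add hL, Nat.add_sub_cancel]
  have hsurj := compress_surjective (F := F) (G.surjective_rangeRestrict) (colspan P)
  have : Finite (LinearMap.range G) := Subtype.finite
  have : Module.Finite F (colspan P →ₗ[F] LinearMap.range G) := inferInstance
  have : Fintype (colspan P →ₗ[F] LinearMap.range G) :=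
    @Fintype.ofFinite _ (Module.finite_of_finite F)
  have h1 := card_filter_comp_mul (compress G.rangeRestrict (colspan P)) hsurj
    (fun y => y = compress G.rangeRestrict (colspan P) M₀)
  rw [card_eq_pow_finrank (K := F) (V := colspan P →ₗ[F] LinearMap.range G), finrank_linearMap,
    hfin, finrank_colspan, card_eq_one.2 ⟨compress G.rangeRestrict (colspan P) M₀, by ext; simp⟩,
    one_mul] at h1
  rw [← h1]
  refine Nat.mul_le_mul_right _ (card_le_card fun M hM => ?_)
  simp only [mem_filter, mem_univ, true_and] at hM ⊢
  ext ⟨_, x, rfl⟩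
  have e1 := colspan_le_iff.1 h₀ x
  have e2 := colspan_le_iff.1 hM x
  have e3 := L.sub_mem e2 e1
  rw [← Matrix.sub_mulVec, add_sub_add_left_eq_sub, ← Matrix.sub_mul, ← Matrix.mul_sub] at e3
  change L.mkQ (P' *ᵥ (M *ᵥ (P *ᵥ x))) = L.mkQ (P' *ᵥ (M₀ *ᵥ (P *ᵥ x)))
  rw [← sub_eq_zero, ← map_sub]
  change Submodule.Quotient.mk _ = _
  rw [Submodule.Quotient.mk_eq_zero]
  simpa [Matrix.mulVec_mulVec, Matrix.sub_mulVec, Matrix.mul_sub, Matrix.sub_mul, Matrix.mul_assoc] using e3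

theorem exists_rank_mul_eq (P : Matrix κ κ F) {s : ℕ} (hs : s ≤ P.rank) :
    ∃ E : Matrix κ κ F, (E * P).rank = s := by
  obtain ⟨t, ht⟩ := Nat.exists_eq_add_of_le hs
  induction t generalizing P with
  | zero => exact ⟨1, by rw [Matrix.one_mul, ht, add_zero]⟩
  | succ t ih =>
    have hP : P ≠ 0 := by
      rintro rfl
      rw [Matrix.rank_zero] at ht; omega
    obtain ⟨x, hx⟩ : ∃ x, P *ᵥ x ≠ 0 := by
      by_contra! h
      exact hP (Matrix.mulVec_injective (by funext x; rw [h, Matrix.zero_mulVec]))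
    obtain ⟨l, hl⟩ := slice_nonempty hx
    have h1 := rank_killer_mul_of_inIm (mem_slice.1 hl) (Y := P) ⟨x, rfl⟩
    obtain ⟨E, hE⟩ := ih (killer (P *ᵥ x) l * P) (by omega) (by omega)
    exact ⟨E * killer (P *ᵥ x) l, by rw [Matrix.mul_assoc, hE]⟩

/-- The indicator of matrices of full column rank whose column space satisfies a predicate. -/
def spaceInd (A : Submodule F (ι → F) → Prop) (M : Matrix ι κ F) : ℂ :=
  if M.rank = Fintype.card κ ∧ A (colspan M) then 1 else 0

theorem moment_one_ite (Z : Matrix ι κ F → Prop) :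
    moment 1 (fun M => if Z M then (1 : ℂ) else 0)
      = #{M | Z M} / (Fintype.card (Matrix ι κ F) : ℝ) := by
  rw [moment, Fintype.expect_eq_sum_div_card]
  congr 1
  rw [card_filter]
  push_cast
  refine sum_congr rfl fun M _ => ?_
  split_ifs <;> simp

theorem moment_res_spaceInd_le_of_eq {A : Submodule F (ι → F) → Prop} {ξ : ℝ} (hξ : 0 ≤ ξ) {r : ℕ}
    (hA : ∀ Q W : Submodule F (ι → F), Q ≤ W → finrank F Q + (Fintype.card ι - finrank F W) = r →
      (Nat.card {L : Submodule F (ι → F) // finrank F L = Fintype.card κ ∧ Q ≤ L ∧ L ≤ W ∧ A L} : ℝ)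
        ≤ ξ * Nat.card {L : Submodule F (ι → F) // finrank F L = Fintype.card κ ∧ Q ≤ L ∧ L ≤ W})
    (T : Matrix ι κ F) (P : Matrix κ κ F) (P' : Matrix ι ι F)
    (hr : Fintype.card κ - P.rank
      + (Fintype.card ι - finrank F ↑(colspan P' ⊔ colspan T)) = r) :
    moment 1 (res T P P' (spaceInd A)) ≤ 4 * ξ := by
  obtain ⟨Good, hGood⟩ : ∃ Good : Matrix ι κ F → Prop, ∀ M, Good M ↔
      (T + P' * M * P).rank = Fintype.card κ ∧ A (colspan (T + P' * M * P)) :=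
    ⟨_, fun _ => Iff.rfl⟩
  refine le_of_eq_of_le (Eq.trans ?_ (moment_one_ite Good)) ?_
  · congr 1
    funext M
    unfold GrassTest.res spaceInd
    simp only [hGood]
  have hPk : P.rank ≤ Fintype.card κ := P.rank_le_card_width
  set W := colspan P' ⊔ colspan T with hW
  let Q : Submodule F (ι → F) := (LinearMap.ker P.mulVecLin).map T.mulVecLin
  have hcardpos : (0 : ℝ) < Fintype.card (Matrix ι κ F) := by exact_mod_cast Fintype.card_pos
  have hker : ∀ M : Matrix ι κ F, ∀ x ∈ LinearMap.ker P.mulVecLin, (T + P' * M * P) *ᵥ x = T *ᵥ x := by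
    intro M x hx
    have hx' : P *ᵥ x = 0 := hx
    rw [Matrix.add_mulVec, ← Matrix.mulVec_mulVec, hx', Matrix.mulVec_zero, add_zero]
  have hQM : ∀ M : Matrix ι κ F, Q ≤ colspan (T + P' * M * P) := by
    rintro M _ ⟨x, hx, rfl⟩
    exact ⟨x, hker M x hx⟩
  have hMW : ∀ M : Matrix ι κ F, colspan (T + P' * M * P) ≤ W := by
    intro M
    refine colspan_le_iff.2 fun x => ?_
    rw [Matrix.add_mulVec, Matrix.mul_assoc, ← Matrix.mulVec_mulVec]
    exact add_mem (Submodule.mem_sup_right (mulVec_mem_colspan _ _))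
      (Submodule.mem_sup_left (mulVec_mem_colspan _ _))
  have hkP := LinearMap.finrank_range_add_finrank_ker P.mulVecLin
  rw [Module.finrank_fintype_fun_eq_card] at hkP
  change P.rank + _ = _ at hkP
  have hQdim : ∀ M : Matrix ι κ F, (T + P' * M * P).rank = Fintype.card κ → finrank F Q = Fintype.card κ - P.rank := by
    intro M hM
    rw [rank_eq_card_iff_injective] at hM
    have hQe : Q = (LinearMap.ker P.mulVecLin).map (T + P' * M * P).mulVecLin := by
      apply Submodule.ext
      intro y
      constructor
      · rintro ⟨x, hx, rfl⟩; exact ⟨x, hx, hker M x hx⟩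
      · rintro ⟨x, hx, rfl⟩; exact ⟨x, hx, (hker M x hx).symm⟩
    rw [hQe, ← (Submodule.equivMapOfInjective _ hM _).finrank_eq, ← hkP]
    omega
  by_cases hQ : finrank F Q = Fintype.card κ - P.rank
  swap
  · rw [filter_eq_empty_iff.2 fun M _ h => hQ (hQdim M ((hGood M).1 h).1)]
    simp [hξ]
  have hQW : Q ≤ W := (hQM 0).trans (hMW 0)
  have : Fintype (Submodule F (ι → F)) := Fintype.ofFinite _
  have hseg := (hA Q W hQW (by rw [hQ, hr])).trans
    (mul_le_mul_of_nonneg_left (card_segment_le Q W (k := Fintype.card κ) (by omega)) hξ)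
  rw [Nat.card_eq_fintype_card, Fintype.card_subtype, hQ, Nat.sub_sub_self hPk] at hseg
  set t := P.rank * (finrank F W - Fintype.card κ) with ht
  set S : Finset (Submodule F (ι → F)) := {L | finrank F L = Fintype.card κ ∧ Q ≤ L ∧ L ≤ W ∧ A L}
    with hS
  have hcount : #{M | Good M} * Fintype.card F ^ t ≤ #S * Fintype.card (Matrix ι κ F) := by
    calc _ ≤ #(S.biUnion fun L => {M : Matrix ι κ F | colspan (T + P' * M * P) ≤ L})
            * Fintype.card F ^ t := by
          refine Nat.mul_le_mul_right _ (card_le_card fun M hM => ?_)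
          simp only [mem_filter, mem_univ, true_and, mem_biUnion, hS, hGood] at hM ⊢
          exact ⟨_, ⟨hM.1, hQM M, hMW M, hM.2⟩, le_rfl⟩
      _ ≤ (∑ L ∈ S, #{M : Matrix ι κ F | colspan (T + P' * M * P) ≤ L}) * Fintype.card F ^ t :=
          Nat.mul_le_mul_right _ card_biUnion_le
      _ ≤ _ := by
          rw [sum_mul, ← smul_eq_mul, ← sum_const]
          refine sum_le_sum fun L hL => ?_
          simp only [mem_filter, mem_univ, true_and, hS] at hL
          have := card_colspan_add_le_mul L T P P' hL.2.2.1
          rwa [hL.1] at this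
  have hcount' : (#{M | Good M} : ℝ) * (Fintype.card F : ℝ) ^ t
        ≤ #S * (Fintype.card (Matrix ι κ F) : ℝ) := by exact_mod_cast hcount
  have hqt : 0 < (Fintype.card F : ℝ) ^ t := pow_pos (by exact_mod_cast Fintype.card_pos) _
  rw [div_le_iff₀ hcardpos]
  refine le_of_mul_le_mul_right ?_ hqt
  have := mul_le_mul_of_nonneg_right hseg hcardpos.le
  linarith

theorem moment_res_spaceInd_le {A : Submodule F (ι → F) → Prop} {ξ : ℝ} (hξ : 0 ≤ ξ) {r : ℕ}
    (hrk : r ≤ Fintype.card κ)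
    (hA : ∀ Q W : Submodule F (ι → F), Q ≤ W → finrank F Q + (Fintype.card ι - finrank F W) = r →
      (Nat.card {L : Submodule F (ι → F) // finrank F L = Fintype.card κ ∧ Q ≤ L ∧ L ≤ W ∧ A L} : ℝ)
        ≤ ξ * Nat.card {L : Submodule F (ι → F) // finrank F L = Fintype.card κ ∧ Q ≤ L ∧ L ≤ W})
    (T : Matrix ι κ F) (P : Matrix κ κ F) (P' : Matrix ι ι F)
    (hr : Fintype.card κ + Fintype.card ι ≤ P.rank + P'.rank + r) :
    moment 1 (res T P P' (spaceInd A)) ≤ 4 * ξ := by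
  set W := colspan P' ⊔ colspan T with hW
  have h1 : P'.rank ≤ finrank F W := Submodule.finrank_mono (s := colspan P') le_sup_left
  have h2 : finrank F W ≤ Fintype.card ι := by
    simpa using W.finrank_le
  have hPk : P.rank ≤ Fintype.card κ := P.rank_le_card_width
  obtain ⟨E, hE⟩ := exists_rank_mul_eq P
    (s := Fintype.card κ - (r - (Fintype.card ι - finrank F W))) (by omega)
  have hsplit : moment 1 (res T P P' (spaceInd A))
      = 𝔼 N : Matrix ι κ F, moment 1 (res (T + P' * N * P) (E * P) P' (spaceInd A)) := by
    simp only [moment, GrassTest.res]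
    rw [expect_comm]
    have : ∀ M : Matrix ι κ F, 𝔼 N : Matrix ι κ F,
        ‖spaceInd A (T + P' * N * P + P' * M * (E * P))‖ ^ 1
          = 𝔼 N : Matrix ι κ F, ‖spaceInd A (T + P' * N * P)‖ ^ 1 := by
      intro M
      refine Fintype.expect_equiv (Equiv.addRight (M * E)) _ _ fun N => ?_
      simp only [Equiv.coe_addRight, Matrix.mul_add, Matrix.add_mul, Matrix.mul_assoc, add_assoc]
    simp only [this]
    rw [expect_const univ_nonempty]
  rw [hsplit]
  refine expect_le univ_nonempty fun N _ => ?_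
  have hW' : colspan P' ⊔ colspan (T + P' * N * P) = W := by
    apply le_antisymm
    · refine sup_le le_sup_left (colspan_le_iff.2 fun x => ?_)
      rw [Matrix.add_mulVec, Matrix.mul_assoc, ← Matrix.mulVec_mulVec]
      exact add_mem (Submodule.mem_sup_right (mulVec_mem_colspan _ _))
        (Submodule.mem_sup_left (mulVec_mem_colspan _ _))
    · refine sup_le le_sup_left (colspan_le_iff.2 fun x => ?_)
      have h3 := mulVec_mem_colspan (T + P' * N * P) x
      have hadd : (T + P' * N * P) *ᵥ x = T *ᵥ x + P' *ᵥ ((N * P) *ᵥ x) := by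
        rw [Matrix.add_mulVec, Matrix.mul_assoc, ← Matrix.mulVec_mulVec]
      rw [hadd] at h3
      have h4 := Submodule.sub_mem_sup h3 (mulVec_mem_colspan P' ((N * P) *ᵥ x))
      rw [add_sub_cancel_right, sup_comm] at h4
      exact h4
  exact moment_res_spaceInd_le_of_eq hξ hA _ _ _ (by rw [hE, hW']; omega)

/-- The table entry at `L` is the restriction of the functional `x ↦ c ⬝ᵥ x`. -/
def Agree (T : (L : Submodule F (ι → F)) → (L →ₗ[F] F)) (c : ι → F) (L : Submodule F (ι → F)) :
    Prop := ∀ (x : ι → F) (hx : x ∈ L), T L ⟨x, hx⟩ = c ⬝ᵥ x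

/-- The two table entries at `L` and `R` coincide on `L ⊓ R`. -/
def Compatible (T₁ T₂ : (L : Submodule F (ι → F)) → (L →ₗ[F] F)) (L R : Submodule F (ι → F)) :
    Prop := ∀ (x : ι → F) (hx2 : x ∈ R) (hx1 : x ∈ L), T₁ L ⟨x, hx1⟩ = T₂ R ⟨x, hx2⟩

theorem card_agree_mul (T : (L : Submodule F (ι → F)) → (L →ₗ[F] F)) (L : Submodule F (ι → F)) :
    #{c | Agree T c L} * Fintype.card F ^ finrank F L = Fintype.card (ι → F) := by
  have : Fintype (Module.Dual F L) := @Fintype.ofFinite _ (Module.finite_of_finite F)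
  let Ψ : (ι → F) →ₗ[F] Module.Dual F L :=
    L.subtype.dualMap ∘ₗ (dotProductEquiv F ι).toLinearMap
  have hΨ : Function.Surjective Ψ := by
    refine (LinearMap.dualMap_surjective_of_injective L.injective_subtype).comp
      (dotProductEquiv F ι).surjective
  have h := card_filter_comp_mul Ψ hΨ (fun y => y = T L)
  rw [card_eq_one.2 ⟨T L, by ext; simp⟩, one_mul, card_eq_pow_finrank (K := F)
    (V := Module.Dual F L), Subspace.dual_finrank_eq] at h
  rw [← h]
  congr 2
  ext c
  simp only [mem_filter, mem_univ, true_and]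
  constructor
  · intro hc
    ext ⟨x, hx⟩
    exact (hc x hx).symm
  · intro hc x hx
    exact (LinearMap.congr_fun hc ⟨x, hx⟩).symm

theorem expect_norm_spaceInd (T : (L : Submodule F (ι → F)) → (L →ₗ[F] F)) (M : Matrix ι κ F) :
    𝔼 c : ι → F, ‖spaceInd (Agree T c) M‖
      = if M.rank = Fintype.card κ then ((Fintype.card F : ℝ) ^ Fintype.card κ)⁻¹ else 0 := by
  unfold spaceInd
  by_cases h : M.rank = Fintype.card κ
  swap
  · simp [h]
  · rw [if_pos h]
    have h1 := card_agree_mul T (colspan M)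
    rw [finrank_colspan, h] at h1
    have h2 : (#{c | Agree T c (colspan M)} : ℝ) * (Fintype.card F : ℝ) ^ Fintype.card κ
        = Fintype.card (ι → F) := by exact_mod_cast h1
    have hq : (Fintype.card F : ℝ) ≠ 0 := by exact_mod_cast Fintype.card_ne_zero
    have hX : (Fintype.card (ι → F) : ℝ) ≠ 0 := by exact_mod_cast Fintype.card_ne_zero
    rw [Fintype.expect_eq_sum_div_card]
    have h3 : ∑ c : ι → F, ‖if M.rank = Fintype.card κ ∧ Agree T c (colspan M) then (1 : ℂ) else 0‖
        = #{c | Agree T c (colspan M)} := by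
      rw [card_filter]
      push_cast
      refine sum_congr rfl fun c _ => ?_
      by_cases hc : Agree T c (colspan M) <;> simp [h, hc]
    rw [h3, div_eq_iff hX, ← h2]
    field_simp

theorem expect_moment_spaceInd_le (T : (L : Submodule F (ι → F)) → (L →ₗ[F] F)) {μ : Type}
    [Fintype μ] (S : Matrix ι κ F → Matrix ι μ F) :
    𝔼 c : ι → F, moment 1 (fun M => spaceInd (Agree T c) (S M))
      ≤ ((Fintype.card F : ℝ) ^ Fintype.card μ)⁻¹ := by
  simp only [moment, pow_one]
  rw [expect_comm]
  refine expect_le univ_nonempty fun M _ => ?_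
  rw [expect_norm_spaceInd]
  split_ifs
  · exact le_rfl
  · positivity

theorem le_expect_moment_mul {μ : Type} [Fintype μ] (S : Matrix ι κ F → Matrix ι μ F)
    (hS : ∀ M, M.rank = Fintype.card κ → (S M).rank = Fintype.card μ)
    (hS' : ∀ M, colspan (S M) ≤ colspan M) (T₁ T₂ : (L : Submodule F (ι → F)) → (L →ₗ[F] F)) :
    (Nat.card {M : Matrix ι κ F // M.rank = Fintype.card κ ∧
        Compatible T₁ T₂ (colspan M) (colspan (S M))} : ℝ)
        / Nat.card (Matrix ι κ F) * ((Fintype.card F : ℝ) ^ Fintype.card κ)⁻¹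
      ≤ 𝔼 c : ι → F, moment 1 ((spaceInd (Agree T₁ c) : Matrix ι κ F → ℂ)
          * fun M => spaceInd (Agree T₂ c) (S M)) := by
  simp only [moment, pow_one]
  rw [expect_comm, Fintype.expect_eq_sum_div_card, div_mul_eq_mul_div, Nat.card_eq_fintype_card,
    Nat.card_eq_fintype_card, Fintype.card_subtype]
  refine div_le_div_of_nonneg_right ?_ (by positivity)
  rw [card_filter]
  push_cast
  rw [sum_mul]
  refine sum_le_sum fun M _ => ?_
  split_ifs with h
  · have h1 := expect_norm_spaceInd T₁ M
    rw [if_pos h.1] at h1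
    rw [one_mul, ← h1]
    refine expect_le_expect fun c _ => ?_
    rw [Pi.mul_apply, norm_mul]
    by_cases hc : Agree T₁ c (colspan M)
    · have hc2 : Agree T₂ c (colspan (S M)) := fun x hx => by
        rw [← h.2 x hx (hS' M hx)]
        exact hc x _
      have e : ‖spaceInd (Agree T₂ c) (S M)‖ = 1 := by
        simp [spaceInd, hS M h.1, hc2]
      rw [e, mul_one]
    · simp [spaceInd, hc]
  · rw [zero_mul]
    exact expect_nonneg fun _ _ => norm_nonneg _

theorem le_card_compatible {n m d : ℕ} {ε : ℝ} (hε : 0 < ε)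
    {T₁ T₂ : (L : Submodule F (Fin n → F)) → (L →ₗ[F] F)}
    (h : ε ≤ consistFrac F n (m + d) m T₁ T₂) :
    ε ≤ 4 * ((Nat.card {M : Matrix (Fin n) (Fin m ⊕ Fin d) F //
        M.rank = Fintype.card (Fin m ⊕ Fin d) ∧
          Compatible T₁ T₂ (colspan M) (colspan M.toCols₁)} : ℝ)
        / Nat.card (Matrix (Fin n) (Fin m ⊕ Fin d) F)) := by
  have hk : Fintype.card (Fin m ⊕ Fin d) = m + d := by simp
  obtain ⟨N₀, hN⟩ := exists_card_flag (F := F) (ι := Fin n) (μ := Fin m) (ν := Fin d)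
  have h1 := hN (Compatible T₁ T₂)
  have h2 := hN fun _ _ => True
  simp only [and_true] at h2
  simp only [hk, Fintype.card_fin] at h1 h2 ⊢
  change ε ≤ (Nat.card {p : Submodule F (Fin n → F) × Submodule F (Fin n → F) //
      finrank F p.1 = m + d ∧ finrank F p.2 = m ∧ p.2 ≤ p.1 ∧ Compatible T₁ T₂ p.1 p.2} : ℝ) /
    (Nat.card {p : Submodule F (Fin n → F) × Submodule F (Fin n → F) //
      finrank F p.1 = m + d ∧ finrank F p.2 = m ∧ p.2 ≤ p.1} : ℝ) at h
  set B := Nat.card {p : Submodule F (Fin n → F) × Submodule F (Fin n → F) //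
      finrank F p.1 = m + d ∧ finrank F p.2 = m ∧ p.2 ≤ p.1} with hB
  have hB0 : B ≠ 0 := by
    intro h0
    rw [h0, Nat.cast_zero, div_zero] at h
    linarith
  have hn : m + d ≤ n := by
    have : Nonempty {p : Submodule F (Fin n → F) × Submodule F (Fin n → F) //
      finrank F p.1 = m + d ∧ finrank F p.2 = m ∧ p.2 ≤ p.1} := by
      by_contra hne
      rw [not_nonempty_iff] at hne
      exact hB0 Nat.card_of_isEmpty
    obtain ⟨p, hp, _⟩ := this
    rw [← hp]
    simpa using p.1.finrank_le
  have h3 := pow_le_four_mul_card_rank (F := F) (ι := Fin n) (κ := Fin m ⊕ Fin d) (by simpa using hn)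
  simp only [hk] at h3
  have hX : (Nat.card (Matrix (Fin n) (Fin m ⊕ Fin d) F) : ℝ)
      = (Fintype.card F : ℝ) ^ (Fintype.card (Fin n) * (m + d)) := by
    rw [Matrix, Nat.card_fun, Nat.card_fun, ← pow_mul]
    simp [mul_comm]
  rw [← hX, h2] at h3
  rw [h1]
  have hXpos : (0 : ℝ) < Nat.card (Matrix (Fin n) (Fin m ⊕ Fin d) F) := by
    exact_mod_cast Nat.card_pos
  have hBpos : (0 : ℝ) < B := by exact_mod_cast Nat.pos_of_ne_zero hB0
  rw [le_div_iff₀ hBpos] at h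
  rw [← mul_div_assoc, le_div_iff₀ hXpos]
  push_cast at h3 ⊢
  calc ε * _ ≤ ε * (4 * (B * N₀)) := by gcongr
    _ = 4 * (ε * B * N₀) := by ring
    _ ≤ _ := by gcongr

theorem colspan_mul_of_isUnit (M : Matrix ι κ F) {g : Matrix κ κ F} (hg : IsUnit g) :
    colspan (M * g) = colspan M := by
  rw [colspan_mul, colspan, LinearMap.range_eq_top.2 (mulVec_surjective_iff_isUnit.2 hg),
    Submodule.map_top]
  rfl

theorem spaceInd_eq (A : Submodule F (ι → F) → Prop) (M : Matrix ι κ F) :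
    spaceInd A M = 0 ∨ spaceInd A M = 1 := by
  unfold spaceInd
  split_ifs <;> simp

theorem spaceInd_mul_of_isUnit (A : Submodule F (ι → F) → Prop) {g : Matrix κ κ F} (hg : IsUnit g)
    (M : Matrix ι κ F) : spaceInd A (M * g) = spaceInd A M := by
  unfold spaceInd
  rw [← finrank_colspan, ← finrank_colspan, colspan_mul_of_isUnit M hg]

theorem moment_one_mul_le {f h : Matrix ι κ F → ℂ} (hf : ∀ M, f M = 0 ∨ f M = 1) :
    moment 1 (f * h) ≤ moment 1 h := by
  refine expect_le_expect fun M _ => ?_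
  rcases hf M with h | h <;> simp [h]

/-- A functional for which the correlation dominates the densities of the two agreement sets. -/
theorem exists_correlated_functional {μ : Type} [Fintype μ] (S : Matrix ι κ F → Matrix ι μ F)
    (hS : ∀ M, M.rank = Fintype.card κ → (S M).rank = Fintype.card μ)
    (hS' : ∀ M, colspan (S M) ≤ colspan M) (T₁ T₂ : (L : Submodule F (ι → F)) → (L →ₗ[F] F))
    {d : ℕ} (hd : Fintype.card κ = Fintype.card μ + d) {ε : ℝ} (hε0 : 0 ≤ ε)
    (hε : ε ≤ 4 * ((Nat.card {M : Matrix ι κ F // M.rank = Fintype.card κ ∧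
        Compatible T₁ T₂ (colspan M) (colspan (S M))} : ℝ) / Nat.card (Matrix ι κ F))) :
    ∃ c : ι → F, ε / 16 * (moment 1 (spaceInd (Agree T₁ c) : Matrix ι κ F → ℂ)
        + moment 1 (fun M => spaceInd (Agree T₂ c) (S M)) / (Fintype.card F : ℝ) ^ d
        + 1 / (Fintype.card F : ℝ) ^ Fintype.card κ)
      ≤ moment 1 ((spaceInd (Agree T₁ c) : Matrix ι κ F → ℂ)
          * fun M => spaceInd (Agree T₂ c) (S M)) := by
  have h0 := le_expect_moment_mul S hS hS' T₁ T₂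
  have h1 := expect_moment_spaceInd_le (F := F) T₁ (fun M : Matrix ι κ F => M)
  have h2 := expect_moment_spaceInd_le T₂ S
  have hq : (0 : ℝ) < Fintype.card F := by exact_mod_cast Fintype.card_pos
  suffices h : 𝔼 c : ι → F, ε / 16 * (moment 1 (spaceInd (Agree T₁ c) : Matrix ι κ F → ℂ)
        + moment 1 (fun M => spaceInd (Agree T₂ c) (S M)) / (Fintype.card F : ℝ) ^ d
        + 1 / (Fintype.card F : ℝ) ^ Fintype.card κ)
      ≤ 𝔼 c : ι → F, moment 1 ((spaceInd (Agree T₁ c) : Matrix ι κ F → ℂ)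
          * fun M => spaceInd (Agree T₂ c) (S M)) by
    obtain ⟨c, _, hc⟩ := exists_le_of_expect_le_expect univ_nonempty h
    exact ⟨c, hc⟩
  refine le_trans ?_ h0
  rw [← mul_expect, expect_add_distrib, expect_add_distrib, ← expect_div,
    expect_const univ_nonempty]
  set u := ((Fintype.card F : ℝ) ^ Fintype.card κ)⁻¹ with hu
  have hu0 : 0 ≤ u := by positivity
  have h2' : (𝔼 c : ι → F, moment 1 fun M => spaceInd (Agree T₂ c) (S M))
      / (Fintype.card F : ℝ) ^ d ≤ u := by
    rw [hu, hd, pow_add, mul_inv, div_eq_mul_inv]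
    gcongr
  rw [one_div]
  have h3 := mul_le_mul_of_nonneg_right hε hu0
  calc _ ≤ ε / 16 * (u + u + u) := by
        refine mul_le_mul_of_nonneg_left ?_ (by positivity)
        exact add_le_add (add_le_add h1 h2') le_rfl
    _ ≤ _ := by nlinarith [mul_nonneg hε0 hu0]

theorem false_of_subspace_density (F : Type) [Field F] [Fintype F] (r : ℕ) :
    ∃ K₀ : ℕ, ∀ (ι κ μ : Type) [Fintype ι] [Fintype κ] [Fintype μ] (d : ℕ) (J : Finset κ)
      (S : Matrix ι κ F → Matrix ι μ F) (T₁ T₂ : (L : Submodule F (ι → F)) → (L →ₗ[F] F))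
      (ε ξ : ℝ), K₀ ≤ Fintype.card κ → 1 ≤ Fintype.card κ → r ≤ Fintype.card κ →
      Fintype.card κ = Fintype.card μ + d → #J = d → d * r = 10 * Fintype.card κ →
      (∀ M, M.rank = Fintype.card κ → (S M).rank = Fintype.card μ) →
      (∀ M, colspan (S M) ≤ colspan M) →
      (∀ s ∈ J, ∀ M w, S (M + vecMulVec w (Pi.single s 1)) = S M) → 0 ≤ ξ → 0 ≤ ε →
      (Fintype.card F : ℝ) ^ (1000 * d) ≤ ε * (Fintype.card F : ℝ) ^ Fintype.card κ →
      ξ * (Fintype.card F : ℝ) ^ Fintype.card κ ≤ (Fintype.card F : ℝ) ^ d →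
      ε ≤ 4 * ((Nat.card {M : Matrix ι κ F // M.rank = Fintype.card κ ∧
        Compatible T₁ T₂ (colspan M) (colspan (S M))} : ℝ) / Nat.card (Matrix ι κ F)) →
      (∀ (c : ι → F) (Q W : Submodule F (ι → F)), Q ≤ W →
        finrank F Q + (Fintype.card ι - finrank F W) = r →
        (Nat.card {L : Submodule F (ι → F) //
            finrank F L = Fintype.card κ ∧ Q ≤ L ∧ L ≤ W ∧ Agree T₁ c L} : ℝ)
          ≤ ξ * Nat.card {L : Submodule F (ι → F) //
            finrank F L = Fintype.card κ ∧ Q ≤ L ∧ L ≤ W}) → False := by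
  obtain ⟨C, hC, hcorr⟩ := exists_correlation_bound F r r
  obtain ⟨K₀, hK₀⟩ := pow_unbounded_of_one_lt
    (256 ^ (2 ^ (r + 1) + 1) * 2 ^ 2 ^ (r + 1) * 4 ^ (2 ^ (r + 1) - 1) * C) (one_lt_two (α := ℝ))
  have hq : (2 : ℝ) ≤ Fintype.card F := by exact_mod_cast Fintype.one_lt_card
  refine ⟨K₀, fun ι κ μ _ _ _ d J S T₁ T₂ ε ξ hK hk hr hd hJ hdr hS hS' hinv hξ hε0 hεq hξq hε hA => ?_⟩
  obtain ⟨c, hc⟩ := exists_correlated_functional S hS hS' T₁ T₂ hd hε0 hε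
  obtain ⟨lo, hlo0, hlop, hlo⟩ := hcorr ι κ (4 * ξ) (spaceInd (Agree T₁ c))
    (fun M => spaceInd (Agree T₂ c) (S M)) J (spaceInd_eq _) (fun M => spaceInd_eq _ _)
    (fun g hg M => spaceInd_mul_of_isUnit _ hg M) (fun s hs M w => by simp only [hinv s hs M w])
    (fun T P P' h => moment_res_spaceInd_le hξ hr (hA c) T P P' h)
  rw [hJ] at hlo
  have hp : r ≤ 2 ^ (r + 1) := (Nat.lt_two_pow_self.trans_le (Nat.pow_le_pow_right two_pos r.le_succ)).le
  refine correlation_contradiction hq (moment_nonneg _ _) (moment_nonneg _ _)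
    (by positivity : 0 ≤ 4 * ξ) hC (moment_one_mul_le (spaceInd_eq _)) ?_ hc hlo hlop hdr hk hp
    (by linarith) (hK₀.trans_le ?_)
  · have : 0 ≤ ε * (Fintype.card F : ℝ) ^ Fintype.card κ := by positivity
    linarith
  · exact (pow_le_pow_right₀ one_le_two hK).trans (pow_le_pow_left₀ two_pos.le hq _)

/-- Consistency of the two tables forces agreement of `T₁` with a global functional on a zoom. -/
theorem exists_zoom (F : Type) [Field F] [Fintype F] (r : ℕ) :
    ∃ K₀ : ℕ, ∀ (n m d : ℕ) (T₁ T₂ : (L : Submodule F (Fin n → F)) → (L →ₗ[F] F))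
      (ε ξ : ℝ), K₀ ≤ m + d → 1 ≤ m + d → r ≤ m + d → d * r = 10 * (m + d) → 0 ≤ ξ → 0 < ε →
      (Fintype.card F : ℝ) ^ (1000 * d) ≤ ε * (Fintype.card F : ℝ) ^ (m + d) →
      ξ * (Fintype.card F : ℝ) ^ (m + d) ≤ (Fintype.card F : ℝ) ^ d →
      ε ≤ consistFrac F n (m + d) m T₁ T₂ →
      ∃ (c : Fin n → F) (Q W : Submodule F (Fin n → F)), Q ≤ W ∧
        finrank F Q + (n - finrank F W) = r ∧
        ξ * (Nat.card {L : Submodule F (Fin n → F) //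
            finrank F L = m + d ∧ Q ≤ L ∧ L ≤ W} : ℝ)
          ≤ Nat.card {L : Submodule F (Fin n → F) //
            finrank F L = m + d ∧ Q ≤ L ∧ L ≤ W ∧ Agree T₁ c L} := by
  obtain ⟨K₀, h⟩ := false_of_subspace_density F r
  refine ⟨K₀, fun n m d T₁ T₂ ε ξ hK hk hr hdr hξ hε hεq hξq hcons => ?_⟩
  by_contra! hcon
  have hcard : Fintype.card (Fin m ⊕ Fin d) = m + d := by simp
  refine h (Fin n) (Fin m ⊕ Fin d) (Fin m) d (univ.map Function.Embedding.inr) toCols₁ T₁ T₂ ε ξ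
    (by rwa [hcard]) (by rwa [hcard]) (by rwa [hcard]) (by simp) (by simp) (by rwa [hcard])
    (fun M => rank_toCols₁) colspan_toCols₁_le ?_ hξ hε.le (by rwa [hcard]) (by rwa [hcard])
    (le_card_compatible hε hcons) fun c Q W hQW hr' => ?_
  · intro s hs M w
    obtain ⟨j, -, rfl⟩ := Finset.mem_map.1 hs
    ext a b
    simp [toCols₁, vecMulVec_apply]
  · rw [Fintype.card_fin] at hr'
    rw [hcard]
    exact (hcon c Q W hQW hr').le

/-- The consistency fraction is a probability. -/
theorem consistFrac_le_one (n k m : ℕ) (T₁ T₂ : (L : Submodule F (Fin n → F)) → (L →ₗ[F] F)) :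
    consistFrac F n k m T₁ T₂ ≤ 1 := by
  refine div_le_one_of_le₀ ?_ (Nat.cast_nonneg _)
  refine Nat.cast_le.2 (Nat.card_le_card_of_injective
    (Subtype.impEmbedding _ _ fun _ h => ?_) (Function.Embedding.injective _))
  exact ⟨h.1, h.2.1, h.2.2.1⟩

end GrassTest
end

/-- Theorem 5.1, soundness of the subspace agreement test.  Let `q` be a
prime power and `0 < δ < 1/2` with `10/δ ∈ ℕ`.  For all sufficiently large `ℓ` (with
`2(1-δ)ℓ ∈ ℕ`) and all sufficiently large `n`, if tables `T₁` on `Grass_q(n, 2ℓ)` and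
`T₂` on `Grass_q(n, 2(1-δ)ℓ)` are `ε`-consistent for some `ε ≥ q^(-2(1-1000δ)ℓ)`, then
there are subspaces `Q ⊆ W ⊆ F_q^n` and a linear `f : W → F_q` with
`dim Q + codim W = 10/δ` such that `f` agrees with `T₁[L]` for at least a
`q^(-2(1-1000δ²)ℓ)` fraction of the `2ℓ`-dimensional `L` with `Q ⊆ L ⊆ W`. -/
theorem stmt4 (F : Type) [Field F] [Fintype F] (δ : ℝ) (hδ0 : 0 < δ) (hδ : δ < 1 / 2)
    (rr : ℕ) (hrr : (rr : ℝ) = 10 / δ) :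
    ∃ ℓ₀ : ℕ, ∀ ℓ : ℕ, ℓ₀ ≤ ℓ → ∀ m : ℕ, (m : ℝ) = 2 * (1 - δ) * ℓ →
      ∃ n₀ : ℕ, ∀ n : ℕ, n₀ ≤ n →
        ∀ (T₁ T₂ : (L : Submodule F (Fin n → F)) → (↥L →ₗ[F] F)) (ε : ℝ),
          (Fintype.card F : ℝ) ^ (-(2 * (1 - 1000 * δ) * ℓ)) ≤ ε →
          ε ≤ consistFrac F n (2 * ℓ) m T₁ T₂ →
          ∃ (Q W : Submodule F (Fin n → F)) (f : ↥W →ₗ[F] F),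
            Q ≤ W ∧
            finrank F ↥Q + (n - finrank F ↥W) = rr ∧
            (Fintype.card F : ℝ) ^ (-(2 * (1 - 1000 * δ ^ 2) * ℓ)) *
                (Nat.card {L : Submodule F (Fin n → F) //
                  finrank F ↥L = 2 * ℓ ∧ Q ≤ L ∧ L ≤ W} : ℝ) ≤
              (Nat.card {L : Submodule F (Fin n → F) //
                finrank F ↥L = 2 * ℓ ∧ Q ≤ L ∧ L ≤ W ∧
                  ∀ (x : Fin n → F) (hxL : x ∈ L) (hxW : x ∈ W),
                    f ⟨x, hxW⟩ = T₁ L ⟨x, hxL⟩} : ℝ) := by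
  obtain ⟨K₀, hzoom⟩ := GrassTest.exists_zoom F rr
  refine ⟨max K₀ (max rr 1), fun ℓ hℓ m hm => ⟨0, fun n _ T₁ T₂ ε hε hcons => ?_⟩⟩
  obtain ⟨hℓK, hℓr, hℓ1⟩ : K₀ ≤ ℓ ∧ rr ≤ ℓ ∧ 1 ≤ ℓ := by simpa using hℓ
  have hℓ' : (1 : ℝ) ≤ ℓ := by exact_mod_cast hℓ1
  have hq1 : (1 : ℝ) < Fintype.card F := by exact_mod_cast Fintype.one_lt_card
  have hq0 : (0 : ℝ) < Fintype.card F := by linarith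
  have hmℓ : m ≤ 2 * ℓ := by
    have : (m : ℝ) ≤ 2 * ℓ := by rw [hm]; nlinarith
    exact_mod_cast this
  obtain ⟨d, hd⟩ := Nat.exists_eq_add_of_le hmℓ
  have hdR : (d : ℝ) = 2 * δ * ℓ := by
    have : (2 * ℓ : ℝ) = m + d := by exact_mod_cast hd
    linarith
  have hdr : d * rr = 10 * (m + d) := by
    rw [← hd]
    have : (d : ℝ) * rr = 10 * (2 * ℓ) := by rw [hdR, hrr]; field_simp
    exact_mod_cast this
  have hδ' : δ ≤ 1 / 1000 := by
    by_contra! hcon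
    have h1 := (hε.trans hcons).trans (GrassTest.consistFrac_le_one _ _ _ _ _)
    have h2 := Real.one_lt_rpow hq1 (show 0 < -(2 * (1 - 1000 * δ) * ℓ) by nlinarith)
    linarith
  have hkR : ((m + d : ℕ) : ℝ) = 2 * ℓ := by rw [← hd]; push_cast; ring
  have hε0 : 0 < ε := (Real.rpow_pos_of_pos hq0 _).trans_le hε
  rw [hd] at hcons ⊢
  obtain ⟨c, Q, W, hQW, hr, hle⟩ := hzoom n m d T₁ T₂ ε
    ((Fintype.card F : ℝ) ^ (-(2 * (1 - 1000 * δ ^ 2) * ℓ))) (by omega) (by omega) (by omega) hdr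
    (Real.rpow_nonneg hq0.le _) hε0 (by
      refine le_trans (le_of_eq ?_) (mul_le_mul_of_nonneg_right hε (by positivity))
      rw [← Real.rpow_natCast, ← Real.rpow_natCast, ← Real.rpow_add hq0]
      congr 1
      rw [hkR]; push_cast; rw [hdR]; ring) (by
      rw [← Real.rpow_natCast _ (m + d), ← Real.rpow_natCast _ d, ← Real.rpow_add hq0]
      refine Real.rpow_le_rpow_of_exponent_le hq1.le ?_
      rw [hkR, hdR]
      nlinarith [mul_nonneg (mul_nonneg hδ0.le (by linarith : (0 : ℝ) ≤ ℓ)) (sub_nonneg.2 hδ')]) hcons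
  refine ⟨Q, W, (dotProductEquiv F (Fin n) c).comp W.subtype, hQW, hr, hle.trans_eq ?_⟩
  congr 1
  refine Nat.card_congr (Equiv.subtypeEquivRight fun L => ?_)
  refine and_congr_right fun _ => and_congr_right fun _ => and_congr_right fun hLW => ?_
  exact ⟨fun h x hxL _ => (h x hxL).symm, fun h x hxL => (h x hxL (hLW hxL)).symm⟩
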